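/- For every k ≥ 1, every n, and every degree i ≥ 0 with 2i ≤ n − 4k, the group cohomology H^i(Aut(F_n); (H^*)^{⊗k}) is zero, where (H^*)^{⊗k} is the k-fold tensor power (over Z) of the dual of the abelianization of F_n, with Aut(F_n) acting diagonally. -/

import Mathlib

open CategoryTheory

noncomputable section

/-- The free group on `n` generators. -/
abbrev FreeGrp (n : ℕ) : Type := FreeGroup (Fin n)

/-- The automorphism group `Aut(F_n)` of the free group on `n` generators. -/
abbrev AutF (n : ℕ) : Type := MulAut (FreeGrp n)

/-- The abelianization `H = F_n/[F_n,F_n]`, written additively, as a `ℤ`-module. -/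
abbrev AbH (n : ℕ) : Type := Additive (Abelianization (FreeGrp n))

/-- The natural action of `Aut(F_n)` on the abelianization `H`, as a `ℤ`-linear
representation. -/
def abRep (n : ℕ) : Representation ℤ (AutF n) (AbH n) where
  toFun φ := (MonoidHom.toAdditive (Abelianization.map φ.toMonoidHom)).toIntLinearMap
  map_one' := by
    ext x
    show MonoidHom.toAdditive (Abelianization.map (MulEquiv.toMonoidHom (1 : AutF n))) x = x
    rw [show MulEquiv.toMonoidHom (1 : AutF n) = MonoidHom.id _ from rfl, Abelianization.map_id]
    rfl
  map_mul' φ ψ := by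
    ext x
    show MonoidHom.toAdditive (Abelianization.map (MulEquiv.toMonoidHom (φ * ψ))) x =
      MonoidHom.toAdditive (Abelianization.map φ.toMonoidHom)
        (MonoidHom.toAdditive (Abelianization.map ψ.toMonoidHom) x)
    rw [show MulEquiv.toMonoidHom (φ * ψ) = φ.toMonoidHom.comp ψ.toMonoidHom from rfl,
      ← Abelianization.map_comp]
    rfl

open scoped TensorProduct

/-- The `k`-fold tensor power of a representation, with the diagonal action. -/
def tensorPowerRep {R G V : Type} [CommRing R] [Group G] [AddCommGroup V] [Module R V]
    (ρ : Representation R G V) (k : ℕ) : Representation R G (⨂[R]^k V) where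
  toFun g := PiTensorProduct.map (fun _ => ρ g)
  map_one' := by
    show PiTensorProduct.map (fun _ : Fin k => ρ 1) = 1
    have h : (fun _ : Fin k => ρ 1) = fun _ : Fin k => (1 : V →ₗ[R] V) := by simp
    rw [h, PiTensorProduct.map_one]
  map_mul' g g' := by
    show PiTensorProduct.map (fun _ : Fin k => ρ (g * g')) =
      PiTensorProduct.map (fun _ : Fin k => ρ g) * PiTensorProduct.map (fun _ : Fin k => ρ g')
    have h : (fun _ : Fin k => ρ (g * g')) = fun _ : Fin k => (ρ g * ρ g') := by
      funext i; rw [map_mul]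
    rw [h, PiTensorProduct.map_mul]

/-- The `k`-fold tensor power `(H^*)^{⊗k}` of the dual of the abelianization, with the
diagonal `Aut(F_n)`-action, as an object of `Rep ℤ (Aut F_n)`. -/
def dualTensorPowerRep (n k : ℕ) : Rep ℤ (AutF n) :=
  Rep.of (tensorPowerRep (abRep n).dual k)

namespace GrpCoh

section Cochains
variable {G S M A : Type} [Group G] [Group S] [AddCommGroup M] [AddCommGroup A]

/-- The differential on inhomogeneous cochains. -/
def dC (ρ : Representation ℤ G M) (q : ℕ) (c : (Fin q → G) → M) : (Fin (q + 1) → G) → M :=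
  fun g => ρ (g 0) (c fun i => g i.succ) +
    ∑ j : Fin (q + 1), (-1 : ℤ) ^ ((j : ℕ) + 1) • c (Fin.contractNth j (· * ·) g)

theorem dC_eq (ρ : Representation ℤ G M) (q : ℕ) (c : (Fin q → G) → M) :
    dC ρ q c = (groupCohomology.inhomogeneousCochains (Rep.of ρ)).d q (q + 1) c := by
  rw [groupCohomology.inhomogeneousCochains.d_def]
  rfl

theorem dC_dC (ρ : Representation ℤ G M) (q : ℕ) (c : (Fin q → G) → M) :
    dC ρ (q + 1) (dC ρ q c) = 0 := by
  rw [dC_eq, dC_eq]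
  exact congrArg (fun f => f.hom c)
    ((groupCohomology.inhomogeneousCochains (Rep.of ρ)).d_comp_d q (q + 1) (q + 2))

theorem dC_sub (ρ : Representation ℤ G M) (q : ℕ) (c c' : (Fin q → G) → M) :
    dC ρ q (c - c') = dC ρ q c - dC ρ q c' := by
  simp only [dC_eq]; exact map_sub _ _ _

theorem dC_zero (ρ : Representation ℤ G M) (q : ℕ) :
    dC ρ q (0 : (Fin q → G) → M) = 0 := by
  simp only [dC_eq]; exact map_zero _

theorem dC_degree_zero (ρ : Representation ℤ G M) (c : (Fin 0 → G) → M) (g : Fin 1 → G)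
    (e : Fin 0 → G) : dC ρ 0 c g = ρ (g 0) (c e) - c e := by
  have h : ∀ a b : Fin 0 → G, a = b := fun a b => Subsingleton.elim _ _
  rw [dC, Fin.sum_univ_one, h (fun _ => _) e, h (Fin.contractNth _ _ _) e]
  simp [sub_eq_add_neg]

/-- The map on cochains induced by a group homomorphism and an additive map. -/
def pull (φ : S →* G) (f : M →+ A) {q : ℕ} (c : (Fin q → G) → M) : (Fin q → S) → A :=
  fun s => f (c fun i => φ (s i))

/-- Compatibility of a coefficient map with the actions. -/
def Compat (ρ : Representation ℤ G M) (σ : Representation ℤ S A) (φ : S →* G) (f : M →+ A) : Prop :=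
  ∀ s m, f (ρ (φ s) m) = σ s (f m)

theorem dC_pull {ρ : Representation ℤ G M} {σ : Representation ℤ S A} {φ : S →* G} {f : M →+ A}
    (h : Compat ρ σ φ f) {q : ℕ} (c : (Fin q → G) → M) :
    dC σ q (pull φ f c) = pull φ f (dC ρ q c) := by
  funext s
  simp only [dC, pull, map_add, map_sum, map_zsmul, h _ _]
  congr 1
  refine Finset.sum_congr rfl fun j _ => ?_
  congr 3
  funext i
  simp only [Fin.contractNth]
  split_ifs <;> simp

theorem pull_sub (φ : S →* G) (f : M →+ A) {q : ℕ} (c c' : (Fin q → G) → M) :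
    pull φ f (c - c') = pull φ f c - pull φ f c' := by
  funext s; simp [pull]

theorem pull_zero (φ : S →* G) (f : M →+ A) {q : ℕ} :
    pull φ f (0 : (Fin q → G) → M) = 0 := by
  funext s; simp [pull]

/-- Coboundaries. -/
def IsB (ρ : Representation ℤ G M) : (q : ℕ) → ((Fin q → G) → M) → Prop
  | 0, c => c = 0
  | q + 1, c => ∃ b, c = dC ρ q b

theorem IsB.zero (ρ : Representation ℤ G M) (q : ℕ) : IsB ρ q 0 := by
  cases q with
  | zero => rfl
  | succ q => exact ⟨0, (dC_zero ρ q).symm⟩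

theorem IsB.sub {ρ : Representation ℤ G M} {q : ℕ} {c c' : (Fin q → G) → M}
    (h : IsB ρ q c) (h' : IsB ρ q c') : IsB ρ q (c - c') := by
  cases q with
  | zero => simp_all [IsB]
  | succ q =>
    obtain ⟨b, rfl⟩ := h
    obtain ⟨b', rfl⟩ := h'
    exact ⟨b - b', (dC_sub _ _ _ _).symm⟩

theorem IsB.pull {ρ : Representation ℤ G M} {σ : Representation ℤ S A} {φ : S →* G} {f : M →+ A}
    (h : Compat ρ σ φ f) {q : ℕ} {c : (Fin q → G) → M} (hc : IsB ρ q c) :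
    IsB σ q (pull φ f c) := by
  cases q with
  | zero => rw [show c = 0 from hc, pull_zero]; rfl
  | succ q => obtain ⟨b, rfl⟩ := hc; exact ⟨_, (dC_pull h b).symm⟩

/-- Vanishing of the cohomology in degree `q`. -/
def Van (ρ : Representation ℤ G M) (q : ℕ) : Prop :=
  ∀ c, dC ρ q c = 0 → IsB ρ q c

/-- Injectivity on cohomology in degree `q` of the map induced by a compatible pair. -/
def Inj (ρ : Representation ℤ G M) (σ : Representation ℤ S A) (φ : S →* G) (f : M →+ A) (q : ℕ) :
    Prop :=
  ∀ c, dC ρ q c = 0 → IsB σ q (pull φ f c) → IsB ρ q c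

theorem Van.of_inj {ρ : Representation ℤ G M} {σ : Representation ℤ S A} {φ : S →* G} {f : M →+ A}
    (h : Compat ρ σ φ f) {q : ℕ} (hi : Inj ρ σ φ f q) (hv : Van σ q) : Van ρ q := fun c hc =>
  hi c hc (hv _ (by rw [dC_pull h, hc, pull_zero]))

end Cochains

section Exact
variable {G M N Q : Type} [Group G] [AddCommGroup M] [AddCommGroup N] [AddCommGroup Q]

/-- A short exact sequence of representations. -/
structure SES (ρ : Representation ℤ G M) (ν : Representation ℤ G N) (κ : Representation ℤ G Q)
    (j : M →+ N) (p : N →+ Q) : Prop where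
  cj : Compat ρ ν (MonoidHom.id G) j
  cp : Compat ν κ (MonoidHom.id G) p
  inj : Function.Injective j
  surj : Function.Surjective p
  comp : ∀ m, p (j m) = 0
  ex : ∀ n, p n = 0 → ∃ m, j m = n

variable {ρ : Representation ℤ G M} {ν : Representation ℤ G N} {κ : Representation ℤ G Q}
    {j : M →+ N} {p : N →+ Q}

namespace SES

theorem lift (h : SES ρ ν κ j p) {q : ℕ} (c : (Fin q → G) → Q) :
    ∃ b, pull (MonoidHom.id G) p b = c := by
  choose s hs using h.surj
  exact ⟨fun g => s (c g), by funext g; exact hs _⟩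

theorem lift_ker (h : SES ρ ν κ j p) {q : ℕ} (c : (Fin q → G) → N)
    (hc : pull (MonoidHom.id G) p c = 0) : ∃ b, pull (MonoidHom.id G) j b = c := by
  choose s hs using h.ex
  exact ⟨fun g => s (c g) (congrFun hc g), by funext g; exact hs _ _⟩

theorem pull_inj (h : SES ρ ν κ j p) {q : ℕ} {c c' : (Fin q → G) → M}
    (hc : pull (MonoidHom.id G) j c = pull (MonoidHom.id G) j c') : c = c' := by
  funext g
  exact h.inj (congrFun hc g)

theorem pull_pull (h : SES ρ ν κ j p) {q : ℕ} (c : (Fin q → G) → M) :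
    pull (MonoidHom.id G) p (pull (MonoidHom.id G) j c) = 0 := by
  funext g
  exact h.comp _

/-- If a class of the submodule dies in the middle term then it comes from a cocycle of the
quotient. -/
theorem connecting (h : SES ρ ν κ j p) {q : ℕ} {b : (Fin q → G) → N} {c : (Fin (q + 1) → G) → M}
    (hb : pull (MonoidHom.id G) j c = dC ν q b) : dC κ q (pull (MonoidHom.id G) p b) = 0 := by
  rw [dC_pull h.cp, ← hb, h.pull_pull]

/-- The class of the submodule vanishes as soon as the class of the quotient lifts. -/
theorem isB_of_lift (h : SES ρ ν κ j p) {q : ℕ} {b z : (Fin q → G) → N}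
    {c : (Fin (q + 1) → G) → M} (hb : pull (MonoidHom.id G) j c = dC ν q b) (hz : dC ν q z = 0)
    (hbz : IsB κ q (pull (MonoidHom.id G) p (b - z))) : IsB ρ (q + 1) c := by
  cases q with
  | zero =>
    obtain ⟨a, ha⟩ := h.lift_ker _ hbz
    refine ⟨a, h.pull_inj ?_⟩
    rw [hb, ← dC_pull h.cj, ha, dC_sub, hz, sub_zero]
  | succ q =>
    obtain ⟨e, he⟩ := hbz
    obtain ⟨e', rfl⟩ := h.lift e
    obtain ⟨a, ha⟩ := h.lift_ker (b - z - dC ν q e')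
      (by rw [pull_sub, he, dC_pull h.cp, sub_self])
    refine ⟨a, h.pull_inj ?_⟩
    rw [hb, ← dC_pull h.cj, ha, dC_sub, dC_sub, hz, dC_dC, sub_zero, sub_zero]

theorem inj_zero (h : SES ρ ν κ j p) : Inj ρ ν (MonoidHom.id G) j 0 := fun c _ hc =>
  h.pull_inj (hc.trans (pull_zero _ _).symm)

theorem inj_succ (h : SES ρ ν κ j p) {q : ℕ} (hq : Van κ q) :
    Inj ρ ν (MonoidHom.id G) j (q + 1) := by
  rintro _ - ⟨b, hb⟩
  exact h.isB_of_lift hb (dC_zero ν q) (by rw [sub_zero]; exact hq _ (h.connecting hb))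

theorem van_sub (h : SES ρ ν κ j p) {q : ℕ} (hq : Van κ q) (hn : Van ν (q + 1)) :
    Van ρ (q + 1) :=
  Van.of_inj h.cj (h.inj_succ hq) hn

theorem van_sub_zero (h : SES ρ ν κ j p) (hn : Van ν 0) : Van ρ 0 :=
  Van.of_inj h.cj h.inj_zero hn

/-- If the connecting class of a cocycle of the quotient vanishes then it lifts. -/
theorem exists_lift (h : SES ρ ν κ j p) {q : ℕ} (hq : Van ρ (q + 1)) {c : (Fin q → G) → Q}
    (hc : dC κ q c = 0) : ∃ z, dC ν q z = 0 ∧ pull (MonoidHom.id G) p z = c := by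
  obtain ⟨b, rfl⟩ := h.lift c
  obtain ⟨a, ha⟩ := h.lift_ker (dC ν q b) (by rw [← dC_pull h.cp, hc])
  obtain ⟨e, he⟩ := hq a (h.pull_inj (by rw [← dC_pull h.cj, ha, dC_dC, pull_zero]))
  refine ⟨b - pull (MonoidHom.id G) j e, ?_, ?_⟩
  · rw [dC_sub, dC_pull h.cj, ← he, ha, sub_self]
  · rw [pull_sub, h.pull_pull, sub_zero]

theorem van_quot (h : SES ρ ν κ j p) {q : ℕ} (hn : Van ν q) (hq : Van ρ (q + 1)) : Van κ q := by
  intro c hc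
  obtain ⟨z, hz, rfl⟩ := h.exists_lift hq hc
  exact (hn z hz).pull h.cp

end SES
end Exact

section Constructions
variable {G S M A N : Type} [Group G] [Group S] [AddCommGroup M] [AddCommGroup A] [AddCommGroup N]

/-- Build a representation over `ℤ` from additive maps. -/
def mkRep (a : G → M →+ M) (h1 : ∀ m, a 1 m = m) (hm : ∀ g g' m, a (g * g') m = a g (a g' m)) :
    Representation ℤ G M where
  toFun g := (a g).toIntLinearMap
  map_one' := by ext m; exact h1 m
  map_mul' g g' := by ext m; exact hm g g' m

@[simp] theorem mkRep_apply (a : G → M →+ M) (h1) (hm) (g : G) (m : M) :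
    mkRep a h1 hm g m = a g m := rfl

theorem rep_one (ρ : Representation ℤ G M) (m : M) : ρ 1 m = m := by simp

theorem rep_mul (ρ : Representation ℤ G M) (g g' : G) (m : M) : ρ (g * g') m = ρ g (ρ g' m) := by
  simp

theorem rep_inv_self (ρ : Representation ℤ G M) (g : G) (m : M) : ρ g⁻¹ (ρ g m) = m := by
  rw [← rep_mul, inv_mul_cancel, rep_one]

theorem rep_self_inv (ρ : Representation ℤ G M) (g : G) (m : M) : ρ g (ρ g⁻¹ m) = m := by
  rw [← rep_mul, mul_inv_cancel, rep_one]

/-- Functions on `G` with the action by right translation. -/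
def funRep (G A : Type) [Group G] [AddCommGroup A] : Representation ℤ G (G → A) :=
  mkRep (fun g => { toFun := fun u x => u (x * g), map_zero' := rfl, map_add' := fun _ _ => rfl })
    (fun u => by funext x; simp) (fun g g' u => by funext x; simp [mul_assoc])

@[simp] theorem funRep_apply (g : G) (u : G → A) (x : G) : funRep G A g u x = u (x * g) := rfl

/-- The canonical map into functions attached to an additive map. -/
def toFun (ρ : Representation ℤ G M) (f : M →+ A) : M →+ (G → A) where
  toFun m x := f (ρ x m)
  map_zero' := by funext x; simp
  map_add' m m' := by funext x; simp

@[simp] theorem toFun_apply (ρ : Representation ℤ G M) (f : M →+ A) (m : M) (x : G) :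
    toFun ρ f m x = f (ρ x m) := rfl

theorem toFun_compat (ρ : Representation ℤ G M) (f : M →+ A) :
    Compat ρ (funRep G A) (MonoidHom.id G) (toFun ρ f) := by
  intro g m; funext x; simp

/-- The representation on the quotient by the image of an equivariant map. -/
def quotRep (ν : Representation ℤ G N) (j : M →+ N) (h : ∀ g m, ∃ m', j m' = ν g (j m)) :
    Representation ℤ G (N ⧸ j.range) :=
  mkRep (fun g => QuotientAddGroup.map _ _ (ν g).toAddMonoidHom
    (by rintro _ ⟨m, rfl⟩; exact h g m))
    (fun x => by
      obtain ⟨x, rfl⟩ := QuotientAddGroup.mk_surjective x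
      simp)
    (fun g g' x => by
      obtain ⟨x, rfl⟩ := QuotientAddGroup.mk_surjective x
      simp)

@[simp] theorem quotRep_mk (ν : Representation ℤ G N) (j : M →+ N) (h) (g : G) (n : N) :
    quotRep ν j h g (n : N ⧸ j.range) = ((ν g n : N) : N ⧸ j.range) := rfl

theorem Compat.exists {ρ : Representation ℤ G M} {ν : Representation ℤ G N} {j : M →+ N}
    (h : Compat ρ ν (MonoidHom.id G) j) (g : G) (m : M) : ∃ m', j m' = ν g (j m) :=
  ⟨_, h g m⟩

theorem quot_ses {ρ : Representation ℤ G M} {ν : Representation ℤ G N} {j : M →+ N}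
    (h : Compat ρ ν (MonoidHom.id G) j) (hj : Function.Injective j) :
    SES ρ ν (quotRep ν j h.exists) j (QuotientAddGroup.mk' j.range) where
  cj := h
  cp := fun _ _ => rfl
  inj := hj
  surj := QuotientAddGroup.mk'_surjective _
  comp m := (QuotientAddGroup.eq_zero_iff _).2 ⟨m, rfl⟩
  ex n hn := (QuotientAddGroup.eq_zero_iff n).1 hn

end Constructions

section Coind
variable {G S M A : Type} [Group G] [Group S] [AddCommGroup M] [AddCommGroup A]

/-- The pair `(ρ, f)` is coinduced from the representation `σ` along `φ`. -/
structure IsCoind (ρ : Representation ℤ G M) (σ : Representation ℤ S A) (φ : S →* G) (f : M →+ A) :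
    Prop where
  compat : Compat ρ σ φ f
  inj : Function.Injective φ
  zero : ∀ m, (∀ g, f (ρ g m) = 0) → m = 0
  ex : ∀ u : G → A, (∀ s g, u (φ s * g) = σ s (u g)) → ∃ m, ∀ g, f (ρ g m) = u g

/-- The pair `(ρ, f)` is coinduced from the trivial group. -/
structure IsCoindOne (ρ : Representation ℤ G M) (f : M →+ A) : Prop where
  zero : ∀ m, (∀ g, f (ρ g m) = 0) → m = 0
  ex : ∀ u : G → A, ∃ m, ∀ g, f (ρ g m) = u g

theorem contractNth_zero_cons {q : ℕ} (x : G) (g : Fin (q + 1) → G) :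
    Fin.contractNth 0 (· * ·) (Fin.cons x g : Fin (q + 2) → G) =
      Fin.cons (x * g 0) (fun i => g i.succ) := by
  funext i
  refine Fin.cases ?_ (fun i => ?_) i <;> simp [Fin.contractNth]

theorem contractNth_succ_cons {q : ℕ} (x : G) (g : Fin (q + 1) → G) (j : Fin (q + 1)) :
    Fin.contractNth j.succ (· * ·) (Fin.cons x g : Fin (q + 2) → G) =
      Fin.cons x (Fin.contractNth j (· * ·) g) := by
  funext i
  refine Fin.cases ?_ (fun i => ?_) i
  · simp [Fin.contractNth]
  · simp only [Fin.contractNth, Fin.cons_succ, Fin.val_succ, add_lt_add_iff_right,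
      add_left_inj]
    simp only [← Fin.succ_castSucc, Fin.cons_succ]

theorem IsCoindOne.van {ρ : Representation ℤ G M} {f : M →+ A} (h : IsCoindOne ρ f) (q : ℕ) :
    Van ρ (q + 1) := by
  intro c hc
  choose b hb using fun g : Fin q → G => h.ex fun x => f (c (Fin.cons x g))
  refine ⟨b, funext fun g => sub_eq_zero.1 (h.zero _ fun x => ?_)⟩
  have key := congrArg f (congrFun hc (Fin.cons x g))
  rw [dC, Fin.sum_univ_succ, Pi.zero_apply, map_zero, map_add, map_add, map_sum] at key
  simp only [contractNth_zero_cons, contractNth_succ_cons, Fin.cons_zero, Fin.cons_succ,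
    map_zsmul] at key
  rw [map_sub, map_sub, dC, map_add, map_add, map_sum, map_sum, ← rep_mul, hb]
  simp only [map_zsmul, hb]
  simp only [Fin.val_succ, pow_succ, Fin.val_zero, pow_zero, neg_mul, mul_neg, neg_neg, mul_one,
    one_mul, neg_smul, one_smul, Finset.sum_neg_distrib] at key ⊢
  rw [sub_add_eq_sub_sub, sub_neg_eq_add, ← key]
  abel

theorem funRep_coindOne : IsCoindOne (funRep G A) (Pi.evalAddMonoidHom (fun _ : G => A) 1) where
  zero u h := by funext x; simpa using h x
  ex u := ⟨u, fun g => by simp⟩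

theorem van_funRep (q : ℕ) : Van (funRep G A) (q + 1) := funRep_coindOne.van q

/-- An equivariant splitting of a group into cosets of a subgroup: an equivariant function with
prescribed values modulo a surjection can be lifted. -/
theorem exists_equivariant_lift {I : Type} [AddCommGroup I] {Q : Type} [AddCommGroup Q]
    {τ : Representation ℤ S I} {κ : Representation ℤ S Q} {φ : S →* G}
    (hφ : Function.Injective φ) {p : I →+ Q} (hp : Function.Surjective p)
    (hc : Compat τ κ (MonoidHom.id S) p)
    (u : G → Q) (hu : ∀ s g, u (φ s * g) = κ s (u g)) :
    ∃ v : G → I, (∀ s g, v (φ s * g) = τ s (v g)) ∧ ∀ g, p (v g) = u g := by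
  choose l hl using hp
  let st : Setoid G := ⟨fun g g' => ∃ s, φ s * g = g', fun g => ⟨1, by simp⟩,
    fun {g g'} ⟨s, hs⟩ => ⟨s⁻¹, by simp [← hs]⟩,
    fun {g g' g''} ⟨s, hs⟩ ⟨t, ht⟩ => ⟨t * s, by simp [← ht, ← hs, mul_assoc]⟩⟩
  let r : G → G := fun g => (Quotient.mk st g).out
  have hr : ∀ g, ∃ s, φ s * r g = g := fun g => Quotient.exact (Quotient.out_eq (Quotient.mk st g))
  have hr' : ∀ s g, r (φ s * g) = r g := fun s g => by
    simp only [r]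
    rw [Quotient.sound (s := st) (show st.r g (φ s * g) from ⟨s, rfl⟩)]
  choose a ha using hr
  have ha' : ∀ s g, a (φ s * g) = s * a g := fun s g => hφ <| by
    have h1 := ha (φ s * g)
    rw [hr'] at h1
    rw [map_mul]
    apply mul_right_cancel (b := r g)
    rw [h1, mul_assoc, ha]
  refine ⟨fun g => τ (a g) (l (u (r g))), fun s g => ?_, fun g => ?_⟩
  · simp only [ha', hr', rep_mul]
  · have := hc (a g) (l (u (r g)))
    simp only [MonoidHom.id_apply] at this
    rw [this, hl, ← hu, ha]

theorem IsCoind.van_inj (q : ℕ) : ∀ {M A : Type} [AddCommGroup M] [AddCommGroup A]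
    {ρ : Representation ℤ G M} {σ : Representation ℤ S A} {φ : S →* G} {f : M →+ A}
    (_ : IsCoind ρ σ φ f), Inj ρ σ φ f q := by
  induction q with
  | zero =>
    intro M A _ _ ρ σ φ f h c hc hf
    funext g
    refine h.zero _ fun x => ?_
    have h1 := congrFun hc fun _ => x
    have h2 := congrFun hf fun i => i.elim0
    rw [dC_degree_zero _ _ _ g, Pi.zero_apply, sub_eq_zero] at h1
    rw [h1, ← Subsingleton.elim (fun i : Fin 0 => φ (i.elim0)) g]
    exact h2
  | succ q ih =>
    intro M A _ _ ρ σ φ f h c hc hf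
    obtain ⟨b0, hb0⟩ := hf
    have hjM : Function.Injective (toFun ρ f) := (injective_iff_map_eq_zero _).2 fun m hm =>
      h.zero m fun g => congrFun hm g
    have hjA : Function.Injective (toFun σ (AddMonoidHom.id A)) :=
      (injective_iff_map_eq_zero _).2 fun a ha => by simpa using congrFun ha 1
    have sM := quot_ses (toFun_compat ρ f) hjM
    have sA := quot_ses (toFun_compat σ (AddMonoidHom.id A)) hjA
    let r : (G → A) →+ (S → A) :=
      { toFun := fun u s => u (φ s), map_zero' := rfl, map_add' := fun _ _ => rfl }
    have hr : Compat (funRep G A) (funRep S A) φ r := fun s u => by funext t; simp [r]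
    have hrj : ∀ m, r (toFun ρ f m) = toFun σ (AddMonoidHom.id A) (f m) := fun m => by
      funext s; simp [r, h.compat s m]
    let f' : ((G → A) ⧸ (toFun ρ f).range) →+ ((S → A) ⧸ (toFun σ (AddMonoidHom.id A)).range) :=
      QuotientAddGroup.map _ _ r (by rintro _ ⟨m, rfl⟩; exact ⟨f m, (hrj m).symm⟩)
    have hf' : ∀ u : G → A, f' u = ((r u : S → A) : (S → A) ⧸ _) := fun u => rfl
    have hco : IsCoind (quotRep (funRep G A) _ (toFun_compat ρ f).exists)
        (quotRep (funRep S A) _ (toFun_compat σ (AddMonoidHom.id A)).exists) φ f' := by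
      refine ⟨?_, h.inj, ?_, ?_⟩
      · intro s x
        obtain ⟨x, rfl⟩ := QuotientAddGroup.mk_surjective x
        rw [quotRep_mk, hf', hr, hf', quotRep_mk]
      · intro x hx
        obtain ⟨u, rfl⟩ := QuotientAddGroup.mk_surjective x
        refine (QuotientAddGroup.eq_zero_iff _).2 ?_
        have h2 : ∀ s g, u (φ s * g) = σ s (u g) := fun s g => by
          have := hx g
          rw [quotRep_mk, hf', QuotientAddGroup.eq_zero_iff] at this
          obtain ⟨a, ha⟩ := this
          have h1 := congrFun ha 1
          have h2 := congrFun ha s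
          simp [r] at h1 h2
          rw [← h2, h1]
        obtain ⟨m, hm⟩ := h.ex u h2
        exact ⟨m, funext hm⟩
      · intro u hu
        obtain ⟨v, hv, hvu⟩ := exists_equivariant_lift h.inj sA.surj sA.cp u hu
        refine ⟨((fun g => v g 1 : G → A) : (G → A) ⧸ _), fun g => ?_⟩
        rw [quotRep_mk, hf', ← hvu]
        refine congrArg _ (funext fun s => ?_)
        simp [r, hv]
    obtain ⟨b, hb⟩ := van_funRep q (pull (MonoidHom.id G) (toFun ρ f) c)
      (by rw [dC_pull sM.cj, hc, pull_zero])
    have hβ : dC (funRep S A) q (pull φ r b) =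
        dC (funRep S A) q (pull (MonoidHom.id S) (toFun σ (AddMonoidHom.id A)) b0) := by
      rw [dC_pull hr, ← hb, dC_pull sA.cj, ← hb0]
      funext g
      exact hrj _
    obtain ⟨z, hz, hbz⟩ : ∃ z : (Fin q → G) → G → A, dC (funRep G A) q z = 0 ∧
        IsB (funRep S A) q (pull φ r (b - z) -
          pull (MonoidHom.id S) (toFun σ (AddMonoidHom.id A)) b0) := by
      cases q with
      | succ q =>
        exact ⟨0, dC_zero _ _, van_funRep q _ (by rw [sub_zero, dC_sub, hβ, sub_self])⟩
      | zero =>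
        set w := pull φ r b - pull (MonoidHom.id S) (toFun σ (AddMonoidHom.id A)) b0
        have hw : dC (funRep S A) 0 w = 0 := by rw [dC_sub, hβ, sub_self]
        have hw' : ∀ g s, w g s = w g 1 := fun g s => by
          have h1 := congrFun (congrFun hw fun _ => s) 1
          rw [dC_degree_zero _ _ _ g] at h1
          simpa [sub_eq_zero] using h1
        refine ⟨fun _ _ => w (fun i => i.elim0) 1, ?_, ?_⟩
        · funext g x
          simp [dC]
        · funext g s
          have h1 := hw' g s
          rw [Subsingleton.elim (fun i : Fin 0 => (i.elim0 : S)) g]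
          simp only [w, pull, Pi.sub_apply, map_sub] at h1 ⊢
          rw [sub_right_comm, h1]
          simp [r]
    refine sM.isB_of_lift hb hz (ih hco _ ?_ ?_)
    · rw [dC_pull sM.cp, dC_sub, ← hb, hz, sub_zero, sM.pull_pull]
    · have := hbz.pull sA.cp
      rw [pull_sub, sA.pull_pull, sub_zero] at this
      exact this

end Coind

/-- A split extension of `L` by `N`. -/
structure Split {N E L : Type} [Group N] [Group E] [Group L] (i : N →* E) (s : L →* E)
    (π : E →* L) : Prop where
  sec : ∀ l, π (s l) = l
  triv : ∀ v, π (i v) = 1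
  inj : Function.Injective i
  ker : ∀ e, π e = 1 → ∃ v, i v = e

/-- All crossed homomorphisms are principal. -/
def Princ {N E M : Type} [Group N] [Group E] [AddCommGroup M] (i : N →* E)
    (ρ : Representation ℤ E M) : Prop :=
  ∀ z : N → M, (∀ v w, z (v * w) = z v + ρ (i v) (z w)) → ∃ q, ∀ v, z v = ρ (i v) q - q

section
variable {E M Q : Type} {X : Type} [Group E] [AddCommGroup M] [AddCommGroup Q]

/-- Every choice of values on the generators extends to a crossed homomorphism. -/
theorem exists_crossed (ρ : Representation ℤ (FreeGroup X) M) (t : X → M) :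
    ∃ z : FreeGroup X → M, (∀ v w, z (v * w) = z v + ρ v (z w)) ∧ ∀ x, z (FreeGroup.of x) = t x := by
  let a : X → Equiv.Perm M := fun x =>
    { toFun := fun m => ρ (FreeGroup.of x) m + t x
      invFun := fun m => ρ (FreeGroup.of x)⁻¹ (m - t x)
      left_inv := fun m => by simp only [add_sub_cancel_right, rep_inv_self]
      right_inv := fun m => by simp only [rep_self_inv, sub_add_cancel] }
  have ha : ∀ x m, a x m = ρ (FreeGroup.of x) m + t x := fun _ _ => rfl
  have ha' : ∀ x m, (a x)⁻¹ m = ρ (FreeGroup.of x)⁻¹ (m - t x) := fun _ _ => rfl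
  have key : ∀ v m, FreeGroup.lift a v m = ρ v m + FreeGroup.lift a v 0 := by
    intro v
    induction v using FreeGroup.induction_on with
    | C1 => intro m; simp
    | of x => intro m; simp [ha]
    | inv_of x _ =>
      intro m
      simp only [map_inv, FreeGroup.lift_apply_of, ha']
      rw [← map_add, zero_sub, sub_eq_add_neg]
    | mul v w hv hw =>
      intro m
      rw [map_mul, Equiv.Perm.mul_apply, Equiv.Perm.mul_apply, hw, hv, hv (FreeGroup.lift a w 0),
        map_add, rep_mul, add_assoc]
  refine ⟨fun v => FreeGroup.lift a v 0, fun v w => ?_, fun x => ?_⟩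
  · beta_reduce
    rw [map_mul, Equiv.Perm.mul_apply, key, add_comm]
  · simp [ha]

theorem crossed_ext {ρ : Representation ℤ (FreeGroup X) M} {z z' : FreeGroup X → M}
    (hz : ∀ v w, z (v * w) = z v + ρ v (z w)) (hz' : ∀ v w, z' (v * w) = z' v + ρ v (z' w))
    (h : ∀ x, z (FreeGroup.of x) = z' (FreeGroup.of x)) (v : FreeGroup X) : z v = z' v := by
  have h1 : z 1 = 0 := by simpa using hz 1 1
  have h1' : z' 1 = 0 := by simpa using hz' 1 1
  induction v using FreeGroup.induction_on with
  | C1 => rw [h1, h1']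
  | of x => exact h x
  | inv_of x _ =>
    have e := hz (FreeGroup.of x)⁻¹ (FreeGroup.of x)
    have e' := hz' (FreeGroup.of x)⁻¹ (FreeGroup.of x)
    rw [inv_mul_cancel, h1] at e
    rw [inv_mul_cancel, h1', ← h, e] at e'
    exact add_right_cancel e'
  | mul v w hv hw => rw [hz, hz', hv, hw]

theorem Princ.quot {N : Type} [AddCommGroup N] {ρ : Representation ℤ E M}
    {ν : Representation ℤ E N} {κ : Representation ℤ E Q} {j : M →+ N} {p : N →+ Q}
    (h : SES ρ ν κ j p) {i : FreeGroup X →* E} (hp : Princ i ν) : Princ i κ := by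
  intro z hz
  choose l hl using h.surj
  obtain ⟨z', hz', hz'x⟩ := exists_crossed (ν.comp i) fun x => l (z (FreeGroup.of x))
  obtain ⟨q, hq⟩ := hp z' hz'
  refine ⟨p q, fun v => ?_⟩
  have hc : ∀ e n, κ e (p n) = p (ν e n) := fun e n => (h.cp e n).symm
  rw [hc, ← map_sub, ← hq]
  refine crossed_ext (ρ := κ.comp i) (z' := fun v => p (z' v)) hz (fun v w => ?_) (fun x => ?_) v
  · simp [hz', hc]
  · simp [hz'x, hl]

end

section
variable {N E L M A : Type} [Group N] [Group E] [Group L] [AddCommGroup M] [AddCommGroup A]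
  {i : N →* E} {s : L →* E} {π : E →* L}

/-- The coinduced representation. -/
def coindSub (σ : Representation ℤ L A) (s : L →* E) : AddSubgroup (E → A) where
  carrier := {u | ∀ l x, u (s l * x) = σ l (u x)}
  zero_mem' := fun l x => by simp
  add_mem' := fun {u v} hu hv l x => by simp [hu l x, hv l x]
  neg_mem' := fun {u} hu l x => by simp [hu l x]

/-- The coinduced representation. -/
def coindRep (σ : Representation ℤ L A) (s : L →* E) : Representation ℤ E (coindSub σ s) :=
  mkRep (fun g =>
    { toFun := fun u => ⟨fun x => u.1 (x * g), fun l x => by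
        beta_reduce
        rw [mul_assoc, u.2]⟩
      map_zero' := rfl
      map_add' := fun _ _ => rfl })
    (fun u => Subtype.ext (by funext x; simp))
    (fun g g' u => Subtype.ext (by funext x; simp [mul_assoc]))

@[simp] theorem coindRep_apply (σ : Representation ℤ L A) (s : L →* E) (g : E)
    (u : coindSub σ s) (x : E) : (coindRep σ s g u).1 x = u.1 (x * g) := rfl

/-- Evaluation at the identity. -/
def coindEv (σ : Representation ℤ L A) (s : L →* E) : coindSub σ s →+ A where
  toFun u := u.1 1
  map_zero' := rfl
  map_add' _ _ := rfl

theorem coindRep_isCoind (σ : Representation ℤ L A) (hs : Function.Injective s) :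
    IsCoind (coindRep σ s) σ s (coindEv σ s) where
  compat l u := by
    have := u.2 l 1
    simpa [coindEv] using this
  inj := hs
  zero u h := Subtype.ext <| funext fun x => by simpa [coindEv] using h x
  ex u hu := ⟨⟨u, hu⟩, fun g => by simp [coindEv]⟩

/-- The canonical map to the coinduced representation attached to an equivariant map. -/
def toCoind {ρ : Representation ℤ E M} {σ : Representation ℤ L A} {f : M →+ A}
    (h : Compat ρ σ s f) : M →+ coindSub σ s where
  toFun m := ⟨fun x => f (ρ x m), fun l x => by
    beta_reduce
    rw [rep_mul, h]⟩
  map_zero' := Subtype.ext (by funext x; simp)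
  map_add' m m' := Subtype.ext (by funext x; simp)

@[simp] theorem toCoind_apply {ρ : Representation ℤ E M} {σ : Representation ℤ L A} {f : M →+ A}
    (h : Compat ρ σ s f) (m : M) (x : E) : (toCoind h m).1 x = f (ρ x m) := rfl

theorem toCoind_compat {ρ : Representation ℤ E M} {σ : Representation ℤ L A} {f : M →+ A}
    (h : Compat ρ σ s f) : Compat ρ (coindRep σ s) (MonoidHom.id E) (toCoind h) := fun g m =>
  Subtype.ext (by funext x; simp)

namespace Split

theorem decomp (h : Split i s π) (e : E) : ∃ v, e = s (π e) * i v := by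
  obtain ⟨v, hv⟩ := h.ker ((s (π e))⁻¹ * e) (by simp [h.sec])
  exact ⟨v, by rw [hv]; group⟩

theorem conj (h : Split i s π) (v : N) (l : L) : ∃ w, i v * s l = s l * i w := by
  obtain ⟨w, hw⟩ := h.decomp (i v * s l)
  exact ⟨w, by simpa [h.triv, h.sec] using hw⟩

theorem s_inj (h : Split i s π) : Function.Injective s := fun l l' e => by
  rw [← h.sec l, e, h.sec]

theorem decomp_unique (h : Split i s π) {l l' : L} {v v' : N} (e : s l * i v = s l' * i v') :
    l = l' ∧ v = v' := by
  have h1 : l = l' := by simpa [h.sec, h.triv] using congrArg π e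
  subst h1
  exact ⟨rfl, h.inj (mul_left_cancel e)⟩

end Split

/-- A function space with the action by right translation has only principal crossed
homomorphisms. -/
theorem Split.princ_aux (h : Split i s π) (z : N → E → A)
    (hz : ∀ v w x, z (v * w) x = z v x + z w (x * i v)) :
    ∃ q : E → A, (∀ v x, z v x = q (x * i v) - q x) ∧
      ∀ l v, q (s l * i v) = z v (s l) := by
  choose w hw using h.decomp
  have h1 : ∀ l v, w (s l * i v) = v := fun l v =>
    ((h.decomp_unique ((hw (s l * i v)).symm)).2)
  have h2 : ∀ l v, π (s l * i v) = l := fun l v => by simp [h.sec, h.triv]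
  refine ⟨fun x => z (w x) (s (π x)), fun v x => ?_, fun l v => by simp only [h1, h2]⟩
  obtain ⟨y, hy⟩ := h.decomp x
  generalize π x = l at hy
  subst hy
  rw [mul_assoc, ← map_mul]
  simp only [h1, h2, hz]
  simp

theorem Split.princ_funRep (h : Split i s π) : Princ i (funRep E A) := fun z hz => by
  obtain ⟨q, hq, -⟩ := h.princ_aux z fun v w x => congrFun (hz v w) x
  exact ⟨q, fun v => funext fun x => hq v x⟩

theorem Split.princ_coindRep (h : Split i s π) (σ : Representation ℤ L A) :
    Princ i (coindRep σ s) := fun z hz => by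
  obtain ⟨q, hq, hq'⟩ := h.princ_aux (fun v => (z v).1) fun v w x =>
    congrFun (congrArg Subtype.val (hz v w)) x
  refine ⟨⟨q, fun l x => ?_⟩, fun v => Subtype.ext (funext fun x => hq v x)⟩
  obtain ⟨y, hy⟩ := h.decomp x
  generalize π x = l' at hy
  subst hy
  rw [← mul_assoc, ← map_mul, hq', hq', map_mul, (z y).2]

end

section
variable {N E L M A B Q : Type} [Group N] [Group E] [Group L] [AddCommGroup M] [AddCommGroup A]
  [AddCommGroup B] [AddCommGroup Q]
  {i : N →* E} {s : L →* E} {π : E →* L}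

/-- `(σ, j)` is the representation on the invariants under the normal subgroup. -/
structure IsInv (i : N →* E) (s : L →* E) (ρ : Representation ℤ E Q) (σ : Representation ℤ L B)
    (j : B →+ Q) : Prop where
  inj : Function.Injective j
  equi : ∀ l b, ρ (s l) (j b) = j (σ l b)
  fixed : ∀ v b, ρ (i v) (j b) = j b
  range : ∀ q, (∀ v, ρ (i v) q = q) → ∃ b, j b = q

/-- The invariants under a normal subgroup. -/
def invSub (i : N →* E) (ρ : Representation ℤ E Q) : AddSubgroup Q where
  carrier := {q | ∀ v, ρ (i v) q = q}
  zero_mem' := fun v => by simp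
  add_mem' := fun {a b} ha hb v => by rw [map_add, ha, hb]
  neg_mem' := fun {a} ha v => by rw [map_neg, ha]

/-- The action on the invariants under a normal subgroup. -/
def invRep (h : Split i s π) (ρ : Representation ℤ E Q) : Representation ℤ L (invSub i ρ) :=
  mkRep (fun l =>
    { toFun := fun q => ⟨ρ (s l) q.1, fun v => by
        obtain ⟨w, hw⟩ := h.conj v l
        rw [← rep_mul, hw, rep_mul, q.2]⟩
      map_zero' := Subtype.ext (by simp)
      map_add' := fun _ _ => Subtype.ext (by simp) })
    (fun q => Subtype.ext (by simp))
    (fun g g' q => Subtype.ext (by simp))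

theorem invRep_val (h : Split i s π) (ρ : Representation ℤ E Q) (l : L) (q : invSub i ρ) :
    (invRep h ρ l q).1 = ρ (s l) q.1 := rfl

theorem invRep_isInv (h : Split i s π) (ρ : Representation ℤ E Q) :
    IsInv i s ρ (invRep h ρ) (invSub i ρ).subtype where
  inj := Subtype.val_injective
  equi _ _ := rfl
  fixed v b := b.2 v
  range q hq := ⟨⟨q, hq⟩, rfl⟩

theorem IsInv.compat (h : Split i s π) {ρ : Representation ℤ E Q} {σ : Representation ℤ L B}
    {j : B →+ Q} (hj : IsInv i s ρ σ j) : Compat (σ.comp π) ρ (MonoidHom.id E) j := by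
  intro e b
  obtain ⟨v, hv⟩ := h.decomp e
  rw [MonoidHom.id_apply]
  conv_rhs => rw [hv, rep_mul, hj.fixed, hj.equi]
  rfl

theorem invRep_funRep_coindOne (h : Split i s π) :
    IsCoindOne (invRep h (funRep E A))
      ((Pi.evalAddMonoidHom (fun _ : E => A) 1).comp (invSub i (funRep E A)).subtype) where
  zero u hu := Subtype.ext <| funext fun x => by
    obtain ⟨v, hv⟩ := h.decomp x
    have h1 := congrFun (u.2 v) (s (π x))
    have h2 := hu (π x)
    simp only [AddMonoidHom.comp_apply, AddSubgroup.coe_subtype, invRep_val,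
      Pi.evalAddMonoidHom_apply, funRep_apply, one_mul] at h1 h2
    rw [hv, h1, h2]
    rfl
  ex u := ⟨⟨fun x => u (π x), fun v => funext fun x => by simp [h.triv]⟩,
    fun g => by simp [invRep_val, h.sec]⟩

theorem SES.inv_ses {C : Type} [AddCommGroup C] (h : Split i s π) {ρ : Representation ℤ E Q}
    {ν : Representation ℤ E A} {κ : Representation ℤ E C} {j : Q →+ A} {p : A →+ C}
    (hs : SES ρ ν κ j p) (hp : Princ i ρ) {σ : Representation ℤ L B} {jB : B →+ Q}
    (hB : IsInv i s ρ σ jB) :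
    ∃ (j' : B →+ invSub i ν) (p' : invSub i ν →+ invSub i κ),
      SES σ (invRep h ν) (invRep h κ) j' p' ∧ ∀ x, (p' x).1 = p x.1 := by
  have cj : ∀ e q, ν e (j q) = j (ρ e q) := fun e q => (hs.cj e q).symm
  have cp : ∀ e q, κ e (p q) = p (ν e q) := fun e q => (hs.cp e q).symm
  refine ⟨{ toFun := fun b => ⟨j (jB b), fun v => by rw [cj, hB.fixed]⟩
            map_zero' := Subtype.ext (by simp), map_add' := fun _ _ => Subtype.ext (by simp) },
    { toFun := fun x => ⟨p x.1, fun v => by rw [cp, x.2]⟩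
      map_zero' := Subtype.ext (by simp), map_add' := fun _ _ => Subtype.ext (by simp) },
    ⟨?_, ?_, ?_, ?_, ?_, ?_⟩, fun x => rfl⟩
  · intro l b
    exact Subtype.ext (by
      rw [invRep_val]
      change j (jB (σ l b)) = ν (s l) (j (jB b))
      rw [cj, hB.equi])
  · intro l b
    exact Subtype.ext (cp (s l) b.1).symm
  · intro b b' e
    exact hB.inj (hs.inj (congrArg Subtype.val e))
  · intro y
    obtain ⟨x, hx⟩ := hs.surj y.1
    have h1 : ∀ v, ∃ q, j q = ν (i v) x - x := fun v => hs.ex _ (by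
      rw [map_sub, ← cp, hx, y.2, sub_self])
    choose z hz using h1
    obtain ⟨q, hq⟩ := hp z fun v w => hs.inj <| by
      rw [map_add, hz, hz, ← cj, hz, map_sub, map_mul, rep_mul]; abel
    refine ⟨⟨x - j q, fun v => ?_⟩, Subtype.ext ?_⟩
    · have := hz v
      rw [hq, map_sub, ← cj] at this
      rw [map_sub, sub_eq_sub_iff_sub_eq_sub, ← this]
    · change p (x - j q) = y.1
      rw [map_sub, hs.comp, hx, sub_zero]
  · intro b
    exact Subtype.ext (hs.comp _)
  · intro x hx
    obtain ⟨q, hq⟩ := hs.ex x.1 (congrArg Subtype.val hx)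
    obtain ⟨b, hb⟩ := hB.range q fun v => hs.inj <| by rw [← cj, hq, x.2]
    exact ⟨b, Subtype.ext (by rw [← hq, ← hb]; rfl)⟩

end

section
variable {X E L : Type} [Group E] [Group L] {i : FreeGroup X →* E} {s : L →* E} {π : E →* L}

/-- Vanishing for an extension by a free group can be tested on the invariants, as long as all
crossed homomorphisms are principal. -/
theorem Split.van (h : Split i s π) (q : ℕ) : ∀ {Q B : Type} [AddCommGroup Q] [AddCommGroup B]
    {ρ : Representation ℤ E Q} {σ : Representation ℤ L B} {j : B →+ Q},
    Princ i ρ → IsInv i s ρ σ j → Van σ q → Van ρ q := by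
  induction q with
  | zero =>
    intro Q B _ _ ρ σ j hp hj hv c hc
    have h1 : ∀ e g, ρ e (c g) = c g := fun e g => by
      have := congrFun hc fun _ => e
      rw [dC_degree_zero _ _ _ g] at this
      exact sub_eq_zero.1 this
    choose b hb using fun g => hj.range (c g) fun v => h1 _ g
    have h2 := hv (fun _ => b fun x => x.elim0) (by
      funext g
      rw [dC_degree_zero _ _ _ (fun x => x.elim0), Pi.zero_apply, sub_eq_zero]
      exact hj.inj (by rw [← hj.equi, hb, h1]))
    funext g
    rw [Subsingleton.elim g fun x => x.elim0, ← hb, congrFun h2 fun x => x.elim0]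
    simp
  | succ q ih =>
    intro Q B _ _ ρ σ j hp hj hv
    have hinj : Function.Injective (toFun ρ (AddMonoidHom.id Q)) :=
      (injective_iff_map_eq_zero _).2 fun a ha => by simpa using congrFun ha 1
    have hs := quot_ses (toFun_compat ρ (AddMonoidHom.id Q)) hinj
    obtain ⟨j', p', hs', hp'⟩ := hs.inv_ses h hp hj
    cases q with
    | succ q =>
      exact hs.van_sub (ih (Princ.quot hs h.princ_funRep) (invRep_isInv h _)
        (hs'.van_quot ((invRep_funRep_coindOne h).van q) hv)) (van_funRep _)
    | zero =>
      intro c hc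
      obtain ⟨b, hb⟩ := van_funRep 0 _ (show dC _ _ (pull (MonoidHom.id E) _ c) = 0 by
        rw [dC_pull hs.cj, hc, pull_zero])
      have hy := hs.connecting hb
      set y := pull (MonoidHom.id E) (QuotientAddGroup.mk' (toFun ρ (AddMonoidHom.id Q)).range) b
        with hy'
      have h1 : ∀ e g, quotRep _ _ (toFun_compat ρ (AddMonoidHom.id Q)).exists e (y g) = y g :=
        fun e g => by
          have := congrFun hy fun _ => e
          rw [dC_degree_zero _ _ _ g] at this
          exact sub_eq_zero.1 this
      obtain ⟨z, hz, hzy⟩ := hs'.exists_lift hv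
        (c := fun _ => ⟨y fun x => x.elim0, fun v => h1 _ _⟩) (by
          funext g
          rw [dC_degree_zero _ _ _ (fun x => x.elim0), Pi.zero_apply, sub_eq_zero]
          exact Subtype.ext (h1 _ _))
      have h2 : ∀ l g, invRep h _ l (z g) = z g := fun l g => by
        have := congrFun hz fun _ => l
        rw [dC_degree_zero _ _ _ g] at this
        exact sub_eq_zero.1 this
      let z' : (Fin 0 → E) → (E → Q) := fun _ => (z fun x => x.elim0).1
      refine hs.isB_of_lift hb (z := z') ?_ ?_
      · funext g
        rw [dC_degree_zero _ _ _ (fun x => x.elim0), Pi.zero_apply, sub_eq_zero]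
        obtain ⟨v, hv⟩ := h.decomp (g 0)
        rw [hv, rep_mul]
        simp only [z']
        rw [(z _).2, ← invRep_val h, h2]
      · rw [pull_sub, ← hy']
        funext g
        rw [Pi.sub_apply, Pi.zero_apply, sub_eq_zero, Subsingleton.elim g fun x => x.elim0]
        have h3 := congrArg Subtype.val (congrFun hzy fun x => x.elim0)
        simp only [pull, hp', MonoidHom.id_apply] at h3
        rw [← h3]
        congr 3
end

section
variable {N E L M B : Type} [Group N] [Group E] [Group L] [AddCommGroup M] [AddCommGroup B]

/-- `B` is, equivariantly, the group of homomorphisms from `N` to `M`. -/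
structure IsHom (i : N →* E) (s : L →* E) (σB : Representation ℤ L B) (σ : Representation ℤ L M)
    (ev : B → N → M) : Prop where
  map_add : ∀ b b' v, ev (b + b') v = ev b v + ev b' v
  map_mul : ∀ b v w, ev b (v * w) = ev b v + ev b w
  ext : ∀ b b', (∀ v, ev b v = ev b' v) → b = b'
  ex : ∀ z : N → M, (∀ v w, z (v * w) = z v + z w) → ∃ b, ∀ v, ev b v = z v
  equi : ∀ l b w w', i w * s l = s l * i w' → ev (σB l b) w = σ l (ev b w')

end

section
variable {N E L Q B B' : Type} [Group N] [Group E] [Group L] [AddCommGroup Q] [AddCommGroup B]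
  [AddCommGroup B'] {i : N →* E} {s : L →* E} {π : E →* L}

/-- The invariants of the quotient by the invariants are the homomorphisms to the invariants. -/
theorem Split.exists_inv_quot (h : Split i s π) {ρ : Representation ℤ E Q}
    (hp : Princ i ρ) {σ : Representation ℤ L B} {j : B →+ Q} (hj : IsInv i s ρ σ j)
    {σ' : Representation ℤ L B'} {ev : B' → N → B} (he : IsHom i s σ' σ ev) :
    ∃ j' : B' →+ Q ⧸ j.range, IsInv i s (quotRep ρ j (hj.compat h).exists) σ' j' ∧
      ∀ b q, (∀ v, ρ (i v) q - q = j (ev b v)) → j' b = QuotientAddGroup.mk' j.range q := by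
  have hq : ∀ b, ∃ q, ∀ v, ρ (i v) q - q = j (ev b v) := fun b => by
    obtain ⟨q, hq⟩ := hp (fun v => j (ev b v)) fun v w => by rw [he.map_mul, map_add, hj.fixed]
    exact ⟨q, fun v => (hq v).symm⟩
  choose f hf using hq
  have huniq : ∀ b q q', (∀ v, ρ (i v) q - q = j (ev b v)) → (∀ v, ρ (i v) q' - q' = j (ev b v)) →
      QuotientAddGroup.mk' j.range q = QuotientAddGroup.mk' j.range q' := fun b q q' h1 h2 => by
    rw [← sub_eq_zero, ← map_sub, ← AddMonoidHom.mem_ker, QuotientAddGroup.ker_mk']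
    exact hj.range _ fun v => by
      have := (h1 v).trans (h2 v).symm
      rw [map_sub, sub_eq_sub_iff_sub_eq_sub]
      exact this
  refine ⟨AddMonoidHom.mk' (fun b => QuotientAddGroup.mk' j.range (f b)) fun b b' => ?_,
    ⟨?_, ?_, ?_, ?_⟩, fun b q hb => huniq b _ _ (hf b) hb⟩
  · rw [← map_add]
    refine huniq (b + b') _ _ (hf _) fun v => ?_
    rw [he.map_add, map_add, map_add, ← hf, ← hf]; abel
  · refine (injective_iff_map_eq_zero _).2 fun b hb => he.ext _ _ fun v => ?_
    have h0 : ev 0 v = 0 := by simpa using he.map_add 0 0 v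
    obtain ⟨m, hm⟩ : f b ∈ j.range := by
      rw [← QuotientAddGroup.ker_mk' j.range]; exact hb
    apply hj.inj
    rw [h0, ← hf, ← hm, hj.fixed, sub_self, map_zero]
  · intro l b
    refine huniq (σ' l b) (ρ (s l) (f b)) _ (fun v => ?_) (hf _)
    obtain ⟨w, hw⟩ := h.conj v l
    rw [← rep_mul, hw, rep_mul, ← map_sub, hf, hj.equi, he.equi _ _ _ _ hw]
  · intro v b
    change QuotientAddGroup.mk' j.range (ρ (i v) (f b)) = QuotientAddGroup.mk' j.range (f b)
    rw [← sub_eq_zero, ← map_sub, hf, ← AddMonoidHom.mem_ker, QuotientAddGroup.ker_mk']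
    exact ⟨_, rfl⟩
  · intro q hq
    obtain ⟨q, rfl⟩ := QuotientAddGroup.mk'_surjective _ q
    have h1 : ∀ v, ∃ b, j b = ρ (i v) q - q := fun v => by
      have : ρ (i v) q - q ∈ (QuotientAddGroup.mk' j.range).ker := by
        rw [AddMonoidHom.mem_ker, map_sub, sub_eq_zero]
        exact hq v
      rwa [QuotientAddGroup.ker_mk'] at this
    choose z hz using h1
    obtain ⟨b, hb⟩ := he.ex z fun v w => hj.inj <| by
      have := hj.fixed v (z w)
      rw [hz, map_sub] at this
      rw [map_add, hz, hz, hz, map_mul, rep_mul, add_comm, ← this]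
      abel
    exact ⟨b, huniq b _ _ (hf b) fun v => by rw [hb, hz]⟩

variable {M : Type} [AddCommGroup M]

theorem Split.compat_id (h : Split i s π) (σ : Representation ℤ L M) :
    Compat (σ.comp π) σ s (AddMonoidHom.id M) := fun l m => by
  simp [h.sec]

/-- The constants inside the coinduced representation. -/
def Split.const (h : Split i s π) (σ : Representation ℤ L M) : M →+ coindSub σ s :=
  toCoind (h.compat_id σ)

theorem Split.const_apply (h : Split i s π) (σ : Representation ℤ L M) (m : M) (x : E) :
    (h.const σ m).1 x = σ (π x) m := rfl

theorem Split.const_isInv (h : Split i s π) (σ : Representation ℤ L M) :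
    IsInv i s (coindRep σ s) σ (h.const σ) where
  inj m m' e := by
    simpa [h.const_apply] using congrArg (fun u : coindSub σ s => u.1 1) e
  equi l m := Subtype.ext <| funext fun x => by simp [h.const_apply, h.sec]
  fixed v m := Subtype.ext <| funext fun x => by simp [h.const_apply, h.triv]
  range u hu := ⟨u.1 1, Subtype.ext <| funext fun x => by
    obtain ⟨v, hv⟩ := h.decomp x
    have h1 := congrFun (congrArg Subtype.val (hu v)) (s (π x))
    have h2 := u.2 (π x) 1
    rw [mul_one] at h2
    rw [h.const_apply, ← h2, ← h1, coindRep_apply, ← hv]⟩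

/-- The quotient of the coinduced representation by the constants. -/
theorem Split.const_ses (h : Split i s π) (σ : Representation ℤ L M) :
    SES (σ.comp π) (coindRep σ s) (quotRep _ _ ((h.const_isInv σ).compat h).exists) (h.const σ)
      (QuotientAddGroup.mk' (h.const σ).range) :=
  quot_ses ((h.const_isInv σ).compat h) (h.const_isInv σ).inj

end

section
variable {X E L M B B' : Type} [Group E] [Group L] [AddCommGroup M] [AddCommGroup B]
  [AddCommGroup B'] {i : FreeGroup X →* E} {s : L →* E} {π : E →* L} {σ : Representation ℤ L M}
  {σB : Representation ℤ L B} {ev : B → FreeGroup X → M}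
  {σB' : Representation ℤ L B'} {ev' : B' → FreeGroup X → B}

theorem Split.van_const_quot (h : Split i s π) (he : IsHom i s σB σ ev) {q : ℕ} (hB : Van σB q) :
    Van (quotRep (coindRep σ s) _ ((h.const_isInv σ).compat h).exists) q := by
  obtain ⟨j', hj', -⟩ := h.exists_inv_quot (h.princ_coindRep σ) (h.const_isInv σ) he
  exact h.van q (Princ.quot (h.const_ses σ) (h.princ_coindRep σ)) hj' hB

theorem Split.van_coindRep (h : Split i s π) {q : ℕ} (hM : Van σ q) : Van (coindRep σ s) q :=
  Van.of_inj (coindRep_isCoind σ h.s_inj).compat ((coindRep_isCoind σ h.s_inj).van_inj q) hM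

theorem Split.van_comp_zero (h : Split i s π) (hM : Van σ 0) : Van (σ.comp π) 0 :=
  (h.const_ses σ).van_sub_zero (h.van_coindRep hM)

theorem Split.van_comp_succ (h : Split i s π) (he : IsHom i s σB σ ev) {q : ℕ} (hM : Van σ (q + 1))
    (hB : Van σB q) : Van (σ.comp π) (q + 1) :=
  (h.const_ses σ).van_sub (h.van_const_quot he hB) (h.van_coindRep hM)

/-- Restriction along the splitting is injective on cohomology. -/
theorem Split.inj_res_zero : Inj (σ.comp π) σ s (AddMonoidHom.id M) 0 := fun c _ hc => by
  funext g
  have h1 := congrFun (show pull s (AddMonoidHom.id M) c = 0 from hc) fun x => x.elim0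
  rw [Subsingleton.elim g fun x => s ((fun x => x.elim0 : Fin 0 → L) x)]
  exact h1

theorem Split.inj_res_succ (h : Split i s π) (he : IsHom i s σB σ ev) {q : ℕ} (hB : Van σB q) :
    Inj (σ.comp π) σ s (AddMonoidHom.id M) (q + 1) := fun c hc hb => by
  refine (h.const_ses σ).inj_succ (h.van_const_quot he hB) c hc ?_
  refine (coindRep_isCoind σ h.s_inj).van_inj (q + 1) _ ?_ ?_
  · rw [dC_pull (h.const_ses σ).cj, hc, pull_zero]
  · convert hb using 1
    funext g
    simp [pull, coindEv, h.const_apply]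

/-- If a coefficient map to the constants is, up to a map to `M`, evaluation of homomorphisms, then
it is trivial on cohomology. -/
theorem Split.isB_of_ev (h : Split i s π) (he : IsHom i s σB σ ev) (he' : IsHom i s σB' σB ev')
    {T : Type} [AddCommGroup T] {τ : Representation ℤ E T} {r : T →+ B} {g : T →+ M}
    (hr : Compat τ (σB.comp π) (MonoidHom.id E) r) (hg : Compat τ σ s g)
    (hrg : ∀ w c, g (τ (i w) c) = ev (r c) w + g c)
    (q : ℕ) (hv : ∀ q', q = q' + 1 → Van σB' q') (c : (Fin q → E) → T) (hc : dC τ q c = 0) :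
    IsB (σB.comp π) q (pull (MonoidHom.id E) r c) := by
  obtain ⟨j, hj, hj'⟩ := h.exists_inv_quot (h.princ_coindRep σ) (h.const_isInv σ) he
  have hpr := Princ.quot (h.const_ses σ) (h.princ_coindRep σ)
  obtain ⟨j', hjj, -⟩ := h.exists_inv_quot hpr hj he'
  have hses := quot_ses (hj.compat h) hj.inj
  have hinj : Inj (σB.comp π) (quotRep _ _ ((h.const_isInv σ).compat h).exists) (MonoidHom.id E) j q := by
    cases q with
    | zero => exact hses.inj_zero
    | succ q => exact hses.inj_succ (h.van q (Princ.quot hses hpr) hjj (hv q rfl))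
  refine hinj _ (by rw [dC_pull hr, hc, pull_zero]) ?_
  have hθ : ∀ t, j (r t) = QuotientAddGroup.mk' _ (toCoind hg t) := fun t => hj' _ _ fun v =>
    Subtype.ext <| funext fun x => by
      obtain ⟨w, hw⟩ := h.decomp x
      have hg' : ∀ l t, g (τ (s l) t) = σ l (g t) := hg
      change g (τ (x * i v) t) - g (τ x t) = σ (π x) (ev (r t) v)
      rw [hw, mul_assoc, ← map_mul, rep_mul, rep_mul, hg', hg', hrg, hrg, he.map_mul, ← map_sub]
      simp only [map_mul, h.sec, h.triv, mul_one]
      congr 1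
      abel
  set θ := pull (MonoidHom.id E) (toCoind hg) c with hθdef
  have hcθ : dC (coindRep σ s) q θ = 0 := by rw [dC_pull (toCoind_compat hg), hc, pull_zero]
  have hJ := coindRep_isCoind σ h.s_inj
  set y := pull (MonoidHom.id E) (h.const σ)
    (pull π (AddMonoidHom.id M) (pull s (coindEv σ s) θ)) with hy
  have hcπ : Compat σ (σ.comp π) π (AddMonoidHom.id M) := fun _ _ => rfl
  have hcy : dC (coindRep σ s) q y = 0 := by
    rw [dC_pull (h.const_ses σ).cj, dC_pull hcπ, dC_pull hJ.compat, hcθ, pull_zero, pull_zero,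
      pull_zero]
  have h1 : IsB (coindRep σ s) q (θ - y) := by
    refine hJ.van_inj q _ (by rw [dC_sub, hcθ, hcy, sub_self]) ?_
    rw [pull_sub, show pull s (coindEv σ s) y = pull s (coindEv σ s) θ from ?_, sub_self]
    · exact IsB.zero _ _
    · funext a
      simp [hy, pull, coindEv, h.const_apply, h.sec]
  have h2 := h1.pull (h.const_ses σ).cp
  rw [pull_sub, hy, (h.const_ses σ).pull_pull, sub_zero] at h2
  convert h2 using 1
  funext a
  exact hθ _

end

section
variable {G H M A : Type} [Group G] [Group H] [AddCommGroup M] [AddCommGroup A]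

theorem Van.of_equiv {ρ : Representation ℤ G M} {σ : Representation ℤ H A} (φ : H ≃* G)
    (f : M ≃+ A) (hc : Compat ρ σ φ.toMonoidHom f.toAddMonoidHom) {q : ℕ} (h : Van σ q) :
    Van ρ q := by
  refine Van.of_inj hc (fun c _ hb => ?_) h
  have hc' : Compat σ ρ φ.symm.toMonoidHom f.symm.toAddMonoidHom := fun g a => by
    have := hc (φ.symm g) (f.symm a)
    simp only [MulEquiv.toMonoidHom_eq_coe, MonoidHom.coe_coe, MulEquiv.apply_symm_apply,
      AddEquiv.toAddMonoidHom_eq_coe, AddMonoidHom.coe_coe, AddEquiv.apply_symm_apply] at this ⊢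
    rw [← this, AddEquiv.symm_apply_apply]
  have := hb.pull hc'
  convert this using 1
  funext g
  simp [pull]

theorem Van.isZero {ρ : Representation ℤ G M} {q : ℕ} (h : Van ρ q) :
    Limits.IsZero (groupCohomology (Rep.of ρ) q) := by
  refine ((groupCohomology.inhomogeneousCochains (Rep.of ρ)).exactAt_iff_isZero_homology q).1 ?_
  cases q with
  | zero =>
    rw [HomologicalComplex.exactAt_iff' _ 0 0 1 (by simp) (by simp), ShortComplex.moduleCat_exact_iff]
    intro c hc
    refine ⟨0, ?_⟩
    rw [map_zero]
    refine ((h c ?_).symm : (0 : (Fin 0 → G) → M) = c)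
    exact (dC_eq ρ 0 c).trans hc
  | succ q =>
    rw [HomologicalComplex.exactAt_iff' _ q (q + 1) (q + 2) (by simp) (by simp),
      ShortComplex.moduleCat_exact_iff]
    intro c hc
    obtain ⟨b, hb⟩ := h c ((dC_eq ρ (q + 1) c).trans hc)
    exact ⟨b, ((hb.trans (dC_eq ρ q b)).symm :)⟩

end

section
variable {G C : Type} [Group G] [AddCommGroup C]

/-- A stable subgroup of a representation. -/
def subRep (ρ : Representation ℤ G C) (K : AddSubgroup C) (hK : ∀ g, ∀ c ∈ K, ρ g c ∈ K) :
    Representation ℤ G K :=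
  mkRep (fun g =>
    { toFun := fun c => ⟨ρ g c.1, hK g c.1 c.2⟩
      map_zero' := Subtype.ext (by simp)
      map_add' := fun _ _ => Subtype.ext (by simp) })
    (fun c => Subtype.ext (by simp)) (fun g g' c => Subtype.ext (by simp))

@[simp] theorem subRep_val (ρ : Representation ℤ G C) (K : AddSubgroup C)
    (hK : ∀ g, ∀ c ∈ K, ρ g c ∈ K) (g : G) (c : K) : (subRep ρ K hK g c).1 = ρ g c.1 := rfl

/-- A complex of stable subgroups. -/
structure Cx (ρ : Representation ℤ G C) (K : ℕ → AddSubgroup C) (d : C →+ C) : Prop where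
  stable : ∀ p g, ∀ c ∈ K p, ρ g c ∈ K p
  equi : ∀ g c, d (ρ g c) = ρ g (d c)
  maps : ∀ p, ∀ c ∈ K p, d c ∈ K (p + 1)
  sq : ∀ c, d (d c) = 0

namespace Cx
variable {ρ : Representation ℤ G C} {K : ℕ → AddSubgroup C} {d : C →+ C}

theorem stable_ker (h : Cx ρ K d) (p : ℕ) (g : G) : ∀ c ∈ K p ⊓ d.ker, ρ g c ∈ K p ⊓ d.ker := by
  rintro c ⟨h1, h2⟩
  refine ⟨h.stable p g c h1, ?_⟩
  change d (ρ g c) = 0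
  rw [h.equi, show d c = 0 from h2, map_zero]

/-- The differential. -/
def map (h : Cx ρ K d) (p : ℕ) : K p →+ K (p + 1) where
  toFun c := ⟨d c.1, h.maps p c.1 c.2⟩
  map_zero' := Subtype.ext (by simp)
  map_add' _ _ := Subtype.ext (by simp)

/-- The differential with values in the cocycles. -/
def mapKer (h : Cx ρ K d) (p : ℕ) : K p →+ (K (p + 1) ⊓ d.ker : AddSubgroup C) where
  toFun c := ⟨d c.1, h.maps p c.1 c.2, h.sq c.1⟩
  map_zero' := Subtype.ext (by simp)
  map_add' _ _ := Subtype.ext (by simp)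

theorem ker_ses (h : Cx ρ K d) {p : ℕ} (hp : ∀ c ∈ K (p + 1), d c = 0 → ∃ b ∈ K p, d b = c) :
    SES (subRep ρ _ (h.stable_ker p)) (subRep ρ _ (h.stable p))
      (subRep ρ _ (h.stable_ker (p + 1))) (AddSubgroup.inclusion inf_le_left) (h.mapKer p) where
  cj _ _ := rfl
  cp g c := Subtype.ext (h.equi g c.1)
  inj := AddSubgroup.inclusion_injective _
  surj c := by
    obtain ⟨b, hb, hbc⟩ := hp c.1 c.2.1 c.2.2
    exact ⟨⟨b, hb⟩, Subtype.ext hbc⟩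
  comp c := Subtype.ext c.2.2
  ex c hc := ⟨⟨c.1, c.2, congrArg Subtype.val hc⟩, rfl⟩

theorem van_ker (h : Cx ρ K d) (q : ℕ) : ∀ p,
    (∀ j, p ≤ j → j < p + q → ∀ c ∈ K (j + 1), d c = 0 → ∃ b ∈ K j, d b = c) →
    (∀ j r, p ≤ j → j + r = p + q → Van (subRep ρ _ (h.stable j)) r) →
    Van (subRep ρ _ (h.stable_ker p)) q := by
  induction q with
  | zero =>
    intro p _ hv
    refine Van.of_inj (f := AddSubgroup.inclusion inf_le_left) (φ := MonoidHom.id G) (fun _ _ => rfl)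
      (fun c _ hb => ?_) (hv p 0 le_rfl rfl)
    funext g
    exact AddSubgroup.inclusion_injective _ (congrFun hb g)
  | succ q ih =>
    intro p he hv
    exact (h.ker_ses (he p le_rfl (by omega))).van_sub
      (ih (p + 1) (fun j h1 h2 => he j (by omega) (by omega))
        fun j r h1 h2 => hv j r (by omega) (by omega)) (hv p (q + 1) le_rfl rfl)

/-- Dimension shifting. -/
theorem inj_zero_one (h : Cx ρ K d) (q : ℕ) (h0 : ∀ c ∈ K 0, d c = 0 → c = 0)
    (he : ∀ j < q + 1, ∀ c ∈ K (j + 1), d c = 0 → ∃ b ∈ K j, d b = c)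
    (hv : ∀ j r, 2 ≤ j → j + r = q + 1 → Van (subRep ρ _ (h.stable j)) r) :
    Inj (subRep ρ _ (h.stable 0)) (subRep ρ _ (h.stable 1)) (MonoidHom.id G) (h.map 0) q := by
  have hinj : Function.Injective (h.map 0) := (injective_iff_map_eq_zero _).2 fun c hc =>
    Subtype.ext (h0 c.1 c.2 (congrArg Subtype.val hc))
  cases q with
  | zero =>
    intro c _ hb
    funext g
    exact hinj ((congrFun hb g).trans (map_zero _).symm)
  | succ q =>
    have hs : SES (subRep ρ _ (h.stable 0)) (subRep ρ _ (h.stable 1))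
        (subRep ρ _ (h.stable_ker 2)) (h.map 0) (h.mapKer 1) :=
      { cj := fun g c => Subtype.ext (h.equi g c.1)
        cp := (h.ker_ses (he 1 (by omega))).cp
        inj := hinj
        surj := (h.ker_ses (he 1 (by omega))).surj
        comp := fun c => Subtype.ext (h.sq c.1)
        ex := fun c hc => by
          obtain ⟨b, hb, hbc⟩ := he 0 (by omega) c.1 c.2 (congrArg Subtype.val hc)
          exact ⟨⟨b, hb⟩, Subtype.ext hbc⟩ }
    exact hs.inj_succ (h.van_ker q 2 (fun j h1 h2 => he j (by omega))
      fun j r h1 h2 => hv j r h1 (by omega))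

end Cx
end

section
variable (F : Type) [Group F]

/-- Integer valued functions of `k` elements of a group which are additive in each variable. -/
def multi (k : ℕ) : AddSubgroup ((Fin k → F) → ℤ) where
  carrier := {c | ∀ h j a b, c (Function.update h j (a * b)) =
    c (Function.update h j a) + c (Function.update h j b)}
  zero_mem' := fun h j a b => by simp
  add_mem' := fun {c c'} hc hc' h j a b => by
    simp only [Pi.add_apply, hc h j a b, hc' h j a b]; abel
  neg_mem' := fun {c} hc h j a b => by
    simp only [Pi.neg_apply, hc h j a b]; abel

variable {F}

theorem comp_update_aut {F E : Type} {k : ℕ} (φ : F → E) (h : Fin k → F) (j : Fin k) (a : F) :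
    (fun l => φ (Function.update h j a l)) = Function.update (fun l => φ (h l)) j (φ a) := by
  funext l
  by_cases hl : l = j
  · subst hl; simp
  · simp [hl]

/-- The action of the automorphism group on multiadditive functions. -/
def formRep (k : ℕ) : Representation ℤ (MulAut F) (multi F k) :=
  mkRep (fun φ =>
    { toFun := fun c => ⟨fun h => c.1 fun l => φ⁻¹ (h l), fun h j a b => by
        beta_reduce
        simp only [comp_update_aut (⇑φ⁻¹), map_mul]
        exact c.2 _ _ _ _⟩
      map_zero' := rfl
      map_add' := fun _ _ => rfl })
    (fun c => rfl) (fun φ ψ c => Subtype.ext <| funext fun h => by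
      change c.1 _ = c.1 _
      simp)

/-- Evaluation of a multiadditive function in the first variable. -/
def formEv {k : ℕ} (c : multi F (k + 1)) (v : F) : multi F k :=
  ⟨fun h => c.1 (Fin.cons v h), fun h j a b => by
    beta_reduce
    simp only [Fin.cons_update]
    exact c.2 _ _ _ _⟩

@[simp] theorem formEv_apply {k : ℕ} (c : multi F (k + 1)) (v : F) (h : Fin k → F) :
    (formEv c v).1 h = c.1 (Fin.cons v h) := rfl

theorem formEv_isHom {E L : Type} [Group E] [Group L] {i : F →* E} {s : L →* E} (γ : L →* MulAut F)
    (hγ : ∀ l w w', i w * s l = s l * i w' → w = γ l w') (k : ℕ) :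
    IsHom i s ((formRep (k + 1)).comp γ) ((formRep k).comp γ) formEv where
  map_add _ _ _ := rfl
  map_mul c v w := Subtype.ext <| funext fun h => by
    have := c.2 (Fin.cons 1 h) 0 v w
    simp only [Fin.update_cons_zero] at this
    exact this
  ext c c' h := Subtype.ext <| funext fun x => by
    have := congrFun (congrArg Subtype.val (h (x 0))) (fun l => x l.succ)
    simp only [formEv_apply] at this
    rwa [show (Fin.cons (x 0) fun l => x l.succ : Fin (k + 1) → F) = x from Fin.cons_self_tail x]
      at this
  ex z hz := by
    refine ⟨⟨fun x => (z (x 0)).1 (Fin.tail x), fun h j a b => ?_⟩, fun v => rfl⟩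
    beta_reduce
    refine Fin.cases ?_ (fun j => ?_) j
    · simp only [Function.update_self, Fin.tail_update_zero, hz]
      rfl
    · simp only [Fin.tail_update_succ]
      rw [Function.update_of_ne (Fin.succ_ne_zero j).symm,
        Function.update_of_ne (Fin.succ_ne_zero j).symm,
        Function.update_of_ne (Fin.succ_ne_zero j).symm]
      exact (z (h 0)).2 _ _ _ _
  equi l c w w' h := Subtype.ext <| funext fun x => by
    change c.1 _ = c.1 _
    refine congrArg c.1 (funext fun j => ?_)
    refine Fin.cases ?_ (fun j => ?_) j
    · simp [hγ l w w' h]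
    · simp

end

section
variable (I F : Type) [Group F]

/-- The diagonal action of the automorphism group on a power. -/
def piAct : MulAut F →* MulAut (I → F) where
  toFun φ := MulEquiv.piCongrRight fun _ => φ
  map_one' := rfl
  map_mul' _ _ := rfl

/-- The semidirect product of a power of a group with its automorphism group. -/
abbrev Ext := (I → F) ⋊[piAct I F] MulAut F

variable {I F}

@[simp] theorem piAct_apply (φ : MulAut F) (a : I → F) (j : I) : piAct I F φ a j = φ (a j) := rfl

theorem ext_ext {x y : Ext I F} (h1 : ∀ j, x.left j = y.left j) (h2 : x.right = y.right) : x = y :=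
  SemidirectProduct.ext (funext h1) h2

variable (I F)

/-- The first factor. -/
def optI : F →* Ext (Option I) F where
  toFun v := ⟨fun o => o.elim v fun _ => 1, 1⟩
  map_one' := ext_ext (fun j => by cases j <;> rfl) rfl
  map_mul' v w := ext_ext (fun j => by cases j <;> simp) (by simp)

/-- The other factors. -/
def optS : Ext I F →* Ext (Option I) F where
  toFun x := ⟨fun o => o.elim 1 x.left, x.right⟩
  map_one' := ext_ext (fun j => by cases j <;> rfl) rfl
  map_mul' v w := ext_ext (fun j => by cases j <;> simp) (by simp)

/-- Forgetting the first factor. -/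
def optP : Ext (Option I) F →* Ext I F where
  toFun x := ⟨fun o => x.left (some o), x.right⟩
  map_one' := rfl
  map_mul' v w := rfl

theorem opt_split : Split (optI I F) (optS I F) (optP I F) where
  sec l := rfl
  triv v := rfl
  inj v w h := congrFun (congrArg SemidirectProduct.left h) none
  ker e h := ⟨e.left none, ext_ext (fun j => by
    cases j with
    | none => rfl
    | some j => exact (congrFun (congrArg SemidirectProduct.left h) j).symm)
    (congrArg SemidirectProduct.right h).symm⟩

theorem opt_isHom (k : ℕ) : IsHom (optI I F) (optS I F)
    ((formRep (k + 1)).comp SemidirectProduct.rightHom)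
    ((formRep k).comp SemidirectProduct.rightHom) formEv :=
  formEv_isHom _ (fun l w w' h => by
    have := congrFun (congrArg SemidirectProduct.left h) none
    simpa [optI, optS] using this) k

/-- The only factor. -/
def unitI : F →* Ext Unit F where
  toFun v := ⟨fun _ => v, 1⟩
  map_one' := rfl
  map_mul' v w := ext_ext (fun j => by simp) (by simp)

theorem unit_split : Split (unitI F) (SemidirectProduct.inr (φ := piAct Unit F))
    SemidirectProduct.rightHom where
  sec l := rfl
  triv v := rfl
  inj v w h := congrFun (congrArg SemidirectProduct.left h) ()
  ker e h := ⟨e.left (), ext_ext (fun j => rfl) h.symm⟩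

theorem unit_isHom (k : ℕ) : IsHom (unitI F) (SemidirectProduct.inr (φ := piAct Unit F))
    (formRep (k + 1)) (formRep k) formEv :=
  formEv_isHom (MonoidHom.id _) (fun l w w' h => by
    have := congrFun (congrArg SemidirectProduct.left h) ()
    simpa [unitI] using this) k

variable {I}

/-- Reindexing. -/
def extCongr {J : Type} (e : I ≃ J) : Ext J F ≃* Ext I F where
  toFun x := ⟨fun i => x.left (e i), x.right⟩
  invFun x := ⟨fun j => x.left (e.symm j), x.right⟩
  left_inv x := ext_ext (fun j => by simp) rfl
  right_inv x := ext_ext (fun j => by simp) rfl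
  map_mul' x y := rfl

end

theorem van_ext {X : Type} (I : Type) [Finite I] : ∀ k q : ℕ,
    (∀ j r, k ≤ j → j + r = k + q → Van (formRep (F := FreeGroup X) j) r) →
    Van ((formRep (F := FreeGroup X) k).comp
      (SemidirectProduct.rightHom : Ext I (FreeGroup X) →* _)) q := by
  induction I using Finite.induction_empty_option with
  | of_equiv e ih =>
    intro k q hv
    exact Van.of_equiv (extCongr (FreeGroup X) e).symm (AddEquiv.refl _) (fun _ _ => rfl) (ih k q hv)
  | h_empty =>
    intro k q hv
    refine Van.of_equiv (MulEquiv.mk' ⟨fun φ => (⟨fun x => x.elim, φ⟩ : Ext PEmpty _),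
      SemidirectProduct.rightHom, fun _ => rfl, fun x => ext_ext (fun j => j.elim) rfl⟩
      fun x y => ext_ext (fun j => j.elim) rfl) (AddEquiv.refl _) (fun _ _ => rfl)
      (hv k q le_rfl rfl)
  | h_option ih =>
    intro k q hv
    have h1 := ih k q hv
    cases q with
    | zero => exact (opt_split _ _).van_comp_zero h1
    | succ q =>
      exact (opt_split _ _).van_comp_succ (opt_isHom _ _ k) h1
        (ih (k + 1) q fun j r hj hr => hv j r (by omega) (by omega))

section Lists
variable {α β : Type}

/-- The alternating sum over the omissions of one entry of a list. -/
def dl : List α → (List α → ℤ) → ℤ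
  | [], _ => 0
  | v :: σ, c => c σ - dl σ fun τ => c (v :: τ)

theorem dl_congr {σ : List α} : ∀ {c c' : List α → ℤ},
    (∀ τ, τ.Sublist σ → τ.length + 1 = σ.length → c τ = c' τ) → dl σ c = dl σ c' := by
  induction σ with
  | nil => intros; rfl
  | cons v σ ih =>
    intro c c' h
    rw [dl, dl, h σ (List.sublist_cons_self v σ) rfl, ih fun τ hτ hl => h _ (hτ.cons_cons v) (by
      simp [hl])]

theorem dl_zero (σ : List α) : dl σ (fun _ => 0) = 0 := by
  induction σ with
  | nil => rfl
  | cons v σ ih => rw [dl, ih]; rfl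

theorem dl_add (σ : List α) : ∀ c c' : List α → ℤ,
    dl σ (fun τ => c τ + c' τ) = dl σ c + dl σ c' := by
  induction σ with
  | nil => intros; rfl
  | cons v σ ih => intro c c'; rw [dl, dl, dl, ih]; ring

theorem dl_mul (σ : List α) (m : ℤ) : ∀ c : List α → ℤ, dl σ (fun τ => m * c τ) = m * dl σ c := by
  induction σ with
  | nil => intros; simp [dl]
  | cons v σ ih => intro c; rw [dl, dl, ih]; ring

theorem dl_sub (σ : List α) (c c' : List α → ℤ) :
    dl σ (fun τ => c τ - c' τ) = dl σ c - dl σ c' := by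
  have := dl_add σ c fun τ => -1 * c' τ
  rw [dl_mul] at this
  simpa [sub_eq_add_neg] using this

theorem dl_eq_zero {σ : List α} {c : List α → ℤ}
    (h : ∀ τ, τ.Sublist σ → τ.length + 1 = σ.length → c τ = 0) : dl σ c = 0 :=
  (dl_congr h).trans (dl_zero σ)

theorem dl_dl (σ : List α) : ∀ c : List α → ℤ, dl σ (fun τ => dl τ c) = 0 := by
  induction σ with
  | nil => intros; rfl
  | cons v σ ih =>
    intro c
    rw [dl]
    simp only [dl]
    rw [dl_sub, ih, sub_zero, sub_self]

theorem dl_map (f : α → β) (w : List α) : ∀ c : List β → ℤ,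
    dl (w.map f) c = dl w fun τ => c (τ.map f) := by
  induction w with
  | nil => intros; rfl
  | cons v w ih => intro c; rw [List.map_cons, dl, dl, ih]; rfl

end Lists

section OneRose
variable {ι : Type} [DecidableEq ι]

/-- Words in signed letters with distinct underlying letters. -/
def Nd (w : List (ι × Bool)) : Prop := (w.map Prod.fst).Nodup

omit [DecidableEq ι] in
theorem Nd.sublist {w w' : List (ι × Bool)} (h : Nd w) (hw : w'.Sublist w) : Nd w' :=
  List.Nodup.sublist (hw.map _) h

/-- The complex of words with distinct letters in a finite alphabet is highly connected, relative to
the words which miss one of the letters of a proper subset. -/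
theorem one_rose (L : Finset ι) (ℓ : ℕ) (hℓ : ℓ < L.card) : ∀ (m : ℕ) (R : Finset ι),
    R ⊆ L → (L \ R).card = m → ∀ r : List (ι × Bool) → ℤ,
    (∀ w, r w ≠ 0 → (Nd w ∧ ∀ x ∈ w, x.1 ∈ L) ∧ w.length = ℓ ∧ ∀ a ∈ R, a ∈ w.map Prod.fst) →
    (∀ w, (Nd w ∧ ∀ x ∈ w, x.1 ∈ L) → dl w r = 0) →
    ∃ b : List (ι × Bool) → ℤ,
      (∀ w, b w ≠ 0 → (Nd w ∧ ∀ x ∈ w, x.1 ∈ L) ∧ w.length + 1 = ℓ ∧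
        ∀ a ∈ R, a ∈ w.map Prod.fst) ∧
      ∀ w, (Nd w ∧ ∀ x ∈ w, x.1 ∈ L) → dl w b = r w := by
  classical
  intro m
  induction m with
  | zero =>
    intro R hR hm r hr hd
    refine ⟨fun _ => 0, fun w h => (h rfl).elim, fun w hw => ?_⟩
    rw [dl_zero]
    by_contra h
    obtain ⟨h1, h2, h3⟩ := hr w (Ne.symm h)
    have h4 : L ⊆ (w.map Prod.fst).toFinset := fun a ha => List.mem_toFinset.2 <| h3 a <| by
      by_contra hc
      have := Finset.card_eq_zero.1 hm
      exact Finset.notMem_empty a (this ▸ Finset.mem_sdiff.2 ⟨ha, hc⟩)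
    have h5 := (Finset.card_le_card h4).trans (List.toFinset_card_le _)
    rw [List.length_map, h2] at h5
    omega
  | succ m ih =>
    intro R hR hm r hr hd
    obtain ⟨a, ha⟩ : (L \ R).Nonempty := Finset.card_pos.1 (by omega)
    obtain ⟨haL, haR⟩ := Finset.mem_sdiff.1 ha
    let good : List (ι × Bool) → Prop := fun w => Nd w ∧ ∀ x ∈ w, x.1 ∈ L
    have good_sub : ∀ {w w' : List (ι × Bool)}, good w → w'.Sublist w → good w' :=
      fun h hs => ⟨h.1.sublist hs, fun x hx => h.2 x (hs.subset hx)⟩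
    let b1 : List (ι × Bool) → ℤ := fun τ => r ((a, true) :: τ)
    have hb1 : ∀ w, b1 w ≠ 0 → good w ∧ w.length + 1 = ℓ ∧ ∀ x ∈ R, x ∈ w.map Prod.fst := by
      intro w hw
      obtain ⟨h1, h2, h3⟩ := hr _ hw
      refine ⟨good_sub h1 (List.sublist_cons_self _ _), by simpa using h2, fun x hx => ?_⟩
      have := h3 x hx
      rw [List.map_cons, List.mem_cons] at this
      rcases this with rfl | h
      · exact (haR hx).elim
      · exact h
    have key : ∀ w, good w → a ∉ w.map Prod.fst → dl w b1 = r w := by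
      intro w hw haw
      have := hd ((a, true) :: w) ⟨List.nodup_cons.2 ⟨haw, hw.1⟩, fun x hx => by
        rcases List.mem_cons.1 hx with rfl | h
        · exact haL
        · exact hw.2 x h⟩
      rw [dl] at this
      exact (sub_eq_zero.1 this).symm
    let r' : List (ι × Bool) → ℤ := fun w => if good w then r w - dl w b1 else 0
    obtain ⟨b2, hb2, hb2'⟩ := ih (insert a R) (Finset.insert_subset haL hR)
      (by rw [Finset.sdiff_insert, Finset.card_erase_of_mem ha, hm]; rfl) r' (by
        intro w hw
        have hg : good w := by
          by_contra hg
          exact hw (if_neg hg)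
        have hw' : r w - dl w b1 ≠ 0 := by simpa [r', hg] using hw
        have h1 : w.length = ℓ ∧ ∀ x ∈ R, x ∈ w.map Prod.fst := by
          by_cases h0 : r w = 0
          · by_contra hcon
            apply hw'
            rw [h0, zero_sub, neg_eq_zero]
            refine dl_eq_zero fun τ hτ hl => ?_
            by_contra hb
            obtain ⟨-, h2, h3⟩ := hb1 τ hb
            exact hcon ⟨by omega, fun x hx => (hτ.map _).subset (h3 x hx)⟩
          · exact (hr w h0).2
        refine ⟨hg, h1.1, fun x hx => ?_⟩
        rcases Finset.mem_insert.1 hx with rfl | hx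
        · by_contra hc
          exact hw' (by rw [key w hg hc, sub_self])
        · exact h1.2 x hx) (by
        intro w hw
        rw [dl_congr (c' := fun τ => r τ - dl τ b1) fun τ hτ _ => if_pos (good_sub hw hτ), dl_sub,
          hd w hw, dl_dl, sub_self])
    refine ⟨fun w => b1 w + b2 w, fun w hw => ?_, fun w hw => ?_⟩
    · by_cases h : b1 w = 0
      · obtain ⟨h1, h2, h3⟩ := hb2 w (by simpa [h] using hw)
        exact ⟨h1, h2, fun x hx => h3 x (Finset.mem_insert_of_mem hx)⟩
      · exact hb1 w h
    · rw [dl_add, hb2' w hw]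
      simp only [r', if_pos (show good w from hw)]
      ring

end OneRose

section Coefficients
variable {F : Type} [Group F]

/-- Additivity in each variable, on a subgroup. -/
def AddOn (H : Subgroup F) {k : ℕ} (c : (Fin k → F) → ℤ) : Prop :=
  ∀ h : Fin k → F, (∀ l, h l ∈ H) → ∀ j, ∀ a ∈ H, ∀ b ∈ H,
    c (Function.update h j (a * b)) = c (Function.update h j a) + c (Function.update h j b)

theorem AddOn.sub {H : Subgroup F} {k : ℕ} {c c' : (Fin k → F) → ℤ} (hc : AddOn H c)
    (hc' : AddOn H c') : AddOn H fun h => c h - c' h := fun h hh j a ha b hb => by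
  simp only [hc h hh j a ha b hb, hc' h hh j a ha b hb]; ring

theorem AddOn.mul {H : Subgroup F} {k : ℕ} {c : (Fin k → F) → ℤ} (hc : AddOn H c) (m : ℤ) :
    AddOn H fun h => m * c h := fun h hh j a ha b hb => by
  simp only [hc h hh j a ha b hb]; ring

theorem AddOn.zero (H : Subgroup F) (k : ℕ) : AddOn H fun _ : Fin k → F => 0 :=
  fun _ _ _ _ _ _ _ => rfl

theorem AddOn.sum {I : Type} (s : Finset I) {H : Subgroup F} {k : ℕ} {c : I → (Fin k → F) → ℤ}
    (hc : ∀ i, AddOn H (c i)) : AddOn H fun h => ∑ i ∈ s, c i h := fun h hh j a ha b hb => by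
  simp only [hc _ h hh j a ha b hb, Finset.sum_add_distrib]

theorem AddOn.mono {H H' : Subgroup F} {k : ℕ} {c : (Fin k → F) → ℤ} (hc : AddOn H c)
    (h : H' ≤ H) : AddOn H' c := fun x hx j a ha b hb =>
  hc x (fun l => h (hx l)) j a (h ha) b (h hb)

theorem AddOn.dl {α : Type} {k : ℕ} {H : Subgroup F} (σ : List α) :
    ∀ {c : (Fin k → F) → List α → ℤ}, (∀ τ, τ.Sublist σ → AddOn H fun h => c h τ) →
      AddOn H fun h => GrpCoh.dl σ (c h) := by
  induction σ with
  | nil => intro c _; exact AddOn.zero H k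
  | cons v σ ih =>
    intro c hc
    exact (hc σ (List.sublist_cons_self v σ)).sub
      (ih (c := fun h τ => c h (v :: τ)) fun τ hτ => hc _ (hτ.cons_cons v))

theorem AddOn.prod {k : ℕ} (H : Subgroup F) (e : Fin k → F → ℤ)
    (he : ∀ j a b, e j (a * b) = e j a + e j b) : AddOn H fun h => ∏ j, e j (h j) := by
  classical
  intro h _ j a _ b _
  have key : ∀ x, ∏ l, e l (Function.update h j x l) =
      e j x * ∏ l ∈ Finset.univ.erase j, e l (h l) := fun x => by
    rw [← Finset.mul_prod_erase _ _ (Finset.mem_univ j), Function.update_self]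
    congr 1
    exact Finset.prod_congr rfl fun l hl => by rw [Function.update_of_ne (Finset.ne_of_mem_erase hl)]
  simp only [key, he]
  ring

/-- A function which is additive in each variable is determined by its values on generators. -/
theorem AddOn.eq_zero {k : ℕ} {S : Set F} {c : (Fin k → F) → ℤ}
    (hc : AddOn (Subgroup.closure S) c) (h0 : ∀ h, (∀ l, h l ∈ S) → c h = 0) :
    ∀ h, (∀ l, h l ∈ Subgroup.closure S) → c h = 0 := by
  have key : ∀ m, m ≤ k → ∀ h : Fin k → F, (∀ l, h l ∈ Subgroup.closure S) →
      (∀ l : Fin k, m ≤ l → h l ∈ S) → c h = 0 := by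
    intro m
    induction m with
    | zero => exact fun _ h _ hS => h0 h fun l => hS l (Nat.zero_le _)
    | succ m ih =>
      intro hm h hh hS
      have h1 : ∀ a ∈ Subgroup.closure S, c (Function.update h ⟨m, hm⟩ a) = 0 := by
        intro a ha
        have hz : c (Function.update h ⟨m, hm⟩ 1) = 0 := by
          have := hc h hh ⟨m, hm⟩ 1 (one_mem _) 1 (one_mem _)
          rw [mul_one] at this
          omega
        induction ha using Subgroup.closure_induction with
        | mem a ha =>
          refine ih (by omega) _ (fun l => ?_) fun l hl => ?_
          · by_cases e : l = ⟨m, hm⟩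
            · subst e; simpa using Subgroup.subset_closure ha
            · rw [Function.update_of_ne e]; exact hh l
          · by_cases e : l = ⟨m, hm⟩
            · subst e; simpa using ha
            · rw [Function.update_of_ne e]
              refine hS l (lt_of_le_of_ne hl fun e' => e (Fin.ext e'.symm))
        | one => exact hz
        | mul a b ha hb iha ihb => rw [hc h hh _ a ha b hb, iha, ihb, add_zero]
        | inv a ha iha =>
          have := hc h hh ⟨m, hm⟩ a ha a⁻¹ (inv_mem ha)
          rw [mul_inv_cancel, hz, iha] at this
          omega
      have := h1 _ (hh ⟨m, hm⟩)
      rwa [Function.update_eq_self] at this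
  exact fun h hh => key k le_rfl h hh fun l hl => absurd l.2 (not_lt.2 hl)

end Coefficients

section Solve
variable {ι F : Type} [DecidableEq ι] [Fintype ι] [Group F]

/-- The subgroup generated by the basis elements which do not occur in a word. -/
def wcore (y : ι → F) (w : List (ι × Bool)) : Subgroup F :=
  Subgroup.closure (y '' {j | j ∉ w.map Prod.fst})

omit [DecidableEq ι] [Fintype ι] in
theorem wcore_anti (y : ι → F) {w w' : List (ι × Bool)} (h : w'.Sublist w) :
    wcore y w ≤ wcore y w' :=
  Subgroup.closure_mono (Set.image_mono fun _ hj hj' => hj ((h.map _).subset hj'))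

theorem solve_rose (y : ι → F) (e : ι → F → ℤ) (he : ∀ i a b, e i (a * b) = e i a + e i b)
    (hey : ∀ i j, e i (y j) = if i = j then 1 else 0) {k ℓ : ℕ} (hk : ℓ + k < Fintype.card ι)
    (R : Finset ι) (r : (Fin k → F) → List (ι × Bool) → ℤ)
    (hadd : ∀ w, Nd w → AddOn (wcore y w) fun h => r h w)
    (hsupp : ∀ w h, Nd w → (∀ l, h l ∈ wcore y w) → r h w ≠ 0 →
      w.length = ℓ ∧ ∀ a ∈ R, a ∈ w.map Prod.fst)
    (hd : ∀ w h, Nd w → (∀ l, h l ∈ wcore y w) → dl w (r h) = 0) :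
    ∃ b : (Fin k → F) → List (ι × Bool) → ℤ,
      (∀ w h, b h w ≠ 0 → Nd w ∧ w.length + 1 = ℓ ∧ (∀ a ∈ R, a ∈ w.map Prod.fst)) ∧
      (∀ w, AddOn (wcore y w) fun h => b h w) ∧
      ∀ w h, Nd w → (∀ l, h l ∈ wcore y w) → dl w (b h) = r h w := by
  classical
  let L : (Fin k → ι) → Finset ι := fun f => Finset.univ \ Finset.univ.image f
  have hL : ∀ f a, a ∈ L f ↔ ∀ l, f l ≠ a := fun f a => by simp [L]
  have hcard : ∀ f, ℓ < (L f).card := fun f => by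
    have h1 : (Finset.univ.image f).card ≤ k := by simpa using Finset.card_image_le (s := Finset.univ) (f := f)
    have h2 := Finset.le_card_sdiff (Finset.univ.image f) (Finset.univ : Finset ι)
    rw [Finset.card_univ] at h2
    change ℓ < (Finset.univ \ Finset.univ.image f).card
    omega
  have hmem : ∀ (f : Fin k → ι) (w : List (ι × Bool)), (∀ x ∈ w, x.1 ∈ L f) → ∀ l, y (f l) ∈ wcore y w :=
    fun f w hw l => Subgroup.subset_closure ⟨f l, fun hf => by
      obtain ⟨x, hx, hxf⟩ := List.mem_map.1 hf
      exact (hL f _).1 (hw x hx) l hxf.symm, rfl⟩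
  have hsol : ∀ f : Fin k → ι, ∃ b : List (ι × Bool) → ℤ,
      (∀ w, b w ≠ 0 → (Nd w ∧ ∀ x ∈ w, x.1 ∈ L f) ∧ w.length + 1 = ℓ ∧
        ∀ a ∈ R, a ∈ w.map Prod.fst) ∧
      ∀ w, (Nd w ∧ ∀ x ∈ w, x.1 ∈ L f) → dl w b = r (fun l => y (f l)) w := by
    intro f
    let r' : List (ι × Bool) → ℤ := fun w =>
      if Nd w ∧ ∀ x ∈ w, x.1 ∈ L f then r (fun l => y (f l)) w else 0
    have hr' : ∀ w, r' w ≠ 0 → (Nd w ∧ ∀ x ∈ w, x.1 ∈ L f) ∧ r (fun l => y (f l)) w ≠ 0 := by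
      intro w hw
      by_cases hg : Nd w ∧ ∀ x ∈ w, x.1 ∈ L f
      · exact ⟨hg, by simpa only [r', if_pos hg] using hw⟩
      · exact (hw (if_neg hg)).elim
    by_cases hR : R ⊆ L f
    · obtain ⟨b, hb, hb'⟩ := one_rose (L f) ℓ (hcard f) _ R hR rfl r' (fun w hw => by
        obtain ⟨h1, h2⟩ := hr' w hw
        exact ⟨h1, hsupp w _ h1.1 (hmem f w h1.2) h2⟩) (fun w hw => by
        rw [← hd w (fun l => y (f l)) hw.1 (hmem f w hw.2)]
        exact dl_congr fun τ hτ _ => if_pos ⟨hw.1.sublist hτ, fun x hx => hw.2 x (hτ.subset hx)⟩)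
      exact ⟨b, hb, fun w hw => (hb' w hw).trans (if_pos hw)⟩
    · refine ⟨fun _ => 0, fun w h => (h rfl).elim, fun w hw => ?_⟩
      rw [dl_zero]
      by_contra h0
      refine hR fun a ha => ?_
      obtain ⟨x, hx, rfl⟩ := List.mem_map.1
        ((hsupp w _ hw.1 (hmem f w hw.2) (Ne.symm h0)).2 a ha)
      exact hw.2 x hx
  choose b hb hb' using hsol
  have hprod : ∀ (H : Subgroup F) (f : Fin k → ι), AddOn H fun h => ∏ j, e (f j) (h j) :=
    fun H f => AddOn.prod H _ fun j => he (f j)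
  have hadd' : ∀ (H : Subgroup F) w, AddOn H fun h => ∑ f, b f w * ∏ j, e (f j) (h j) :=
    fun H w => AddOn.sum Finset.univ fun f => (hprod H f).mul _
  refine ⟨fun h w => ∑ f, b f w * ∏ j, e (f j) (h j), fun w h hw => ?_, fun w => hadd' _ w,
    fun w h hw hh => ?_⟩
  · obtain ⟨f, -, hf⟩ := Finset.exists_ne_zero_of_sum_ne_zero hw
    obtain ⟨h1, h2⟩ := hb f w (left_ne_zero_of_mul hf)
    exact ⟨h1.1, h2⟩
  · refine sub_eq_zero.1 (AddOn.eq_zero (c := fun h => dl w (fun w =>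
      ∑ f, b f w * ∏ j, e (f j) (h j)) - r h w) ((AddOn.dl w fun τ _ => hadd' _ τ).sub
      (hadd w hw)) (fun g hg => ?_) h hh)
    choose f hf hfg using hg
    have hgf : g = fun l => y (f l) := funext fun l => (hfg l).symm
    subst hgf
    rw [sub_eq_zero, ← hb' f w ⟨hw, fun x hx => (hL f _).2 fun l e =>
      hf l (e ▸ List.mem_map_of_mem hx)⟩]
    refine dl_congr fun τ _ _ => ?_
    rw [Finset.sum_eq_single f]
    · simp [hey]
    · intro f' _ hne
      obtain ⟨l, hl⟩ := Function.ne_iff.1 hne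
      rw [Finset.prod_eq_zero (Finset.mem_univ l), mul_zero]
      rw [hey, if_neg hl]
    · simp

end Solve

section
variable {W V ι F : Type} [DecidableEq ι] [Fintype ι] [Group F]

/-- The ordered simplices of a rose. -/
def Val (D : W → ι × Bool → V) (ν : W) (τ : List V) : Prop := ∃ w, Nd w ∧ τ = w.map (D ν)

omit [DecidableEq ι] [Fintype ι] in
theorem Val.sublist {D : W → ι × Bool → V} {ν : W} {τ τ' : List V} (h : Val D ν τ)
    (hτ : τ'.Sublist τ) : Val D ν τ' := by
  obtain ⟨w, hw, rfl⟩ := h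
  obtain ⟨w', hw', rfl⟩ := List.sublist_map_iff.1 hτ
  exact ⟨w', hw.sublist hw', rfl⟩

/-- A system of roses with a shelling order. -/
structure RoseSys [LinearOrder W] (D : W → ι × Bool → V) (core : List V → Subgroup F)
    (y : W → ι → F) (e : W → ι → F → ℤ) (R : W → Finset ι) : Prop where
  inj : ∀ ν, Function.Injective (D ν)
  core_eq : ∀ ν w, Nd w → core (w.map (D ν)) = wcore (y ν) w
  e_mul : ∀ ν i a b, e ν i (a * b) = e ν i a + e ν i b
  e_y : ∀ ν i j, e ν i (y ν j) = if i = j then 1 else 0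
  mem_R : ∀ ν, ∀ i ∈ R ν, ∃ μ < ν, ∀ w, Nd w → i ∉ w.map Prod.fst → Val D μ (w.map (D ν))
  shell : ∀ μ ν, μ < ν → ∃ i ∈ R ν, ∀ w, Nd w → i ∈ w.map Prod.fst → ¬ Val D μ (w.map (D ν))

/-- Cochains with coefficients in the multiadditive functions on the cores. -/
structure IsCo (D : W → ι × Bool → V) (core : List V → Subgroup F) {k : ℕ} (ℓ : ℕ)
    (c : (Fin k → F) → List V → ℤ) : Prop where
  supp : ∀ h τ, c h τ ≠ 0 → (∃ ν, Val D ν τ) ∧ τ.length = ℓ ∧ ∀ l, h l ∈ core τ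
  add : ∀ ν τ, Val D ν τ → AddOn (core τ) fun h => c h τ

namespace RoseSys
variable [LinearOrder W] [WellFoundedLT W] {D : W → ι × Bool → V} {core : List V → Subgroup F}
  {y : W → ι → F} {e : W → ι → F → ℤ} {R : W → Finset ι} {k ℓ : ℕ}

/-- The conditions on the part of a primitive which is supported on the new simplices of a rose. -/
structure Spec (D : W → ι × Bool → V) (core : List V → Subgroup F) (R : W → Finset ι) (ℓ : ℕ)
    (c : (Fin k → F) → List V → ℤ) (ν : W) (g b : (Fin k → F) → List V → ℤ) : Prop where
  supp : ∀ h τ, b h τ ≠ 0 → ∃ w, Nd w ∧ τ = w.map (D ν) ∧ w.length + 1 = ℓ ∧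
    ∀ a ∈ R ν, a ∈ w.map Prod.fst
  add : ∀ τ, Val D ν τ → AddOn (core τ) fun h => b h τ
  eq : ∀ τ h, Val D ν τ → (∀ l, h l ∈ core τ) → dl τ (b h) = c h τ - dl τ (g h)

open Classical in
/-- The choice of the new part. -/
def sol (D : W → ι × Bool → V) (core : List V → Subgroup F) (R : W → Finset ι) (ℓ : ℕ)
    (c : (Fin k → F) → List V → ℤ) (ν : W) (g : (Fin k → F) → List V → ℤ) :
    (Fin k → F) → List V → ℤ :=
  if H : ∃ b, Spec D core R ℓ c ν g b then H.choose else fun _ _ => 0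

open Classical in
/-- The new parts, by recursion on the rose. -/
def part (D : W → ι × Bool → V) (core : List V → Subgroup F) (R : W → Finset ι) (ℓ : ℕ)
    (c : (Fin k → F) → List V → ℤ) : W → (Fin k → F) → List V → ℤ :=
  (wellFounded_lt (α := W)).fix fun ν rec => sol D core R ℓ c ν fun h τ =>
    if H : ∃ μ, μ < ν ∧ IsLeast {μ | Val D μ τ} μ then rec H.choose H.choose_spec.1 h τ else 0

open Classical in
/-- The sum of the new parts. -/
def prim (D : W → ι × Bool → V) (core : List V → Subgroup F) (R : W → Finset ι) (ℓ : ℕ)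
    (c : (Fin k → F) → List V → ℤ) (h : Fin k → F) (τ : List V) : ℤ :=
  if H : ∃ μ, IsLeast {μ | Val D μ τ} μ then part D core R ℓ c H.choose h τ else 0

open Classical in
/-- The sum of the earlier parts. -/
def before (D : W → ι × Bool → V) (core : List V → Subgroup F) (R : W → Finset ι) (ℓ : ℕ)
    (c : (Fin k → F) → List V → ℤ) (ν : W) (h : Fin k → F) (τ : List V) : ℤ :=
  if ∃ μ, μ < ν ∧ IsLeast {μ | Val D μ τ} μ then prim D core R ℓ c h τ else 0

variable (c : (Fin k → F) → List V → ℤ)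

omit [DecidableEq ι] [Fintype ι] in
theorem prim_eq {τ : List V} {μ : W} (hμ : IsLeast {μ | Val D μ τ} μ) (h : Fin k → F) :
    prim D core R ℓ c h τ = part D core R ℓ c μ h τ := by
  have H : ∃ μ, IsLeast {μ | Val D μ τ} μ := ⟨μ, hμ⟩
  rw [prim, dif_pos H, H.choose_spec.unique hμ]

omit [DecidableEq ι] [Fintype ι] in
theorem part_eq (ν : W) :
    part D core R ℓ c ν = sol D core R ℓ c ν (before D core R ℓ c ν) := by
  rw [part, WellFounded.fix_eq]
  congr 1
  funext h τ
  rw [before]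
  split_ifs with H
  · exact (prim_eq c H.choose_spec.2 h).symm
  · rfl

omit [DecidableEq ι] [Fintype ι] in
theorem exists_least {τ : List V} {ν : W} (h : Val D ν τ) :
    ∃ μ ≤ ν, IsLeast {μ | Val D μ τ} μ := by
  have hne : {μ | Val D μ τ}.Nonempty := ⟨ν, h⟩
  have hl : ∀ a ∈ {μ | Val D μ τ}, (wellFounded_lt (α := W)).min _ hne ≤ a := fun a ha =>
    not_lt.1 (WellFounded.not_lt_min _ _ ha)
  exact ⟨_, hl ν h, WellFounded.min_mem _ _ hne, hl⟩

omit [DecidableEq ι] [Fintype ι] in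
theorem part_supp {ν : W} {h : Fin k → F} {τ : List V} (hb : part D core R ℓ c ν h τ ≠ 0) :
    ∃ w, Nd w ∧ τ = w.map (D ν) ∧ w.length + 1 = ℓ ∧ ∀ a ∈ R ν, a ∈ w.map Prod.fst := by
  rw [part_eq, sol] at hb
  split_ifs at hb with H
  · exact H.choose_spec.supp _ _ hb
  · exact (hb rfl).elim

omit [DecidableEq ι] [Fintype ι] in
theorem part_add {ν : W} {τ : List V} (hτ : Val D ν τ) :
    AddOn (core τ) fun h => part D core R ℓ c ν h τ := by
  simp only [part_eq, sol]
  split_ifs with H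
  · exact H.choose_spec.add _ hτ
  · exact AddOn.zero _ _

omit [DecidableEq ι] [Fintype ι] in
theorem prim_supp {h : Fin k → F} {τ : List V} (hb : prim D core R ℓ c h τ ≠ 0) :
    (∃ ν, Val D ν τ) ∧ τ.length + 1 = ℓ := by
  rw [prim] at hb
  split_ifs at hb with H
  · obtain ⟨w, hw, hτ, hl, -⟩ := part_supp c hb
    exact ⟨⟨_, w, hw, hτ⟩, by rw [hτ, List.length_map, hl]⟩
  · exact (hb rfl).elim

omit [DecidableEq ι] [Fintype ι] in
theorem prim_add {ν : W} {τ : List V} (hτ : Val D ν τ) :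
    AddOn (core τ) fun h => prim D core R ℓ c h τ := by
  obtain ⟨μ, -, hμ⟩ := exists_least hτ
  simp only [prim_eq c hμ]
  exact part_add c hμ.1

omit [DecidableEq ι] [Fintype ι] in
theorem before_eq_prim {ν μ : W} (h : μ < ν) {τ : List V} (hτ : Val D μ τ) (x : Fin k → F) :
    before D core R ℓ c ν x τ = prim D core R ℓ c x τ := by
  obtain ⟨l, hl, hl'⟩ := exists_least hτ
  exact if_pos ⟨l, hl.trans_lt h, hl'⟩

omit [DecidableEq ι] [Fintype ι] in
theorem before_add {ν μ : W} {τ : List V} (hτ : Val D μ τ) :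
    AddOn (core τ) fun h => before D core R ℓ c ν h τ := by
  simp only [before]
  split_ifs
  · exact prim_add c hτ
  · exact AddOn.zero _ _

omit [Fintype ι] in
theorem prim_split (hs : RoseSys D core y e R) {ν : W} {τ : List V} (hτ : Val D ν τ) (h : Fin k → F) :
    prim D core R ℓ c h τ = before D core R ℓ c ν h τ + part D core R ℓ c ν h τ := by
  obtain ⟨μ, hμν, hμ⟩ := exists_least hτ
  rcases hμν.lt_or_eq with hlt | rfl
  · rw [before_eq_prim c hlt hμ.1]
    by_contra hne
    obtain ⟨w, hw, rfl, -, hR⟩ := part_supp c (fun h0 => hne (by rw [h0, add_zero]) :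
      part D core R ℓ c ν h τ ≠ 0)
    obtain ⟨i, hi, hi'⟩ := hs.shell μ ν hlt
    exact hi' w hw (hR i hi) hμ.1
  · rw [prim_eq c hμ, before, if_neg, zero_add]
    rintro ⟨l, hl, hl'⟩
    exact hl.ne (hl'.unique hμ)

theorem spec (hs : RoseSys D core y e R) (hk : ℓ + k < Fintype.card ι) (hc : IsCo D core ℓ c)
    (hcd : ∀ ν τ h, Val D ν τ → (∀ l, h l ∈ core τ) → dl τ (c h) = 0) (ν : W) :
    Spec D core R ℓ c ν (before D core R ℓ c ν) (part D core R ℓ c ν) := by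
  induction ν using (wellFounded_lt (α := W)).induction with
  | _ ν ih =>
  have hQ : ∀ μ < ν, ∀ τ h, Val D μ τ → (∀ l, h l ∈ core τ) →
      dl τ (prim D core R ℓ c h) = c h τ := fun μ hμ τ h hτ hh => by
    have h1 := (ih μ hμ).eq τ h hτ hh
    rw [eq_sub_iff_add_eq, add_comm, ← dl_add] at h1
    rw [← h1]
    exact dl_congr fun τ' hτ' _ => hs.prim_split c (hτ.sublist hτ') h
  have anti : ∀ w w' : List (ι × Bool), Nd w → w'.Sublist w → core (w.map (D ν)) ≤ core (w'.map (D ν)) :=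
    fun w w' hw hw' => by
      rw [hs.core_eq ν w hw, hs.core_eq ν w' (hw.sublist hw')]
      exact wcore_anti _ hw'
  suffices H : ∃ b, Spec D core R ℓ c ν (before D core R ℓ c ν) b by
    rw [part_eq, sol, dif_pos H]
    exact H.choose_spec
  obtain ⟨b, hb1, hb2, hb3⟩ := solve_rose (y ν) (e ν) (hs.e_mul ν) (hs.e_y ν) hk (R ν)
    (fun h w => c h (w.map (D ν)) - dl (w.map (D ν)) (before D core R ℓ c ν h))
    (fun w hw => by
      rw [← hs.core_eq ν w hw]
      refine (hc.add ν _ ⟨w, hw, rfl⟩).sub (AddOn.dl _ fun τ hτ => ?_)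
      obtain ⟨w', hw', rfl⟩ := List.sublist_map_iff.1 hτ
      exact (before_add c (⟨w', hw.sublist hw', rfl⟩ : Val D ν _)).mono (anti w w' hw hw'))
    (fun w h hw hh hr => by
      rw [← hs.core_eq ν w hw] at hh
      refine ⟨?_, fun a ha => ?_⟩
      · by_cases h0 : c h (w.map (D ν)) = 0
        · rw [h0, zero_sub, neg_ne_zero] at hr
          by_contra hl
          refine hr (dl_eq_zero fun τ _ hτ => ?_)
          by_contra hb
          rw [before] at hb
          split_ifs at hb with H
          · have := (prim_supp c hb).2
            rw [List.length_map] at hτ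
            omega
          · exact hb rfl
        · simpa using (hc.supp _ _ h0).2.1
      · by_contra haw
        obtain ⟨μ, hμ, hμ'⟩ := hs.mem_R ν a ha
        have hv := hμ' w hw haw
        refine hr ?_
        rw [sub_eq_zero, ← hQ μ hμ _ h hv hh]
        exact dl_congr fun τ hτ _ => (before_eq_prim c hμ (hv.sublist hτ) h).symm)
    (fun w h hw hh => by
      rw [← hs.core_eq ν w hw] at hh
      rw [dl_sub, ← dl_map (D ν) w (c h), hcd ν _ h ⟨w, hw, rfl⟩ hh,
        ← dl_map (D ν) w fun τ => dl τ (before D core R ℓ c ν h), dl_dl, sub_zero])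
  classical
  let b' : (Fin k → F) → List V → ℤ := fun h τ =>
    if H : ∃ w, Nd w ∧ τ = w.map (D ν) then b h H.choose else 0
  have hb' : ∀ h w, Nd w → b' h (w.map (D ν)) = b h w := fun h w hw => by
    have H : ∃ w', Nd w' ∧ w.map (D ν) = w'.map (D ν) := ⟨w, hw, rfl⟩
    simp only [b', dif_pos H]
    rw [← (List.map_injective_iff.2 (hs.inj ν)) H.choose_spec.2]
  refine ⟨b', fun h τ hne => ?_, fun τ hτ => ?_, fun τ h hτ hh => ?_⟩
  · by_cases H : ∃ w, Nd w ∧ τ = w.map (D ν)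
    · obtain ⟨w, hw, rfl⟩ := H
      rw [hb' h w hw] at hne
      exact ⟨w, hw, rfl, (hb1 w h hne).2⟩
    · exact (hne (dif_neg H)).elim
  · obtain ⟨w, hw, rfl⟩ := hτ
    simp only [hb' _ w hw]
    rw [hs.core_eq ν w hw]
    exact hb2 w
  · obtain ⟨w, hw, rfl⟩ := hτ
    rw [hs.core_eq ν w hw] at hh
    rw [← hb3 w h hw hh, dl_map]
    exact dl_congr fun τ hτ _ => hb' h τ (hw.sublist hτ)

theorem exact (hs : RoseSys D core y e R) (hk : ℓ + k < Fintype.card ι) (hc : IsCo D core ℓ c)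
    (hcd : ∀ ν τ h, Val D ν τ → (∀ l, h l ∈ core τ) → dl τ (c h) = 0) :
    ∃ b : (Fin k → F) → List V → ℤ,
      (∀ h τ, b h τ ≠ 0 → (∃ ν, Val D ν τ) ∧ τ.length + 1 = ℓ) ∧
      (∀ ν τ, Val D ν τ → AddOn (core τ) fun h => b h τ) ∧
      ∀ ν τ h, Val D ν τ → (∀ l, h l ∈ core τ) → dl τ (b h) = c h τ := by
  refine ⟨prim D core R ℓ c, fun h τ => prim_supp c, fun ν τ hτ => prim_add c hτ,
    fun ν τ h hτ hh => ?_⟩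
  have h1 := (hs.spec c hk hc hcd ν).eq τ h hτ hh
  rw [eq_sub_iff_add_eq, add_comm, ← dl_add] at h1
  rw [← h1]
  exact dl_congr fun τ' hτ' _ => hs.prim_split c (hτ.sublist hτ') h

end RoseSys
end

section
variable {ι : Type} [DecidableEq ι]

/-- The first letter of a reduced word. -/
def fl (g : FreeGroup ι) : Option (ι × Bool) := g.toWord.head?

/-- The group element of a letter. -/
def lt (t : ι × Bool) : FreeGroup ι := FreeGroup.mk [t]

/-- The inverse letter. -/
def opp (t : ι × Bool) : ι × Bool := (t.1, !t.2)

omit [DecidableEq ι] in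
@[simp] theorem opp_opp (t : ι × Bool) : opp (opp t) = t := by simp [opp]

omit [DecidableEq ι] in
theorem opp_ne (t : ι × Bool) : opp t ≠ t := fun h => by
  have := congrArg Prod.snd h
  simp [opp] at this

omit [DecidableEq ι] in
theorem lt_opp (t : ι × Bool) : lt (opp t) = (lt t)⁻¹ := by
  simp [lt, opp, FreeGroup.inv_mk, FreeGroup.invRev]

omit [DecidableEq ι] in
theorem lt_true (i : ι) : lt (i, true) = FreeGroup.of i := rfl

omit [DecidableEq ι] in
theorem lt_false (i : ι) : lt (i, false) = (FreeGroup.of i)⁻¹ := lt_opp (i, true)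

theorem toWord_mk_of {L : List (ι × Bool)} (h : FreeGroup.IsReduced L) :
    (FreeGroup.mk L).toWord = L := by rw [FreeGroup.toWord_mk, h.reduce_eq]

@[simp] theorem toWord_lt (t : ι × Bool) : (lt t).toWord = [t] :=
  toWord_mk_of FreeGroup.IsReduced.singleton

@[simp] theorem fl_lt (t : ι × Bool) : fl (lt t) = some t := by simp [fl]

@[simp] theorem fl_one : fl (1 : FreeGroup ι) = none := by simp [fl]

theorem fl_eq_none {g : FreeGroup ι} : fl g = none ↔ g = 1 := by
  simp [fl, FreeGroup.toWord_eq_nil_iff]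

omit [DecidableEq ι] in
theorem isReduced_cons {t : ι × Bool} {L : List (ι × Bool)} (h : FreeGroup.IsReduced L)
    (ht : L.head? ≠ some (opp t)) : FreeGroup.IsReduced (t :: L) := by
  cases L with
  | nil => exact FreeGroup.IsReduced.singleton
  | cons b L =>
    refine FreeGroup.isReduced_cons_cons.2 ⟨fun h1 => ?_, h⟩
    by_contra h2
    apply ht
    simp only [List.head?_cons, opp, Option.some.injEq]
    ext
    · exact h1.symm
    · change b.2 = !t.2
      cases h3 : b.2 <;> cases h4 : t.2 <;> simp_all

theorem toWord_lt_mul {t : ι × Bool} {g : FreeGroup ι} (h : fl g ≠ some (opp t)) :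
    (lt t * g).toWord = t :: g.toWord := by
  have : lt t * g = FreeGroup.mk (t :: g.toWord) := by
    conv_lhs => rw [← FreeGroup.mk_toWord (x := g)]
    rw [lt, FreeGroup.mul_mk]
    rfl
  rw [this, toWord_mk_of (isReduced_cons FreeGroup.isReduced_toWord h)]

theorem fl_lt_mul {t : ι × Bool} {g : FreeGroup ι} (h : fl g ≠ some (opp t)) :
    fl (lt t * g) = some t := by
  rw [fl, toWord_lt_mul h]; rfl

theorem exists_lt_mul {t : ι × Bool} {g : FreeGroup ι} (h : fl g = some t) :
    ∃ g', g = lt t * g' ∧ fl g' ≠ some (opp t) ∧ g.toWord = t :: g'.toWord := by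
  obtain ⟨r, hr⟩ : ∃ r, g.toWord = t :: r := by
    rw [fl] at h
    cases hw : g.toWord with
    | nil => simp [hw] at h
    | cons a r => rw [hw] at h; simp at h; exact ⟨r, by rw [h]⟩
  have hred : FreeGroup.IsReduced (t :: r) := hr ▸ FreeGroup.isReduced_toWord
  have hrr : FreeGroup.IsReduced r := List.IsChain.tail hred
  refine ⟨FreeGroup.mk r, ?_, ?_, ?_⟩
  · rw [← FreeGroup.mk_toWord (x := g), hr, lt, FreeGroup.mul_mk]; rfl
  · rw [fl, toWord_mk_of hrr]
    cases r with
    | nil => simp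
    | cons b r =>
      intro h1
      simp only [List.head?_cons, Option.some.injEq] at h1
      have := (FreeGroup.isReduced_cons_cons.1 hred).1
      rw [h1] at this
      simp [opp] at this
  · rw [hr, toWord_mk_of hrr]

theorem fl_opp_mul {t : ι × Bool} {g : FreeGroup ι} :
    fl (lt (opp t) * g) = some (opp t) ↔ fl g ≠ some t := by
  constructor
  · intro h h1
    obtain ⟨g', rfl, h2, -⟩ := exists_lt_mul h1
    rw [lt_opp, inv_mul_cancel_left] at h
    exact h2 h
  · intro h
    exact fl_lt_mul (by rwa [opp_opp])

theorem fl_mul_lt {s : ι × Bool} : ∀ (n : ℕ) (g : FreeGroup ι), g.norm = n → g ≠ 1 →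
    g ≠ lt (opp s) → fl (g * lt s) = fl g := by
  intro n
  induction n with
  | zero => exact fun g h h1 => (h1 (FreeGroup.norm_eq_zero.1 h)).elim
  | succ n ih =>
    intro g hg h1 h2
    obtain ⟨t, ht⟩ := Option.ne_none_iff_exists'.1 (fun h => h1 (fl_eq_none.1 h))
    obtain ⟨g', rfl, h3, h4⟩ := exists_lt_mul ht
    rw [ht, mul_assoc]
    apply fl_lt_mul
    by_cases h5 : g' = 1
    · subst h5
      rw [one_mul, fl_lt]
      intro h6
      rw [Option.some.injEq] at h6
      apply h2
      rw [h6, opp_opp, mul_one]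
    by_cases h6 : g' = lt (opp s)
    · rw [h6, lt_opp, inv_mul_cancel, fl_one]; simp
    · rw [ih g' _ h5 h6]
      · exact h3
      · have := congrArg List.length h4
        simp only [FreeGroup.norm, List.length_cons] at hg this ⊢
        omega

theorem fl_mul_lt' {s : ι × Bool} {g : FreeGroup ι} (h1 : g ≠ 1) (h2 : g ≠ lt (opp s)) :
    fl (g * lt s) = fl g := fl_mul_lt _ g rfl h1 h2

/-- A set without boundary inside a half-tree is constant on it. -/
theorem const_of_no_boundary {t : ι × Bool} {U : Set (FreeGroup ι)}
    (hU : ∀ g s, fl g = some t → fl (g * lt s) = some t → (g ∈ U ↔ g * lt s ∈ U)) :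
    ∀ (L : List (ι × Bool)) (g : FreeGroup ι), g.toWord = L → fl g = some t →
      (g ∈ U ↔ lt t ∈ U) := by
  intro L
  induction L using List.reverseRecOn with
  | nil => exact fun g hg h => by simp [fl, hg] at h
  | append_singleton L s ih =>
    intro g hg h
    have hred : FreeGroup.IsReduced (L ++ [s]) := hg ▸ FreeGroup.isReduced_toWord
    have hg' : g = FreeGroup.mk L * lt s := by
      rw [← FreeGroup.mk_toWord (x := g), hg, lt, FreeGroup.mul_mk]
    have hL := toWord_mk_of (List.IsChain.left_of_append hred)
    rcases eq_or_ne L [] with rfl | hne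
    · rw [fl, hg] at h
      simp at h
      subst h
      rw [hg']
      simp [← FreeGroup.one_eq_mk]
    · have h1 : fl (FreeGroup.mk L) = some t := by
        rw [fl, hL, ← h, fl, hg, List.head?_append_of_ne_nil _ hne]
      rw [hg'] at h
      rw [hg', ← hU _ _ h1 h]
      exact ih _ hL h1

theorem toWord_mul_lt {v : FreeGroup ι} {t : ι × Bool} (h : (v * lt t).norm = v.norm + 1) :
    (v * lt t).toWord = v.toWord ++ [t] := by
  have h1 := FreeGroup.toWord_mul_sublist v (lt t)
  rw [toWord_lt] at h1
  exact h1.eq_of_length (by simpa [FreeGroup.norm] using h)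

theorem norm_mul_of_fl {v g : FreeGroup ι} {t : ι × Bool} (h : (v * lt t).norm = v.norm + 1)
    (hg : fl g = some t) : v.norm + 1 ≤ (v * g).norm := by
  obtain ⟨g', -, -, h3⟩ := exists_lt_mul hg
  have h1 : FreeGroup.IsReduced (v.toWord ++ [t]) :=
    toWord_mul_lt h ▸ FreeGroup.isReduced_toWord
  have h2 : FreeGroup.IsReduced ([t] ++ g'.toWord) := by
    have : FreeGroup.IsReduced g.toWord := FreeGroup.isReduced_toWord
    rwa [h3] at this
  have h4 := h1.append_overlap h2 (by simp)
  have h5 : (v * g).toWord = v.toWord ++ [t] ++ g'.toWord := by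
    rw [FreeGroup.toWord_mul, h3]
    simpa using h4.reduce_eq
  simp only [FreeGroup.norm, h5, List.length_append, List.length_singleton]
  omega

theorem norm_mul_lt (v : FreeGroup ι) : (∀ t, (v * lt t).norm = v.norm + 1) ∨
    ∃ t₀, (v * lt t₀).norm + 1 = v.norm ∧ ∀ t ≠ t₀, (v * lt t).norm = v.norm + 1 := by
  rcases List.eq_nil_or_concat v.toWord with h | ⟨L, s, h⟩
  · left
    intro t
    rw [FreeGroup.toWord_eq_nil_iff] at h
    subst h
    rw [one_mul]
    simp [FreeGroup.norm]
  · right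
    rw [List.concat_eq_append] at h
    have h0 : FreeGroup.IsReduced (L ++ [s]) := h ▸ FreeGroup.isReduced_toWord
    have hv : v = FreeGroup.mk L * lt s := by
      rw [← FreeGroup.mk_toWord (x := v), h, lt, FreeGroup.mul_mk]
    refine ⟨opp s, ?_, fun t ht => ?_⟩
    · have h1 : v * lt (opp s) = FreeGroup.mk L := by rw [hv, lt_opp, mul_inv_cancel_right]
      simp [FreeGroup.norm, h1, h,
        toWord_mk_of (List.IsChain.left_of_append h0)]
    · have h2 : FreeGroup.IsReduced ([s] ++ [t]) :=
        isReduced_cons FreeGroup.IsReduced.singleton (by simpa using ht)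
      have h4 := h0.append_overlap h2 (by simp)
      have h5 : (v * lt t).toWord = L ++ [s] ++ [t] := by
        rw [FreeGroup.toWord_mul, h, toWord_lt, h4.reduce_eq]
      simp [FreeGroup.norm, h5, h]

theorem norm_mul_lt_or (v : FreeGroup ι) (t : ι × Bool) :
    (v * lt t).norm = v.norm + 1 ∨ (v * lt t).norm + 1 = v.norm := by
  rcases norm_mul_lt v with h | ⟨t₀, h, h'⟩
  · exact Or.inl (h t)
  · rcases eq_or_ne t t₀ with rfl | ht
    · exact Or.inr h
    · exact Or.inl (h' t ht)

end

section
variable {ι : Type} [DecidableEq ι]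

/-- Almost invariant subsets of a group. -/
def AI {F : Type} [Group F] (U : Set F) : Prop := ∀ w, {g | ¬(g ∈ U ↔ g * w ∈ U)}.Finite

open Classical in
/-- The integer valued indicator function. -/
def ind {F : Type} (U : Set F) (g : F) : ℤ := if g ∈ U then 1 else 0

/-- Translates. -/
def tr {F : Type} [Group F] (h : F) (U : Set F) : Set F := {g | h * g ∈ U}

/-- Images under automorphisms. -/
def im {F : Type} [Group F] (ψ : MulAut F) (U : Set F) : Set F := {g | ψ⁻¹ g ∈ U}

/-- The signed number of boundary edges. -/
def chi {F : Type} [Group F] (U : Set F) (w : F) : ℤ := ∑ᶠ g, (ind U (g * w) - ind U g)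

section
variable {F : Type} [Group F] {U V : Set F}

theorem AI.compl (h : AI U) : AI Uᶜ := fun w => (h w).subset fun g hg => by
  simp only [Set.mem_ofPred_eq, Set.mem_compl_iff] at hg ⊢; tauto

theorem AI.inter (h : AI U) (h' : AI V) : AI (U ∩ V) := fun w =>
  ((h w).union (h' w)).subset fun g hg => by
    simp only [Set.mem_ofPred_eq, Set.mem_inter_iff, Set.mem_union] at hg ⊢; tauto

theorem AI.union (h : AI U) (h' : AI V) : AI (U ∪ V) := fun w =>
  ((h w).union (h' w)).subset fun g hg => by
    simp only [Set.mem_ofPred_eq, Set.mem_union] at hg ⊢; tauto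

theorem AI.tr (h : AI U) (a : F) : AI (tr a U) := fun w => by
  refine ((h w).preimage (f := fun g => a * g) (mul_right_injective a).injOn).subset fun g hg => ?_
  simpa [GrpCoh.tr, mul_assoc] using hg

theorem AI.im (h : AI U) (ψ : MulAut F) : AI (im ψ U) := fun w => by
  refine ((h (ψ⁻¹ w)).preimage (f := ⇑ψ⁻¹) (MulEquiv.injective _).injOn).subset fun g hg => ?_
  simpa only [GrpCoh.im, Set.mem_ofPred_eq, map_mul, Set.mem_preimage] using hg

omit [Group F] in
theorem ind_congr {x y : F} (h : x ∈ U ↔ y ∈ V) : ind U x = ind V y := by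
  classical exact if_congr h rfl rfl

theorem AI.finite_support (h : AI U) (w : F) :
    (Function.support fun g => ind U (g * w) - ind U g).Finite := (h w).subset fun g hg => by
  simp only [Function.mem_support, Set.mem_ofPred_eq] at hg ⊢
  intro h1
  exact hg (sub_eq_zero.2 (ind_congr h1).symm)

theorem chi_mul (h : AI U) (a b : F) : chi U (a * b) = chi U a + chi U b := by
  have h1 : (fun g => ind U (g * (a * b)) - ind U g) = fun g =>
      (ind U (g * a) - ind U g) + (ind U (g * a * b) - ind U (g * a)) := by
    funext g; rw [mul_assoc]; ring
  have h2 : (Function.support fun g => ind U (g * a * b) - ind U (g * a)).Finite :=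
    (h.finite_support b).preimage (f := fun g => g * a) (mul_left_injective a).injOn
  rw [chi, h1, finsum_add_distrib (h.finite_support a) h2]
  congr 1
  exact finsum_comp_equiv (Equiv.mulRight a) (f := fun g => ind U (g * b) - ind U g)

theorem chi_union_inter (h : AI U) (h' : AI V) (w : F) :
    chi (U ∪ V) w + chi (U ∩ V) w = chi U w + chi V w := by
  rw [chi, chi, chi, chi, ← finsum_add_distrib ((h.union h').finite_support w)
    ((h.inter h').finite_support w), ← finsum_add_distrib (h.finite_support w) (h'.finite_support w)]
  refine finsum_congr fun g => ?_
  have : ∀ x, ind (U ∪ V) x + ind (U ∩ V) x = ind U x + ind V x := fun x => by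
    by_cases h1 : x ∈ U <;> by_cases h2 : x ∈ V <;> simp [ind, h1, h2]
  have h1 := this (g * w)
  have h2 := this g
  linarith

omit [Group F] in
theorem ind_compl (U : Set F) (x : F) : ind Uᶜ x = 1 - ind U x := by
  by_cases h : x ∈ U <;> simp [ind, h]

theorem chi_compl (U : Set F) (w : F) : chi Uᶜ w = - chi U w := by
  rw [chi, chi, ← finsum_neg_distrib]
  refine finsum_congr fun g => ?_
  rw [ind_compl, ind_compl]
  ring

theorem chi_im (ψ : MulAut F) (U : Set F) (w : F) : chi (im ψ U) w = chi U (ψ⁻¹ w) := by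
  rw [chi, chi]
  refine (finsum_congr fun g => ?_).trans (finsum_comp_equiv (ψ⁻¹ : MulAut F).toEquiv
    (f := fun g => ind U (g * ψ⁻¹ w) - ind U g))
  have : ∀ x, ind (im ψ U) x = ind U (ψ⁻¹ x) := fun x => rfl
  rw [this, this, map_mul]
  rfl

end

/-- The half-tree consisting of the words with a given first letter, as seen from a vertex. -/
def ht (h : FreeGroup ι) (t : ι × Bool) : Set (FreeGroup ι) := {g | fl (h⁻¹ * g) = some t}

theorem mem_ht {h g : FreeGroup ι} {t : ι × Bool} : g ∈ ht h t ↔ fl (h⁻¹ * g) = some t := Iff.rfl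

theorem ht_compl (h : FreeGroup ι) (t : ι × Bool) : (ht h t)ᶜ = ht (h * lt t) (opp t) := by
  ext g
  rw [mem_ht, Set.mem_compl_iff, mem_ht, mul_inv_rev, mul_assoc, ← lt_opp, fl_opp_mul]

theorem ht_tr (a h : FreeGroup ι) (t : ι × Bool) : tr a (ht h t) = ht (a⁻¹ * h) t := by
  ext g
  simp [tr, mem_ht, mul_assoc]

/-- Sets which are unions of directions at a vertex. -/
def Star (v : FreeGroup ι) (Z : Set (FreeGroup ι)) : Prop :=
  ∀ t g, fl g = some t → (v * g ∈ Z ↔ v * lt t ∈ Z)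

theorem Star.ht (v : FreeGroup ι) (t : ι × Bool) : Star v (ht v t) := fun s g hg => by
  simp [mem_ht, hg]

theorem Star.compl {v : FreeGroup ι} {Z : Set (FreeGroup ι)} (h : Star v Z) : Star v Zᶜ :=
  fun s g hg => not_congr (h s g hg)

/-- The only boundary edges of a star cut are those at the vertex. -/
theorem Star.boundary {v : FreeGroup ι} {Z : Set (FreeGroup ι)} (h : Star v Z) {g : FreeGroup ι}
    {s : ι × Bool} (h1 : g ≠ v) (h2 : g ≠ v * lt (opp s)) : g ∈ Z ↔ g * lt s ∈ Z := by
  obtain ⟨g, rfl⟩ : ∃ g', g = v * g' := ⟨v⁻¹ * g, by simp⟩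
  have h1' : g ≠ 1 := fun h => h1 (by rw [h, mul_one])
  have h2' : g ≠ lt (opp s) := fun h => h2 (by rw [h])
  obtain ⟨t, ht⟩ := Option.ne_none_iff_exists'.1 (fun h => h1' (fl_eq_none.1 h))
  rw [mul_assoc, h t g ht, h t (g * lt s) (by rw [fl_mul_lt' h1' h2', ht])]

theorem Star.ind_sub {v : FreeGroup ι} {Z : Set (FreeGroup ι)} (h : Star v Z) (s : ι × Bool)
    (g : FreeGroup ι) : ind Z (g * lt s) - ind Z g =
      if g = v then ind Z (v * lt s) - ind Z v else
        if g = v * lt (opp s) then ind Z v - ind Z (v * lt (opp s)) else 0 := by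
  split_ifs with h1 h2
  · rw [h1]
  · rw [h2, lt_opp, inv_mul_cancel_right]
  · exact sub_eq_zero.2 (ind_congr (h.boundary h1 h2)).symm

theorem Star.chi {v : FreeGroup ι} {Z : Set (FreeGroup ι)} (h : Star v Z) (s : ι × Bool) :
    chi Z (lt s) = ind Z (v * lt s) - ind Z (v * lt (opp s)) := by
  have hne : v ≠ v * lt (opp s) := fun h1 => by
    have h2 : fl (lt (opp s)) = none := fl_eq_none.2 (by simpa using h1)
    simp at h2
  rw [GrpCoh.chi, finsum_congr (h.ind_sub s),
    finsum_eq_sum_of_support_subset (s := {v, v * lt (opp s)})]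
  · rw [Finset.sum_pair hne, if_pos rfl, if_neg hne.symm, if_pos rfl]
    ring
  · intro g hg
    simp only [Function.mem_support, ne_eq] at hg
    by_contra h1
    simp only [Finset.coe_insert, Finset.coe_singleton, Set.mem_insert_iff,
      Set.mem_singleton_iff, not_or] at h1
    exact hg (by rw [if_neg h1.1, if_neg h1.2])

theorem ht_ai (h : FreeGroup ι) (t : ι × Bool) : AI (ht h t) := by
  intro w
  induction w using FreeGroup.induction_on with
  | C1 => simp
  | of i =>
    refine (Set.toFinite {h, h * lt (opp (i, true))}).subset fun g hg => ?_
    by_contra h1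
    simp only [Set.mem_insert_iff, Set.mem_singleton_iff, not_or] at h1
    exact hg ((Star.ht h t).boundary h1.1 h1.2)
  | inv_of i _ =>
    refine (Set.toFinite {h, h * lt (opp (i, false))}).subset fun g hg => ?_
    by_contra h1
    simp only [Set.mem_insert_iff, Set.mem_singleton_iff, not_or] at h1
    rw [← lt_false] at hg
    exact hg ((Star.ht h t).boundary h1.1 h1.2)
  | mul a b ha hb =>
    refine (ha.union (hb.preimage (f := fun g => g * a) (mul_left_injective a).injOn)).subset
      fun g hg => ?_
    simp only [Set.mem_ofPred_eq, Set.mem_union, Set.mem_preimage, mul_assoc] at hg ⊢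
    tauto

/-- A set without boundary inside a half-tree is constant on it. -/
theorem const_ht {h : FreeGroup ι} {t : ι × Bool} {U : Set (FreeGroup ι)}
    (hU : ∀ g s, g ∈ ht h t → g * lt s ∈ ht h t → (g ∈ U ↔ g * lt s ∈ U)) :
    ∀ g ∈ ht h t, (g ∈ U ↔ h * lt t ∈ U) := by
  intro g hg
  have := const_of_no_boundary (U := tr h U) (t := t) (fun g s h1 h2 => by
    have := hU (h * g) s (by rwa [mem_ht, inv_mul_cancel_left])
      (by rwa [mem_ht, mul_assoc, inv_mul_cancel_left])
    rwa [mul_assoc] at this) _ _ rfl hg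
  simpa [tr] using this

/-- Nested sets. -/
def Nest {F : Type} (A B : Set F) : Prop :=
  (∀ g, ¬(g ∈ A ∧ g ∈ B)) ∨ (∀ g, ¬(g ∈ A ∧ g ∉ B)) ∨ (∀ g, ¬(g ∉ A ∧ g ∈ B)) ∨
    ∀ g, ¬(g ∉ A ∧ g ∉ B)

theorem Nest.symm {F : Type} {A B : Set F} (h : Nest A B) : Nest B A := by
  unfold Nest at *
  simp only [and_comm] at *
  tauto

theorem Nest.compl {F : Type} {A B : Set F} (h : Nest A B) : Nest A Bᶜ := by
  unfold Nest at *
  simp only [Set.mem_compl_iff, not_not] at *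
  tauto

theorem nest_of_const {F : Type} {A B : Set F} {p : Prop} (h : ∀ g ∈ B, (g ∈ A ↔ p)) :
    Nest A B := by
  by_cases hp : p
  · exact Or.inr (Or.inr (Or.inl fun g hg => hg.1 ((h g hg.2).2 hp)))
  · exact Or.inl fun g hg => hp ((h g hg.2).1 hg.1)

theorem Nest.tr {F : Type} [Group F] {A B : Set F} (h : Nest A B) (a : F) :
    Nest (tr a A) (tr a B) := by
  rcases h with h | h | h | h
  · exact Or.inl fun g hg => h _ hg
  · exact Or.inr (Or.inl fun g hg => h _ hg)
  · exact Or.inr (Or.inr (Or.inl fun g hg => h _ hg))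
  · exact Or.inr (Or.inr (Or.inr fun g hg => h _ hg))

theorem Nest.im {F : Type} [Group F] {A B : Set F} (h : Nest A B) (ψ : MulAut F) :
    Nest (im ψ A) (im ψ B) := by
  rcases h with h | h | h | h
  · exact Or.inl fun g hg => h _ hg
  · exact Or.inr (Or.inl fun g hg => h _ hg)
  · exact Or.inr (Or.inr (Or.inl fun g hg => h _ hg))
  · exact Or.inr (Or.inr (Or.inr fun g hg => h _ hg))

/-- Half-trees are nested. -/
theorem nest_ht (h k : FreeGroup ι) (t s : ι × Bool) : Nest (ht h t) (ht k s) := by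
  -- the half-tree `ht h t` has a single boundary edge
  have key : ∀ k' s', (¬(h ∈ ht k' s' ∧ h * lt t ∈ ht k' s')) → Nest (ht h t) (ht k' s') := by
    intro k' s' hh
    refine nest_of_const (const_ht fun g r h1 h2 => ?_)
    by_contra h3
    have h4 : ¬ (g ≠ h ∧ g ≠ h * lt (opp r)) := fun h5 =>
      h3 ((Star.ht h t).boundary h5.1 h5.2)
    rw [not_and_or, not_not, not_not] at h4
    rcases h4 with rfl | rfl
    · have : r = t := by
        simpa [mem_ht] using h3
      subst this
      exact hh ⟨h1, h2⟩
    · rw [lt_opp, inv_mul_cancel_right] at h2 h3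
      have : opp r = t := by
        simpa [mem_ht, ← lt_opp] using h3
      subst this
      exact hh ⟨h2, h1⟩
  by_cases hh : h ∈ ht k s ∧ h * lt t ∈ ht k s
  · have h1 := key (k * lt s) (opp s) (by
      rw [← ht_compl]
      exact fun h2 => h2.1 hh.1)
    rw [← ht_compl] at h1
    simpa using h1.compl
  · exact key k s hh

theorem Nest.union {F : Type} {W A B : Set F} (hA : Nest W A) (hB : Nest W B)
    (hAB : ∃ g, g ∈ A ∧ g ∈ B) : Nest W (A ∪ B) := by
  obtain ⟨a, ha⟩ := hAB
  rcases hA with hA | hA | hA | hA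
  · rcases hB with hB | hB | hB | hB
    · exact Or.inl fun g hg => hg.2.elim (fun h => hA g ⟨hg.1, h⟩) fun h => hB g ⟨hg.1, h⟩
    · exact Or.inr (Or.inl fun g hg => hB g ⟨hg.1, fun h => hg.2 (Or.inr h)⟩)
    · exact (hB a ⟨fun h => hA a ⟨h, ha.1⟩, ha.2⟩).elim
    · exact Or.inr (Or.inr (Or.inr fun g hg => hB g ⟨hg.1, fun h => hg.2 (Or.inr h)⟩))
  · exact Or.inr (Or.inl fun g hg => hA g ⟨hg.1, fun h => hg.2 (Or.inl h)⟩)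
  · rcases hB with hB | hB | hB | hB
    · exact (hA a ⟨fun h => hB a ⟨h, ha.2⟩, ha.1⟩).elim
    · exact Or.inr (Or.inl fun g hg => hB g ⟨hg.1, fun h => hg.2 (Or.inr h)⟩)
    · exact Or.inr (Or.inr (Or.inl fun g hg =>
        hg.2.elim (fun h => hA g ⟨hg.1, h⟩) fun h => hB g ⟨hg.1, h⟩))
    · exact Or.inr (Or.inr (Or.inr fun g hg => hB g ⟨hg.1, fun h => hg.2 (Or.inr h)⟩))
  · exact Or.inr (Or.inr (Or.inr fun g hg => hA g ⟨hg.1, fun h => hg.2 (Or.inl h)⟩))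

/-- Corners of crossing sets. -/
theorem Nest.corner {F : Type} {W A B : Set F} (hA : Nest W A) (hB : Nest W B)
    (hAB : ¬ Nest A B) : Nest W (A ∪ B) ∧ Nest W (A ∩ Bᶜ) := by
  simp only [Nest, not_or, not_forall, not_not] at hAB
  obtain ⟨ha, hb, hc, hd⟩ := hAB
  refine ⟨hA.union hB ha, ?_⟩
  have := (hA.compl.union hB hc).compl
  rwa [Set.compl_union, compl_compl] at this

end

section
variable {ι Λ : Type} [DecidableEq ι] [AddCommMonoid Λ] [LinearOrder Λ] [IsOrderedCancelAddMonoid Λ]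

/-- Sizes of almost invariant sets. -/
structure Size (sz : Set (FreeGroup ι) → Λ) : Prop where
  tr : ∀ h U, sz (tr h U) = sz U
  compl : ∀ U, sz Uᶜ = sz U
  submod : ∀ U V, AI U → AI V → sz (U ∪ V) + sz (U ∩ V) ≤ sz U + sz V

omit [DecidableEq ι] in
theorem chi_lt_opp {U : Set (FreeGroup ι)} (h : AI U) (t : ι × Bool) :
    chi U (lt (opp t)) = - chi U (lt t) := by
  have h1 := chi_mul h 1 1
  have h2 := chi_mul h (lt (opp t)) (lt t)
  rw [lt_opp, inv_mul_cancel] at h2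
  rw [mul_one] at h1
  rw [lt_opp]
  linarith

theorem chi_empty {F : Type} [Group F] (w : F) : chi (∅ : Set F) w = 0 := by
  simp [chi, ind]

theorem chi_inter_compl {F : Type} [Group F] {U V : Set F} (hU : AI U) (hV : AI V) (w : F) :
    chi (U ∩ V) w + chi (Uᶜ ∩ V) w = chi V w := by
  have h := chi_union_inter (hU.inter hV) (hU.compl.inter hV) w
  have h1 : U ∩ V ∪ Uᶜ ∩ V = V := by rw [← Set.union_inter_distrib_right]; simp
  have h2 : U ∩ V ∩ (Uᶜ ∩ V) = ∅ := by
    ext x; simp only [Set.mem_inter_iff, Set.mem_compl_iff, Set.mem_empty_iff_false]; tauto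
  rw [h1, h2, chi_empty] at h
  linarith

omit [IsOrderedCancelAddMonoid Λ] in
theorem Size.ht {sz : Set (FreeGroup ι) → Λ} (hs : Size sz) (h : FreeGroup ι) (t : ι × Bool) :
    sz (ht h t) = sz (GrpCoh.ht 1 (t.1, true)) := by
  have key : ∀ h', sz (GrpCoh.ht h' (t.1, true)) = sz (GrpCoh.ht 1 (t.1, true)) := fun h' => by
    rw [← hs.tr h'⁻¹ (GrpCoh.ht 1 _), ht_tr, inv_inv, mul_one]
  obtain ⟨i, b⟩ := t
  cases b
  · rw [← hs.compl, ht_compl]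
    exact key _
  · exact key _

/-- The half-trees crossing a set. -/
def crossing (U : Set (FreeGroup ι)) : Set (FreeGroup ι × (ι × Bool)) :=
  {x | ¬ Nest (ht x.1 x.2) U}

/-- The vertices of the boundary edges. -/
def bdry (U : Set (FreeGroup ι)) : Set (FreeGroup ι) := {g | ∃ s, ¬(g ∈ U ↔ g * lt s ∈ U)}

omit [DecidableEq ι] in
theorem AI.bdry_finite [Finite ι] {U : Set (FreeGroup ι)} (h : AI U) : (bdry U).Finite := by
  refine (Set.finite_iUnion fun s : ι × Bool => h (lt s)).subset fun g hg => ?_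
  obtain ⟨s, hs⟩ := hg
  exact Set.mem_iUnion.2 ⟨s, hs⟩

theorem exists_bdry {U : Set (FreeGroup ι)} {x : FreeGroup ι × (ι × Bool)} (h : ¬ Nest (ht x.1 x.2) U) :
    ∃ g ∈ bdry U, g ∈ ht x.1 x.2 := by
  by_contra hg
  push Not at hg
  refine h (nest_of_const (const_ht (h := x.1) (t := x.2) fun g s h1 h2 => ?_)).symm
  by_contra h3
  exact hg g ⟨s, h3⟩ h1

theorem AI.crossing_finite [Finite ι] {U : Set (FreeGroup ι)} (h : AI U) : (crossing U).Finite := by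
  have hb := h.bdry_finite
  have hf : (⋃ t : ι × Bool, ⋃ g ∈ bdry U, ⋃ g' ∈ bdry U, (fun h => (h, t)) ''
      {h : FreeGroup ι | g ∈ ht h t ∧ g' ∉ ht h t}).Finite := by
    refine Set.finite_iUnion fun t => hb.biUnion fun g _ => hb.biUnion fun g' _ => Set.Finite.image _ ?_
    refine ((ht_ai 1 t (g⁻¹ * g')).preimage (f := fun h => h⁻¹ * g)
      (fun a _ b _ hab => by simpa using hab)).subset fun h hh => ?_
    simp only [mem_ht, Set.mem_ofPred_eq, Set.mem_preimage, inv_one, one_mul] at hh ⊢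
    rw [mul_assoc, mul_inv_cancel_left]
    tauto
  refine hf.subset fun x hx => ?_
  obtain ⟨g, hg, hg'⟩ := exists_bdry hx
  have hx' : ¬ Nest (ht (x.1 * lt x.2) (opp x.2)) U := fun h1 => hx (by
    rw [← ht_compl] at h1
    simpa using h1.symm.compl.symm)
  obtain ⟨k, hk, hk'⟩ := exists_bdry (x := (x.1 * lt x.2, opp x.2)) hx'
  rw [← ht_compl] at hk'
  simp only [Set.mem_iUnion]
  exact ⟨x.2, g, hg, k, hk, x.1, ⟨hg', hk'⟩, rfl⟩

theorem Size.step {sz : Set (FreeGroup ι) → Λ} (hs : Size sz) {T : Set ι}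
    (hLM : ∀ t : ι × Bool, t.1 ∉ T → ∀ v Z, AI Z → Star v Z → chi Z (lt t) ≠ 0 →
      sz (GrpCoh.ht 1 (t.1, true)) ≤ sz Z)
    {U : Set (FreeGroup ι)} (hU : AI U)
    (IH : ∀ U', AI U' → crossing U' ⊂ crossing U → (∀ h t, t.1 ∈ T → Nest (GrpCoh.ht h t) U') →
      ∀ t : ι × Bool, t.1 ∉ T → chi U' (lt t) ≠ 0 → sz (GrpCoh.ht 1 (t.1, true)) ≤ sz U')
    (hT : ∀ h t, t.1 ∈ T → Nest (GrpCoh.ht h t) U)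
    {v : FreeGroup ι} {t₀ : ι × Bool}
    (hstar : ∀ s ≠ t₀, ∀ g, fl g = some s → (v * g ∈ U ↔ v * lt s ∈ U))
    (hcr : ¬ Nest (GrpCoh.ht v t₀) U) (hin : v * lt (opp t₀) ∈ U) {t : ι × Bool} (ht : t.1 ∉ T)
    (hchi : chi U (lt t) ≠ 0) : sz (GrpCoh.ht 1 (t.1, true)) ≤ sz U := by
  set V := (GrpCoh.ht v t₀)ᶜ with hVdef
  have hVc : GrpCoh.ht v t₀ = Vᶜ := by rw [hVdef, compl_compl]
  have hV : AI V := (ht_ai _ _).compl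
  have hj : t₀.1 ∉ T := fun h => hcr (hT v t₀ h)
  have hcr' : ¬ Nest U V := fun h => hcr (by rw [hVc]; exact h.compl.symm)
  have hcorner : ∀ h s, Nest (GrpCoh.ht h s) U → Nest (GrpCoh.ht h s) (U ∪ V) ∧
      Nest (GrpCoh.ht h s) (U ∩ Vᶜ) := fun h s h1 => h1.corner (nest_ht _ _ _ _).compl hcr'
  have hmemV : ∀ s g, fl g = some s → (v * g ∈ V ↔ s ≠ t₀) := fun s g hg => by
    rw [hVdef, Set.mem_compl_iff, mem_ht, inv_mul_cancel_left, hg]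
    simp
  have starV : Star v V := (Star.ht v t₀).compl
  have starP : Star v (U ∩ V) := fun s g hg => by
    rw [Set.mem_inter_iff, Set.mem_inter_iff, hmemV s g hg, hmemV s _ (fl_lt s)]
    exact and_congr_left fun h => hstar s h g hg
  have starQ : Star v (Uᶜ ∩ V) := fun s g hg => by
    rw [Set.mem_inter_iff, Set.mem_inter_iff, hmemV s g hg, hmemV s _ (fl_lt s)]
    exact and_congr_left fun h => not_congr (hstar s h g hg)
  have hP0 : chi (U ∩ V) (lt t₀) = -1 := by
    rw [starP.chi]
    have h1 : v * lt t₀ ∉ U ∩ V := fun h => (hmemV _ _ (fl_lt t₀)).1 h.2 rfl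
    have h2 : v * lt (opp t₀) ∈ U ∩ V := ⟨hin, (hmemV _ _ (fl_lt _)).2 (opp_ne _)⟩
    simp [ind, h1, h2]
  have hV0 : chi V (lt t₀) = -1 := by
    rw [starV.chi]
    have h1 : v * lt t₀ ∉ V := fun h => (hmemV _ _ (fl_lt t₀)).1 h rfl
    have h2 : v * lt (opp t₀) ∈ V := (hmemV _ _ (fl_lt _)).2 (opp_ne _)
    simp [ind, h1, h2]
  have hszV : sz V = sz (GrpCoh.ht 1 (t₀.1, true)) := by rw [hVdef, hs.compl, hs.ht]
  have hPV : sz V ≤ sz (U ∩ V) := by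
    rw [hszV]
    exact hLM t₀ hj v _ (hU.inter hV) starP (by rw [hP0]; decide)
  have hsub := hs.submod U V hU hV
  have hunion := fun w => chi_union_inter hU hV w
  have strict : ∀ U', (∀ h s, Nest (GrpCoh.ht h s) U → Nest (GrpCoh.ht h s) U') →
      Nest (GrpCoh.ht v t₀) U' → crossing U' ⊂ crossing U := fun U' h1 h2 =>
    ⟨fun x hx h3 => hx (h1 _ _ h3), fun h3 => h3 (show (v, t₀) ∈ crossing U from hcr) h2⟩
  have IH1 : ∀ s : ι × Bool, s.1 ∉ T → chi (U ∪ V) (lt s) ≠ 0 →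
      sz (GrpCoh.ht 1 (s.1, true)) ≤ sz (U ∪ V) :=
    IH _ (hU.union hV) (strict _ (fun h s h1 => (hcorner h s h1).1) (by
      rw [hVc]
      refine Or.inr (Or.inr (Or.inr fun g hg => ?_))
      simp only [Set.mem_compl_iff, Set.mem_union] at hg
      tauto)) fun h s h1 => (hcorner h s (hT h s h1)).1
  have IH2 : ∀ s : ι × Bool, s.1 ∉ T → chi (U ∩ Vᶜ) (lt s) ≠ 0 →
      sz (GrpCoh.ht 1 (s.1, true)) ≤ sz (U ∩ Vᶜ) :=
    IH _ (hU.inter hV.compl) (strict _ (fun h s h1 => (hcorner h s h1).2) (by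
      rw [hVc]
      refine Or.inr (Or.inr (Or.inl fun g hg => ?_))
      simp only [Set.mem_compl_iff, Set.mem_inter_iff] at hg
      tauto)) fun h s h1 => (hcorner h s (hT h s h1)).2
  by_cases h0 : chi (U ∪ V) (lt t) = 0
  swap
  · have h1 := IH1 t ht h0
    have h2 : sz (U ∪ V) + sz V ≤ sz U + sz V := le_trans (by gcongr) hsub
    exact h1.trans (le_of_add_le_add_right h2)
  by_cases htj : t.1 = t₀.1
  · exfalso
    have hPVt : chi (U ∩ V) (lt t) = chi V (lt t) := by
      by_cases h1 : t = t₀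
      · rw [h1, hP0, hV0]
      · have h2 : t = opp t₀ := by
          ext
          · exact htj
          · change t.2 = !t₀.2
            have h3 : t.2 ≠ t₀.2 := fun h => h1 (Prod.ext htj h)
            exact Bool.eq_not.2 h3
        rw [h2, chi_lt_opp (hU.inter hV), chi_lt_opp hV, hP0, hV0]
    have := hunion (lt t)
    exact hchi (by linarith)
  · have hVt : chi V (lt t) = 0 := by
      rw [starV.chi]
      have h1 : v * lt t ∈ V := (hmemV _ _ (fl_lt _)).2 fun h => htj (by rw [h])
      have h2 : v * lt (opp t) ∈ V := (hmemV _ _ (fl_lt _)).2 fun h => htj (by rw [← h]; rfl)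
      simp [ind, h1, h2]
    have hPt : chi (U ∩ V) (lt t) ≠ 0 := by
      have := hunion (lt t)
      intro h
      exact hchi (by linarith)
    have hQt : chi (Uᶜ ∩ V) (lt t) ≠ 0 := by
      have := chi_inter_compl hU hV (lt t)
      intro h
      exact hPt (by linarith)
    have hP := hLM t ht v _ (hU.inter hV) starP hPt
    have hQ := hLM t ht v _ (hU.compl.inter hV) starQ hQt
    by_cases h1 : chi (U ∪ V) (lt t₀) = 0
    · have h2 : chi (U ∩ Vᶜ) (lt t₀) ≠ 0 := by
        have e1 := hunion (lt t₀)
        have e2 := chi_inter_compl hV hU (lt t₀)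
        rw [Set.inter_comm V, Set.inter_comm Vᶜ] at e2
        intro h
        linarith
      have h3 := IH2 t₀ hj h2
      rw [← hszV] at h3
      have h4 := hs.submod U Vᶜ hU hV.compl
      have h5 : (U ∪ Vᶜ) = (Uᶜ ∩ V)ᶜ := by rw [Set.compl_inter, compl_compl U]
      rw [h5, hs.compl, hs.compl V] at h4
      have h6 : sz (Uᶜ ∩ V) + sz V ≤ sz U + sz V := le_trans (by gcongr) h4
      exact hQ.trans (le_of_add_le_add_right h6)
    · have h3 := IH1 t₀ hj h1
      rw [← hszV] at h3
      have h6 : sz V + sz (U ∩ V) ≤ sz V + sz U := by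
        rw [add_comm (sz V) (sz U)]
        exact le_trans (by gcongr) hsub
      exact hP.trans (le_of_add_le_add_left h6)

theorem Size.key [Finite ι] {sz : Set (FreeGroup ι) → Λ} (hs : Size sz) {T : Set ι}
    (hLM : ∀ t : ι × Bool, t.1 ∉ T → ∀ v Z, AI Z → Star v Z → chi Z (lt t) ≠ 0 →
      sz (GrpCoh.ht 1 (t.1, true)) ≤ sz Z) :
    ∀ n U, AI U → (crossing U).ncard = n → (∀ h t, t.1 ∈ T → Nest (GrpCoh.ht h t) U) →
      ∀ t : ι × Bool, t.1 ∉ T → chi U (lt t) ≠ 0 → sz (GrpCoh.ht 1 (t.1, true)) ≤ sz U := by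
  intro n
  induction n using Nat.strong_induction_on with
  | _ n ih =>
  intro U hU hn hT t ht hchi
  have IH : ∀ U', AI U' → crossing U' ⊂ crossing U →
      (∀ h t, t.1 ∈ T → Nest (GrpCoh.ht h t) U') →
      ∀ t : ι × Bool, t.1 ∉ T → chi U' (lt t) ≠ 0 → sz (GrpCoh.ht 1 (t.1, true)) ≤ sz U' :=
    fun U' hU' hlt => ih _ (hn ▸ Set.ncard_lt_ncard hlt hU.crossing_finite) U' hU' rfl
  let E : Set (FreeGroup ι) :=
    {v | ∃ s, (v * lt s).norm = v.norm + 1 ∧ ¬(v ∈ U ↔ v * lt s ∈ U)}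
  have hE : ∀ g s, ¬(g ∈ U ↔ g * lt s ∈ U) → g ∈ E ∨ g * lt s ∈ E := fun g s hg => by
    rcases norm_mul_lt_or g s with h | h
    · exact Or.inl ⟨s, h, hg⟩
    · refine Or.inr ⟨opp s, ?_, ?_⟩
      · rw [lt_opp, mul_inv_cancel_right, h]
      · rw [lt_opp, mul_inv_cancel_right]
        tauto
  have hEne : E.Nonempty := by
    by_contra h
    refine hchi ?_
    rw [chi, ← finsum_zero (α := FreeGroup ι)]
    refine finsum_congr fun g => sub_eq_zero.2 (ind_congr ?_).symm
    by_contra h1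
    rcases hE _ _ h1 with h2 | h2
    · exact h ⟨_, h2⟩
    · exact h ⟨_, h2⟩
  obtain ⟨v, ⟨t₁, hv1, hv2⟩, hmax⟩ := Set.exists_max_image E FreeGroup.norm
    (hU.bdry_finite.subset fun v hv => ⟨hv.choose, hv.choose_spec.2⟩) hEne
  have hchild : ∀ s, (v * lt s).norm = v.norm + 1 → ∀ g ∈ GrpCoh.ht v s,
      (g ∈ U ↔ v * lt s ∈ U) := by
    intro s hs
    refine const_ht fun g r h1 h2 => ?_
    by_contra h3
    have hbig : ∀ x ∈ GrpCoh.ht v s, v.norm + 1 ≤ x.norm := fun x hx => by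
      have := norm_mul_of_fl hs hx
      rwa [mul_inv_cancel_left] at this
    rcases hE _ _ h3 with h4 | h4
    · have := hmax _ h4
      have := hbig _ h1
      omega
    · have := hmax _ h4
      have := hbig _ h2
      omega
  have hchild' : ∀ s, (v * lt s).norm = v.norm + 1 → ∀ g, fl g = some s →
      (v * g ∈ U ↔ v * lt s ∈ U) := fun s hs g hg =>
    hchild s hs _ (by rwa [mem_ht, inv_mul_cancel_left])
  rcases norm_mul_lt v with h | ⟨t₀, h0, h⟩
  · exact hLM t ht v U hU (fun s g hg => hchild' s (h s) g hg) hchi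
  by_cases hc : ∀ g ∈ GrpCoh.ht v t₀, (g ∈ U ↔ v * lt t₀ ∈ U)
  · refine hLM t ht v U hU (fun s g hg => ?_) hchi
    rcases eq_or_ne s t₀ with rfl | hs0
    · exact hc _ (by rwa [mem_ht, inv_mul_cancel_left])
    · exact hchild' s (h s hs0) g hg
  have ht1 : t₁ ≠ t₀ := by rintro rfl; omega
  have hcr : ¬ Nest (GrpCoh.ht v t₀) U := by
    have hx : ∃ x, x ∉ GrpCoh.ht v t₀ ∧ x ∈ U := by
      by_cases h1 : v ∈ U
      · exact ⟨v, by simp [mem_ht], h1⟩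
      · exact ⟨v * lt t₁, by simpa [mem_ht] using ht1, by tauto⟩
    have hx' : ∃ x, x ∉ GrpCoh.ht v t₀ ∧ x ∉ U := by
      by_cases h1 : v ∈ U
      · exact ⟨v * lt t₁, by simpa [mem_ht] using ht1, by tauto⟩
      · exact ⟨v, by simp [mem_ht], h1⟩
    have hm : v * lt t₀ ∈ GrpCoh.ht v t₀ := by simp [mem_ht]
    push Not at hc
    obtain ⟨g, hg, hg'⟩ := hc
    obtain ⟨x, hx⟩ := hx
    obtain ⟨x', hx'⟩ := hx'
    rintro (h1 | h1 | h1 | h1)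
    · have := h1 g; have := h1 (v * lt t₀); tauto
    · have := h1 g; have := h1 (v * lt t₀); tauto
    · exact h1 _ hx
    · exact h1 _ hx'
  by_cases hin : v * lt (opp t₀) ∈ U
  · exact hs.step hLM hU IH hT (fun s hs0 => hchild' s (h s hs0)) hcr hin ht hchi
  · have hcross : crossing Uᶜ = crossing U := by
      ext x
      exact not_congr ⟨fun h1 => by simpa using h1.compl, fun h1 => h1.compl⟩
    rw [← hs.compl U]
    refine hs.step hLM hU.compl (by rwa [hcross]) (fun h t h1 => (hT h t h1).compl)
      (fun s hs0 g hg => not_congr (hchild' s (h s hs0) g hg)) (fun h1 => hcr ?_) hin ht ?_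
    · simpa using h1.compl
    · rwa [chi_compl, neg_ne_zero]

end

section
variable {ι : Type} [DecidableEq ι]

/-- The half-tree of a generator. -/
abbrev ball (i : ι) : Set (FreeGroup ι) := ht 1 (i, true)

theorem mem_ball {i : ι} {g : FreeGroup ι} : g ∈ ball i ↔ fl g = some (i, true) := by
  rw [mem_ht, inv_one, one_mul]

theorem ball_deriv (i l : ι) (g : FreeGroup ι) :
    ind (ball i) (g * FreeGroup.of l) - ind (ball i) g = if l = i ∧ g = 1 then 1 else 0 := by
  have h := (Star.ht 1 (i, true)).ind_sub (l, true) g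
  rw [lt_true] at h
  rw [h]
  have h1 : (1 : FreeGroup ι) ∉ ball i := by simp [mem_ball]
  have h2 : (1 : FreeGroup ι) * lt (opp (l, true)) ∉ ball i := by
    rw [mem_ball, one_mul, fl_lt]
    simp [opp]
  have h3 : (1 : FreeGroup ι) * FreeGroup.of l ∈ ball i ↔ l = i := by
    rw [mem_ball, one_mul, ← lt_true, fl_lt]
    simp
  by_cases hg : g = 1
  · rw [one_mul] at h3
    rw [if_pos hg, one_mul]
    change ind (ball i) _ - ind (ball i) _ = _
    simp only [ind, h1, h3, hg, and_true]
    simp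
  · rw [if_neg hg]
    change (if _ then ind (ball i) _ - ind (ball i) _ else _) = _
    simp only [ind, h1, h2, hg, and_false]
    simp

theorem im_ball_deriv (ψ : MulAut (FreeGroup ι)) (a : FreeGroup ι) (i l : ι) (g : FreeGroup ι) :
    ind (tr a (im ψ (ball i))) (g * ψ (FreeGroup.of l)) - ind (tr a (im ψ (ball i))) g =
      if l = i ∧ a * g = 1 then 1 else 0 := by
  have : ∀ x, ind (tr a (im ψ (ball i))) x = ind (ball i) (ψ⁻¹ (a * x)) := fun x => rfl
  rw [this, this, ← mul_assoc, map_mul ψ⁻¹ (a * g), MulAut.inv_apply_self, ball_deriv]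
  simp only [map_eq_one_iff _ (MulEquiv.injective ψ⁻¹)]

omit [DecidableEq ι] in
/-- A nontrivial set is determined by its derivatives along a basis. -/
theorem eq_of_deriv (ψ : MulAut (FreeGroup ι)) {U V : Set (FreeGroup ι)}
    (h : ∀ l g, ind U (g * ψ (FreeGroup.of l)) - ind U g =
      ind V (g * ψ (FreeGroup.of l)) - ind V g) {a a' : FreeGroup ι} (ha : a ∉ U) (ha' : a' ∈ U) :
    U = V := by
  have h1 : ∀ w g, ind U (g * ψ w) - ind V (g * ψ w) = ind U g - ind V g := by
    intro w
    induction w using FreeGroup.induction_on with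
    | C1 => simp
    | of i => intro g; linarith [h i g]
    | inv_of i _ =>
      intro g
      have := h i (g * ψ (FreeGroup.of i)⁻¹)
      rw [map_inv, inv_mul_cancel_right] at this
      rw [map_inv]
      linarith
    | mul x y hx hy =>
      intro g
      rw [map_mul, ← mul_assoc, hy, hx]
  have h2 : ∀ g g', ind U g - ind V g = ind U g' - ind V g' := fun g g' => by
    have := h1 (ψ⁻¹ (g'⁻¹ * g)) g'
    rwa [MulAut.apply_inv_self, mul_inv_cancel_left] at this
  ext x
  have e1 := h2 x a
  have e2 := h2 x a'
  by_cases hx : x ∈ U <;> by_cases hx' : x ∈ V <;> by_cases h3 : a ∈ V <;> by_cases h4 : a' ∈ V <;>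
    simp [ind, ha, ha', hx, hx', h3, h4] at e1 e2 ⊢

omit [DecidableEq ι] in
/-- Right invariance under a generator. -/
theorem mem_mul_zpow {U : Set (FreeGroup ι)} {z : FreeGroup ι} (h : ∀ g, g * z ∈ U ↔ g ∈ U) (n : ℤ)
    (g : FreeGroup ι) : g * z ^ n ∈ U ↔ g ∈ U := by
  induction n using Int.induction_on generalizing g with
  | zero => simp
  | succ n ih => rw [zpow_add_one, ← mul_assoc, h, ih]
  | pred n ih =>
    rw [zpow_sub_one, ← mul_assoc, ← h, inv_mul_cancel_right, ih]

/-- The endomorphism which inverts or fixes a generator and multiplies the others by its powers. -/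
def exHom (i : ι) (s : ℤ) (m n : ι → ℤ) : FreeGroup ι →* FreeGroup ι :=
  FreeGroup.lift fun j => if j = i then FreeGroup.of i ^ s else
    FreeGroup.of i ^ m j * FreeGroup.of j * FreeGroup.of i ^ n j

theorem exHom_self (i : ι) (s : ℤ) (m n : ι → ℤ) :
    exHom i s m n (FreeGroup.of i) = FreeGroup.of i ^ s := by simp [exHom]

theorem exHom_ne {i j : ι} (h : j ≠ i) (s : ℤ) (m n : ι → ℤ) :
    exHom i s m n (FreeGroup.of j) = FreeGroup.of i ^ m j * FreeGroup.of j * FreeGroup.of i ^ n j := by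
  simp [exHom, h]

theorem exHom_comp (i : ι) {s : ℤ} (hs : s * s = 1) (m n m' n' : ι → ℤ)
    (hm : ∀ j, s * m j + m' j = 0) (hn : ∀ j, n' j + s * n j = 0) :
    (exHom i s m' n').comp (exHom i s m n) = MonoidHom.id _ := by
  ext j
  rw [MonoidHom.comp_apply, MonoidHom.id_apply]
  by_cases h : j = i
  · subst h
    rw [exHom_self, map_zpow, exHom_self, ← zpow_mul, hs, zpow_one]
  · rw [exHom_ne h, map_mul, map_mul, map_zpow, map_zpow, exHom_self, exHom_ne h, ← zpow_mul,
      ← zpow_mul, mul_assoc (_ ^ m' j), ← mul_assoc, ← mul_assoc, ← zpow_add, hm, mul_assoc,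
      ← zpow_add, hn]
    simp

/-- The automorphism which inverts or fixes a generator and multiplies the others by its powers. -/
def exch (i : ι) (s : ℤ) (hs : s * s = 1) (m n : ι → ℤ) : MulAut (FreeGroup ι) :=
  (exHom i s m n).toMulEquiv (exHom i s (fun j => -(s * m j)) (fun j => -(s * n j)))
    (exHom_comp i hs _ _ _ _ (fun j => by ring) fun j => by ring)
    (exHom_comp i hs _ _ _ _ (fun j => by linear_combination (- m j) * hs)
      fun j => by linear_combination (- n j) * hs)

theorem exch_apply (i : ι) (s : ℤ) (hs : s * s = 1) (m n : ι → ℤ) (x : FreeGroup ι) :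
    exch i s hs m n x = exHom i s m n x := rfl

omit [DecidableEq ι] in
/-- The subgroup generated by all generators except one. -/
def cof (i : ι) : Subgroup (FreeGroup ι) := Subgroup.closure {x | ∃ j, j ≠ i ∧ x = FreeGroup.of j}

omit [DecidableEq ι] in
theorem of_mem_cof {i j : ι} (h : j ≠ i) : FreeGroup.of j ∈ cof i :=
  Subgroup.subset_closure ⟨j, h, rfl⟩

/-- The double coset of a letter. -/
def dbl (l : ι × Bool) : Set (FreeGroup ι) :=
  {x | ∃ a ∈ cof l.1, ∃ b ∈ cof l.1, x = a * lt l * b}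

omit [DecidableEq ι] in
theorem lt_mem_dbl (l : ι × Bool) : lt l ∈ dbl l :=
  ⟨1, one_mem _, 1, one_mem _, by simp⟩

/-- The vertex of a letter in the rose of an automorphism. -/
def vtx (φ : MulAut (FreeGroup ι)) (l : ι × Bool) : Subgroup (FreeGroup ι) × Set (FreeGroup ι) :=
  ((cof l.1).map φ.toMonoidHom, φ '' dbl l)

theorem exHom_cof {i j : ι} (h : j ≠ i) (s : ℤ) (m n : ι → ℤ) :
    cof j ≤ (cof j).comap (exHom i s m n) := by
  rw [cof, Subgroup.closure_le]
  rintro _ ⟨l, hl, rfl⟩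
  have hi : FreeGroup.of i ∈ cof j := of_mem_cof h.symm
  change exHom i s m n (FreeGroup.of l) ∈ cof j
  by_cases hli : l = i
  · subst hli
    rw [exHom_self]
    exact zpow_mem hi _
  · rw [exHom_ne hli]
    exact mul_mem (mul_mem (zpow_mem hi _) (of_mem_cof hl)) (zpow_mem hi _)

theorem exHom_dbl {i j : ι} (h : j ≠ i) (s : ℤ) (m n : ι → ℤ) (ε : Bool) {x : FreeGroup ι}
    (hx : x ∈ dbl (j, ε)) : exHom i s m n x ∈ dbl (j, ε) := by
  obtain ⟨a, ha, b, hb, rfl⟩ := hx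
  have hi : FreeGroup.of i ∈ cof j := of_mem_cof h.symm
  have ha' := exHom_cof h s m n ha
  have hb' := exHom_cof h s m n hb
  rw [Subgroup.mem_comap] at ha' hb'
  rw [map_mul, map_mul]
  cases ε
  · refine ⟨_, mul_mem ha' (zpow_mem hi (-n j)), _, mul_mem (zpow_mem hi (-m j)) hb', ?_⟩
    rw [lt_false, map_inv, exHom_ne h, mul_inv_rev, mul_inv_rev, zpow_neg, zpow_neg]
    simp only [mul_assoc]
  · refine ⟨_, mul_mem ha' (zpow_mem hi (m j)), _, mul_mem (zpow_mem hi (n j)) hb', ?_⟩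
    rw [lt_true, exHom_ne h]
    simp only [mul_assoc]

theorem vtx_exch {i j : ι} (h : j ≠ i) (s : ℤ) (hs : s * s = 1) (m n : ι → ℤ) (ε : Bool) :
    vtx (exch i s hs m n) (j, ε) = vtx 1 (j, ε) := by
  refine Prod.ext ?_ ?_
  · refine le_antisymm ?_ ?_
    · rintro _ ⟨x, hx, rfl⟩
      exact ⟨_, exHom_cof h s m n hx, rfl⟩
    · rintro _ ⟨x, hx, rfl⟩
      exact ⟨(exch i s hs m n)⁻¹ x, exHom_cof h s _ _ hx, MulAut.apply_inv_self _ _ x⟩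
  · refine subset_antisymm ?_ ?_
    · rintro _ ⟨x, hx, rfl⟩
      exact ⟨_, exHom_dbl h s m n ε hx, rfl⟩
    · rintro _ ⟨x, hx, rfl⟩
      exact ⟨(exch i s hs m n)⁻¹ x, exHom_dbl h s _ _ ε hx, MulAut.apply_inv_self _ _ x⟩

variable {Λ : Type} [AddCommMonoid Λ] [LinearOrder Λ] [IsOrderedCancelAddMonoid Λ]

theorem Size.exchange_aux [Fintype ι] {sz : Set (FreeGroup ι) → Λ} (hs : Size sz) (t : ι × Bool)
    (hno : ∀ θ, (∀ j, j ≠ t.1 → ∀ ε, vtx θ (j, ε) = vtx 1 (j, ε)) →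
      ∑ k, sz (ball k) ≤ ∑ k, sz (im θ (ball k)))
    {Z : Set (FreeGroup ι)} (hZ : Star 1 Z) (h1 : 1 ∉ Z) (h2 : lt t ∈ Z) (h3 : lt (opp t) ∉ Z) :
    sz (ball t.1) ≤ sz Z := by
  classical
  obtain ⟨i, β⟩ := t
  change sz (ball i) ≤ sz Z
  change ∀ θ, (∀ j, j ≠ i → ∀ ε, vtx θ (j, ε) = vtx 1 (j, ε)) → _ at hno
  let s : ℤ := if β then 1 else -1
  have hs1 : s * s = 1 := by cases β <;> rfl
  set z : FreeGroup ι := lt (i, β) with hz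
  have hzs : FreeGroup.of i ^ s = z := by cases β <;> simp [s, hz, lt_true, lt_false]
  have hder : ∀ l g, ind Z (g * lt l) - ind Z g = if g = 1 then ind Z (lt l) else
      if g * lt l = 1 then - ind Z (lt (opp l)) else 0 := fun l g => by
    rw [hZ.ind_sub l g]
    simp only [one_mul, lt_opp, mul_eq_one_iff_eq_inv]
    simp [ind, h1]
  have hderz : ∀ g, ind Z (g * z) - ind Z g = if g = 1 then 1 else 0 := fun g => by
    have h2' : lt (i, β) ∈ Z := h2
    rw [hz, hder]
    simp [ind, h2', h3]
  let p : ι → ℤ := fun j => ind Z (FreeGroup.of j)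
  let q : ι → ℤ := fun j => ind Z (FreeGroup.of j)⁻¹
  let θ := exch i s hs1 (fun j => -(s * p j)) (fun j => s * q j)
  have hθi : θ (FreeGroup.of i) = z := by rw [exch_apply, exHom_self, hzs]
  have hθj : ∀ j, j ≠ i → θ (FreeGroup.of j) = z ^ (- p j) * FreeGroup.of j * z ^ q j :=
    fun j hj => by
      rw [exch_apply, exHom_ne hj, ← hzs, ← zpow_mul, ← zpow_mul]
      congr 3
      ring
  have hpow : ∀ (r : ℤ) (g : FreeGroup ι), r = 0 ∨ r = 1 →
      ind Z (g * z ^ r) - ind Z g = if g = 1 then r else 0 := fun r g hr => by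
    rcases hr with rfl | rfl
    · simp
    · rw [zpow_one, hderz]
  have h01 : ∀ x, ind Z x = 0 ∨ ind Z x = 1 := fun x => by
    by_cases h : x ∈ Z <;> simp [ind, h]
  have hZθ : Z = im θ (ball i) := by
    have h4 : im θ (ball i) = GrpCoh.tr 1 (im θ (ball i)) := by ext; simp [GrpCoh.tr]
    rw [h4]
    refine eq_of_deriv θ (fun l g => ?_) h1 h2
    rw [im_ball_deriv, one_mul]
    by_cases hl : l = i
    · subst hl
      rw [hθi, hderz]
      simp
    · rw [hθj l hl, if_neg (fun h => hl h.1)]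
      set u := g * z ^ (-p l) with hu
      have e1 := hpow (p l) u (h01 _)
      have e2 := hpow (q l) (u * FreeGroup.of l) (h01 _)
      have e3 := hder (l, true) u
      rw [hu, zpow_neg, inv_mul_cancel_right, ← zpow_neg, ← hu] at e1
      rw [lt_true, lt_opp, lt_true] at e3
      rw [← mul_assoc, ← mul_assoc, ← hu]
      by_cases hu1 : u = 1
      · have hu2 : u * FreeGroup.of l ≠ 1 := by rw [hu1, one_mul]; exact FreeGroup.of_ne_one l
        rw [if_pos hu1] at e1 e3
        rw [if_neg hu2] at e2
        simp only [p] at e1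
        linarith
      · rw [if_neg hu1] at e1 e3
        split_ifs at e2 e3 with hu2
        · simp only [q] at e2
          linarith
        · linarith
  have hball : ∀ j, j ≠ i → sz (im θ (ball j)) = sz (ball j) := fun j hj => by
    have hinv : ∀ g, g * z ∈ ball j ↔ g ∈ ball j := by
      have : ∀ g, g * FreeGroup.of i ∈ ball j ↔ g ∈ ball j := fun g => by
        have := ball_deriv j i g
        rw [if_neg (fun h => hj h.1.symm)] at this
        by_cases h5 : g * FreeGroup.of i ∈ ball j <;> by_cases h6 : g ∈ ball j <;>
          simp [ind, h5, h6] at this ⊢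
      intro g
      rw [← hzs]
      exact mem_mul_zpow this _ _
    have hpw := mem_mul_zpow hinv
    rw [← hs.tr (z ^ (- p j)) (im θ (ball j))]
    congr 1
    refine (eq_of_deriv θ (fun l g => ?_) (a := 1) (a' := FreeGroup.of j)
      (by simp [mem_ball]) (by simp [mem_ball, ← lt_true])).symm
    rw [im_ball_deriv]
    by_cases hl : l = i
    · subst hl
      rw [hθi, if_neg (fun h => hj h.1.symm), ind_congr (hinv g), sub_self]
    · rw [hθj l hl, ← mul_assoc, ← mul_assoc, ind_congr (hpw _ _),
        ← ind_congr (hpw (- p l) g), ball_deriv]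
      by_cases hlj : l = j
      · subst hlj
        simp only [true_and]
        congr 1
        rw [mul_eq_one_iff_eq_inv, mul_eq_one_iff_inv_eq]
        exact propext eq_comm
      · simp [hlj]
  have := hno θ fun j hj ε => vtx_exch hj _ hs1 _ _ ε
  rw [← Finset.add_sum_erase _ _ (Finset.mem_univ i),
    ← Finset.add_sum_erase _ _ (Finset.mem_univ i), ← hZθ,
    Finset.sum_congr rfl fun j hj => hball j (Finset.ne_of_mem_erase hj)] at this
  exact le_of_add_le_add_right this

theorem Size.exchange [Fintype ι] {sz : Set (FreeGroup ι) → Λ} (hs : Size sz) (t : ι × Bool)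
    (hno : ∀ θ, (∀ j, j ≠ t.1 → ∀ ε, vtx θ (j, ε) = vtx 1 (j, ε)) →
      ∑ k, sz (ball k) ≤ ∑ k, sz (im θ (ball k)))
    {v : FreeGroup ι} {Z : Set (FreeGroup ι)} (hZ : Star v Z) (hc : chi Z (lt t) ≠ 0) :
    sz (ball t.1) ≤ sz Z := by
  rw [hZ.chi] at hc
  rw [← hs.tr v Z]
  have hZ' : Star 1 (GrpCoh.tr v Z) := fun t g hg => by simpa [GrpCoh.tr] using hZ t g hg
  have e1 : lt t ∈ GrpCoh.tr v Z ↔ v * lt t ∈ Z := Iff.rfl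
  have e2 : lt (opp t) ∈ GrpCoh.tr v Z ↔ v * lt (opp t) ∈ Z := Iff.rfl
  have hc' : ¬ (lt t ∈ GrpCoh.tr v Z ↔ lt (opp t) ∈ GrpCoh.tr v Z) := fun h => by
    rw [e1, e2] at h
    exact hc (sub_eq_zero.2 (ind_congr h))
  generalize GrpCoh.tr v Z = Y at hZ' hc'
  have ho : sz (ball (opp t).1) = sz (ball t.1) := rfl
  by_cases h1 : (1 : FreeGroup ι) ∈ Y
  · rw [← hs.compl Y]
    by_cases h2 : lt t ∈ Y
    · rw [← ho]
      refine hs.exchange_aux (opp t) hno hZ'.compl (by simpa using h1) ?_ ?_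
      · exact fun h => hc' (by tauto)
      · rw [opp_opp]
        simpa using h2
    · exact hs.exchange_aux t hno hZ'.compl (by simpa using h1) h2 (by
        rw [Set.mem_compl_iff, not_not]; tauto)
  · by_cases h2 : lt t ∈ Y
    · exact hs.exchange_aux t hno hZ' h1 h2 (by tauto)
    · rw [← ho]
      exact hs.exchange_aux (opp t) hno hZ' h1 (by tauto) (by rwa [opp_opp])

end

section
variable {ι : Type} [DecidableEq ι]

theorem ball_ai (i : ι) : AI (ball i) := ht_ai _ _

theorem chi_ball (k l : ι) : chi (ball k) (FreeGroup.of l) = if l = k then 1 else 0 := by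
  simp only [chi, ball_deriv]
  by_cases h : l = k
  · simp only [h, true_and, if_true]
    rw [finsum_eq_single _ 1 fun x hx => if_neg hx, if_pos rfl]
  · simp [h]

omit [DecidableEq ι] in
theorem chi_one {U : Set (FreeGroup ι)} : chi U 1 = 0 := by simp [chi]

omit [DecidableEq ι] in
theorem AI.chi_inv {U : Set (FreeGroup ι)} (h : AI U) (x : FreeGroup ι) :
    chi U x⁻¹ = - chi U x := by
  have := chi_mul h x⁻¹ x
  rw [inv_mul_cancel, chi_one] at this
  linarith

/-- The character of a set expressed through the half-trees. -/
theorem chi_expand [Fintype ι] {U : Set (FreeGroup ι)} (h : AI U) (w : FreeGroup ι) :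
    ∑ l, chi (ball l) w * chi U (FreeGroup.of l) = chi U w := by
  have hof : ∀ i, ∑ l, chi (ball l) (FreeGroup.of i) * chi U (FreeGroup.of l) =
      chi U (FreeGroup.of i) := fun i => by
    simp only [chi_ball, ite_mul, one_mul, zero_mul]
    simp
  induction w using FreeGroup.induction_on with
  | C1 => simp [chi_one]
  | of i => exact hof i
  | inv_of i _ =>
    simp only [h.chi_inv, (ball_ai _).chi_inv, neg_mul, Finset.sum_neg_distrib, neg_inj]
    exact hof i
  | mul x y hx hy =>
    rw [chi_mul h, ← hx, ← hy, ← Finset.sum_add_distrib]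
    refine Finset.sum_congr rfl fun l _ => ?_
    rw [chi_mul (ball_ai l)]
    ring

theorem exists_perm_chi [Fintype ι] (ψ : MulAut (FreeGroup ι)) :
    ∃ σ : Equiv.Perm ι, ∀ i, chi (im ψ (ball (σ i))) (FreeGroup.of i) ≠ 0 := by
  let M : Matrix ι ι ℤ := fun k i => chi (im ψ (ball k)) (FreeGroup.of i)
  let N : Matrix ι ι ℤ := fun i k => chi (ball i) (ψ (FreeGroup.of k))
  have h : M * N = 1 := by
    ext k l
    rw [Matrix.mul_apply, Matrix.one_apply]
    have := chi_expand ((ball_ai k).im ψ) (ψ (FreeGroup.of l))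
    rw [chi_im ψ _ (ψ _), MulAut.inv_apply_self, chi_ball] at this
    simp only [M, N, mul_comm (chi (im ψ (ball k)) _), this, eq_comm]
  have hd : M.det ≠ 0 := fun h0 => by
    have := congrArg Matrix.det h
    rw [Matrix.det_mul, h0, zero_mul, Matrix.det_one] at this
    exact zero_ne_one this
  rw [Matrix.det_apply] at hd
  obtain ⟨σ, -, hσ⟩ := Finset.exists_ne_zero_of_sum_ne_zero hd
  refine ⟨σ, fun i hi => hσ ?_⟩
  rw [Finset.prod_eq_zero (Finset.mem_univ i) hi, smul_zero]

theorem chi_cof {κ : ι} {x : FreeGroup ι} (hx : x ∈ cof κ) : chi (ball κ) x = 0 := by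
  induction hx using Subgroup.closure_induction with
  | mem x hx =>
    obtain ⟨j, hj, rfl⟩ := hx
    rw [chi_ball, if_neg hj]
  | one => exact chi_one
  | mul x y _ _ hx hy => rw [chi_mul (ball_ai κ), hx, hy, add_zero]
  | inv x _ hx => rw [(ball_ai κ).chi_inv, hx, neg_zero]

theorem mem_ball_mul_cof {i : ι} {x : FreeGroup ι} (hx : x ∈ cof i) (g : FreeGroup ι) :
    g * x ∈ ball i ↔ g ∈ ball i := by
  induction hx using Subgroup.closure_induction generalizing g with
  | mem x hx =>
    obtain ⟨j, hj, rfl⟩ := hx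
    have := ball_deriv i j g
    rw [if_neg (fun h => hj h.1)] at this
    by_cases h5 : g * FreeGroup.of j ∈ ball i <;> by_cases h6 : g ∈ ball i <;>
      simp [ind, h5, h6] at this ⊢
  | one => rw [mul_one]
  | mul x y _ _ hx hy => rw [← mul_assoc, hy, hx]
  | inv x _ hx => rw [← hx, inv_mul_cancel_right]

/-- A common vertex of two roses gives the same set up to translation and complement. -/
theorem exists_tr_of_vtx {ψ : MulAut (FreeGroup ι)} {κ i : ι} {δ ε : Bool}
    (h : vtx ψ (κ, δ) = vtx 1 (i, ε)) :
    ∃ a, ball i = tr a (im ψ (ball κ)) ∨ (ball i)ᶜ = tr a (im ψ (ball κ)) := by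
  have h1 : ∀ x ∈ cof κ, ψ x ∈ cof i := fun x hx => by
    have : ψ x ∈ (vtx ψ (κ, δ)).1 := ⟨x, hx, rfl⟩
    rw [h] at this
    obtain ⟨y, hy, hyx⟩ := this
    rw [← hyx]
    exact hy
  have h2 : ∃ ε' : Bool, ∃ a ∈ cof i, ∃ b ∈ cof i, ψ (FreeGroup.of κ) = a * lt (i, ε') * b := by
    have : ψ (lt (κ, δ)) ∈ (vtx ψ (κ, δ)).2 := ⟨_, lt_mem_dbl _, rfl⟩
    rw [h] at this
    obtain ⟨y, ⟨a, ha, b, hb, rfl⟩, hyx⟩ := this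
    change a * lt (i, ε) * b = _ at hyx
    cases δ
    · refine ⟨!ε, b⁻¹, inv_mem hb, a⁻¹, inv_mem ha, ?_⟩
      rw [lt_false, map_inv, ← inv_eq_iff_eq_inv] at hyx
      rw [← hyx, show ((i, !ε) : ι × Bool) = opp (i, ε) from rfl, lt_opp, mul_inv_rev, mul_inv_rev,
        mul_assoc]
    · exact ⟨ε, a, ha, b, hb, by rw [hyx, lt_true]⟩
  obtain ⟨ε', a, ha, b, hb, h3⟩ := h2
  have hl : ∀ l, l ≠ κ → ∀ g, g * ψ (FreeGroup.of l) ∈ ball i ↔ g ∈ ball i := fun l hl g =>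
    mem_ball_mul_cof (h1 _ (of_mem_cof hl)) g
  cases ε'
  · refine ⟨a * (FreeGroup.of i)⁻¹, Or.inr (eq_of_deriv ψ (fun l g => ?_) (a := FreeGroup.of i)
      (a' := 1) (by simp [mem_ball, ← lt_true]) (by simp [mem_ball]))⟩
    rw [im_ball_deriv, ind_compl, ind_compl]
    by_cases hlκ : l = κ
    · subst hlκ
      rw [h3, ← mul_assoc, ind_congr (mem_ball_mul_cof hb _), ← ind_congr (mem_ball_mul_cof ha g),
        lt_false, ← mul_assoc]
      have := ball_deriv i i (g * a * (FreeGroup.of i)⁻¹)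
      rw [inv_mul_cancel_right] at this
      simp only [true_and] at this ⊢
      have e : g * a * (FreeGroup.of i)⁻¹ = 1 ↔ a * (FreeGroup.of i)⁻¹ * g = 1 := by
        rw [mul_assoc, mul_eq_one_iff_eq_inv, mul_eq_one_iff_inv_eq]
        exact eq_comm
      rw [← if_congr e rfl rfl, ← this]
      ring
    · rw [ind_congr (hl l hlκ g), if_neg (fun h => hlκ h.1), sub_self]
  · refine ⟨a, Or.inl (eq_of_deriv ψ (fun l g => ?_) (a := 1)
      (a' := FreeGroup.of i) (by simp [mem_ball]) (by simp [mem_ball, ← lt_true]))⟩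
    rw [im_ball_deriv]
    by_cases hlκ : l = κ
    · subst hlκ
      rw [h3, ← mul_assoc, ind_congr (mem_ball_mul_cof hb _), ← ind_congr (mem_ball_mul_cof ha g),
        lt_true, ← mul_assoc, ball_deriv]
      simp only [true_and]
      refine if_congr ?_ rfl rfl
      rw [mul_eq_one_iff_eq_inv, mul_eq_one_iff_inv_eq]
      exact eq_comm
    · rw [ind_congr (hl l hlκ g), if_neg (fun h => hlκ h.1), sub_self]

theorem nest_of_vtx {ψ : MulAut (FreeGroup ι)} {κ i : ι} {δ ε : Bool}
    (h : vtx ψ (κ, δ) = vtx 1 (i, ε)) (g : FreeGroup ι) (t : ι × Bool) (ht' : t.1 = i) (k : ι) :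
    Nest (ht g t) (im ψ (ball k)) := by
  obtain ⟨a, ha⟩ := exists_tr_of_vtx h
  have h1 : ∀ c, Nest (tr c (im ψ (ball κ))) (im ψ (ball k)) := fun c => by
    have : tr c (im ψ (ball κ)) = im ψ (tr (ψ⁻¹ c) (ball κ)) := by
      ext x
      change ψ⁻¹ (c * x) ∈ ball κ ↔ ψ⁻¹ c * ψ⁻¹ x ∈ ball κ
      rw [map_mul]
    rw [this, ht_tr]
    exact (nest_ht _ _ _ _).im ψ
  have htt : ∀ c (U : Set (FreeGroup ι)), tr c (tr a U) = tr (a * c) U := fun c U => by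
    ext x
    change a * (c * x) ∈ U ↔ a * c * x ∈ U
    rw [mul_assoc]
  have h2 : ∀ c, Nest (tr c (ball i)) (im ψ (ball k)) := fun c => by
    rcases ha with ha | ha
    · rw [ha, htt]
      exact h1 (a * c)
    · rw [← compl_compl (ball i), ha]
      rw [show ∀ V : Set (FreeGroup ι), tr c Vᶜ = (tr c V)ᶜ from fun V => by ext; rfl, htt]
      exact (h1 (a * c)).symm.compl.symm
  have h3 : ∀ c, Nest (ht c (i, true)) (im ψ (ball k)) := fun c => by
    have := h2 c⁻¹
    rwa [ht_tr, inv_inv, mul_one] at this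
  obtain ⟨j, ε⟩ := t
  change j = i at ht'
  subst ht'
  cases ε
  · have := ht_compl (g * lt (j, false)) (j, true)
    rw [← compl_compl (ht g (j, false)), ht_compl]
    exact (h3 _).symm.compl.symm
  · exact h3 g

variable {Λ : Type} [AddCommMonoid Λ] [LinearOrder Λ] [IsOrderedCancelAddMonoid Λ]

/-- If some rose is smaller than the standard rose then an exchange makes the latter smaller. -/
theorem Size.exists_exchange [Fintype ι] {sz : Set (FreeGroup ι) → Λ} (hs : Size sz)
    (ψ : MulAut (FreeGroup ι)) (hlt : ∑ k, sz (im ψ (ball k)) < ∑ k, sz (ball k)) :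
    ∃ i θ, ∑ k, sz (im θ (ball k)) < ∑ k, sz (ball k) ∧
      (∀ j, j ≠ i → ∀ ε, vtx θ (j, ε) = vtx 1 (j, ε)) ∧ ∀ ε l, vtx ψ l ≠ vtx 1 (i, ε) := by
  by_contra! hcon
  let T : Set ι := {i | ∃ ε l, vtx ψ l = vtx 1 (i, ε)}
  obtain ⟨σ, hσ⟩ := exists_perm_chi ψ
  refine absurd hlt (not_lt.2 ?_)
  rw [← Equiv.sum_comp σ fun k => sz (im ψ (ball k))]
  refine Finset.sum_le_sum fun i _ => ?_
  by_cases hi : i ∈ T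
  · obtain ⟨ε, ⟨κ, δ⟩, h⟩ := hi
    have hσi : σ i = κ := by
      rw [← Equiv.apply_symm_apply σ κ]
      by_contra hne
      have hne' : σ.symm κ ≠ i := fun h => hne (by rw [h])
      have h4 := hσ (σ.symm κ)
      rw [Equiv.apply_symm_apply, chi_im] at h4
      refine h4 (chi_cof ?_)
      have : FreeGroup.of (σ.symm κ) ∈ (vtx 1 (i, ε)).1 := ⟨_, of_mem_cof hne', rfl⟩
      rw [← h] at this
      obtain ⟨y, hy, hyx⟩ := this
      rw [← hyx]
      change ψ⁻¹ (ψ y) ∈ _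
      rwa [MulAut.inv_apply_self]
    rw [hσi]
    obtain ⟨a, ha | ha⟩ := exists_tr_of_vtx h
    · rw [ha, hs.tr]
    · rw [← hs.compl, ha, hs.tr]
  · refine hs.key (T := T) (fun t ht' v Z hZ hst hc => ?_) _ _ ((ball_ai (σ i)).im ψ) rfl
      (fun h t ht' => ?_) (i, true) hi (by rw [lt_true]; exact hσ i)
    · refine hs.exchange t (fun θ hθ => ?_) hst hc
      by_contra! hlt'
      obtain ⟨ε, l, h⟩ := hcon t.1 θ hlt' hθ
      exact ht' ⟨ε, l, h⟩
    · obtain ⟨ε, ⟨κ, δ⟩, h'⟩ := ht'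
      exact nest_of_vtx h' h t rfl _

end

section
variable {ι : Type}

/-- The coboundary of a set along a word. -/
def cob {F : Type} [Group F] (U : Set F) (w : F) : Set F := {g | ¬(g ∈ U ↔ g * w ∈ U)}

/-- The size of a set measured along finitely many words at each place. -/
def lsz {F : Type} [Group F] (L : ℕ → List F) (U : Set F) : Lex (ℕ → ℕ) :=
  toLex fun n => ((L n).map fun w => (cob U w).ncard).sum

theorem cob_tr {F : Type} [Group F] (h : F) (U : Set F) (w : F) :
    (cob (tr h U) w).ncard = (cob U w).ncard := by
  have : cob U w = (fun g => h * g) '' cob (tr h U) w := by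
    ext g
    constructor
    · intro hg
      refine ⟨h⁻¹ * g, ?_, by simp⟩
      simpa [cob, tr, ← mul_assoc] using hg
    · rintro ⟨g, hg, rfl⟩
      simpa [cob, tr, ← mul_assoc] using hg
  rw [this, Set.ncard_image_of_injective _ (mul_right_injective h)]

theorem cob_im {F : Type} [Group F] (ψ : MulAut F) (U : Set F) (w : F) :
    (cob (im ψ U) w).ncard = (cob U (ψ⁻¹ w)).ncard := by
  have : cob U (ψ⁻¹ w) = ⇑(ψ⁻¹) '' cob (im ψ U) w := by
    ext g
    constructor
    · intro hg
      refine ⟨ψ g, ?_, MulAut.inv_apply_self _ ψ g⟩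
      change ¬(ψ⁻¹ (ψ g) ∈ U ↔ ψ⁻¹ (ψ g * w) ∈ U)
      rwa [map_mul, MulAut.inv_apply_self]
    · rintro ⟨g, hg, rfl⟩
      change ¬(ψ⁻¹ g ∈ U ↔ ψ⁻¹ (g * w) ∈ U) at hg
      rwa [map_mul] at hg
  rw [this, Set.ncard_image_of_injective _ (MulEquiv.injective _)]

theorem cob_submod {F : Type} [Group F] {U V : Set F} (hU : AI U) (hV : AI V) (w : F) :
    (cob (U ∪ V) w).ncard + (cob (U ∩ V) w).ncard ≤ (cob U w).ncard + (cob V w).ncard := by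
  rw [← Set.ncard_union_add_ncard_inter (cob (U ∪ V) w) (cob (U ∩ V) w) (hU.union hV w)
      (hU.inter hV w),
    ← Set.ncard_union_add_ncard_inter (cob U w) (cob V w) (hU w) (hV w)]
  refine add_le_add (Set.ncard_le_ncard (fun g hg => ?_) ((hU w).union (hV w)))
    (Set.ncard_le_ncard (fun g hg => ?_) ((hU w).inter_of_left _))
  · simp only [cob, Set.mem_union, Set.mem_inter_iff, Set.mem_ofPred_eq] at hg ⊢
    tauto
  · simp only [cob, Set.mem_union, Set.mem_inter_iff, Set.mem_ofPred_eq] at hg ⊢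
    tauto

theorem list_sum_map_add {α : Type} (l : List α) (f g : α → ℕ) :
    (l.map f).sum + (l.map g).sum = (l.map fun a => f a + g a).sum := by
  induction l with
  | nil => rfl
  | cons a l ih => simp only [List.map_cons, List.sum_cons, ← ih]; ring

theorem lsz_size [DecidableEq ι] (L : ℕ → List (FreeGroup ι)) : Size (lsz L) where
  tr h U := by simp only [lsz, cob_tr]
  compl U := by
    have : ∀ w, cob Uᶜ w = cob U w := fun w => by
      ext g
      simp only [cob, Set.mem_compl_iff, Set.mem_ofPred_eq]
      tauto
    simp only [lsz, this]
  submod U V hU hV := by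
    rw [lsz, lsz, lsz, lsz, ← toLex_add, ← toLex_add]
    refine Pi.toLex_monotone fun n => ?_
    simp only [Pi.add_apply, list_sum_map_add]
    exact List.sum_le_sum fun w _ => cob_submod hU hV w

variable [DecidableEq ι]

theorem cob_letter (k : ι) (t : ι × Bool) (w : FreeGroup ι) (h : fl w ≠ some (opp t)) :
    (cob (ball k) (lt t * w)).ncard = (cob (ball k) w).ncard + if t.1 = k then 1 else 0 := by
  have hfin : (cob (ball k) w).Finite := ball_ai k w
  have h1 : ∀ g, (g ∈ ball k ↔ g * lt t ∈ ball k) ↔ ¬ (t.1 = k ∧ g = if t.2 then 1 else (lt t)⁻¹) := by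
    intro g
    obtain ⟨i, ε⟩ := t
    cases ε
    · have := ball_deriv k i (g * (FreeGroup.of i)⁻¹)
      simp only [inv_mul_cancel_right, mul_inv_eq_one] at this
      simp only [lt_false, inv_inv, Bool.false_eq_true, if_false]
      by_cases h5 : g ∈ ball k <;> by_cases h6 : g * (FreeGroup.of i)⁻¹ ∈ ball k <;>
        simp only [ind, h5, h6, if_true, if_false] at this ⊢ <;> split_ifs at this <;>
        tauto
    · have := ball_deriv k i g
      simp only [lt_true, if_true]
      by_cases h5 : g ∈ ball k <;> by_cases h6 : g * FreeGroup.of i ∈ ball k <;>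
        simp only [ind, h5, h6, if_true, if_false] at this ⊢ <;> split_ifs at this <;>
        tauto
  let B := (fun g => g * (lt t)⁻¹) '' cob (ball k) w
  have hB : ∀ g, g ∈ B ↔ ¬ (g * lt t ∈ ball k ↔ g * (lt t * w) ∈ ball k) := fun g => by
    constructor
    · rintro ⟨g, hg, rfl⟩
      simpa [cob, mul_assoc] using hg
    · intro hg
      exact ⟨g * lt t, by simpa [cob, mul_assoc] using hg, by simp⟩
  have hBc : B.ncard = (cob (ball k) w).ncard :=
    Set.ncard_image_of_injective _ (mul_left_injective _)
  have hBf : B.Finite := hfin.image _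
  by_cases hk : t.1 = k
  · rw [if_pos hk]
    set p : FreeGroup ι := if t.2 then 1 else (lt t)⁻¹ with hp
    have hpB : p ∉ B := by
      rw [hB, not_not]
      obtain ⟨i, ε⟩ := t
      change i = k at hk
      subst hk
      cases ε
      · have : p = (lt (i, false))⁻¹ := rfl
        rw [this, inv_mul_cancel, inv_mul_cancel_left, mem_ball, mem_ball, fl_one]
        have h' : fl w ≠ some (i, true) := h
        simp [h']
      · have : p = 1 := rfl
        rw [this, one_mul, one_mul, mem_ball, mem_ball, fl_lt, fl_lt_mul h]
    have : cob (ball k) (lt t * w) = insert p B := by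
      ext g
      rw [Set.mem_insert_iff, hB]
      have h2 := h1 g
      have h3 : g ∈ B → g ≠ p := fun h h' => hpB (h' ▸ h)
      rw [hB] at h3
      change ¬ (g ∈ ball k ↔ _) ↔ _
      simp only [hk, true_and] at h2
      tauto
    rw [this, Set.ncard_insert_of_notMem hpB hBf, hBc]
  · rw [if_neg hk, add_zero, ← hBc]
    congr 1
    ext g
    rw [hB]
    have h2 := h1 g
    change ¬ (g ∈ ball k ↔ _) ↔ _
    tauto

theorem sum_cob [Fintype ι] : ∀ (n : ℕ) (w : FreeGroup ι), w.norm = n →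
    ∑ k, (cob (ball k) w).ncard = n
  | 0, w, h => by
    have : w = 1 := FreeGroup.norm_eq_zero.1 h
    subst this
    refine Finset.sum_eq_zero fun k _ => ?_
    simp [cob]
  | n + 1, w, h => by
    obtain ⟨t, ht⟩ := Option.ne_none_iff_exists'.1 (fun h0 : fl w = none => by
      rw [fl_eq_none.1 h0, FreeGroup.norm_one] at h
      omega)
    obtain ⟨g, rfl, hg, hw⟩ := exists_lt_mul ht
    have hn : g.norm = n := by
      rw [FreeGroup.norm, hw, List.length_cons] at h
      exact Nat.succ_injective h
    simp only [cob_letter _ t g hg, Finset.sum_add_distrib, sum_cob n g hn]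
    simp

/-- The size of the rose of an automorphism. -/
def rsz {F : Type} [Group F] (N : F → ℕ) (L : ℕ → List F) (φ : MulAut F) : Lex (ℕ → ℕ) :=
  toLex fun n => ((L n).map fun w => N (φ⁻¹ w)).sum

theorem sum_lsz [Fintype ι] (L : ℕ → List (FreeGroup ι)) (φ : MulAut (FreeGroup ι)) :
    ∑ k, lsz L (im φ (ball k)) = rsz FreeGroup.norm L φ := by
  have h : ∀ (s : Finset ι) (f : ι → ℕ → ℕ), ∑ k ∈ s, toLex (f k) = toLex (∑ k ∈ s, f k) := by
    intro s f
    classical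
    induction s using Finset.induction_on with
    | empty => rfl
    | insert a s ha ih => rw [Finset.sum_insert ha, Finset.sum_insert ha, ih, toLex_add]
  simp only [lsz, rsz]
  rw [h]
  congr 1
  ext n
  rw [Finset.sum_apply]
  simp only [cob_im]
  induction L n with
  | nil => simp
  | cons w l ih =>
    simp only [List.map_cons, List.sum_cons, Finset.sum_add_distrib, ih]
    rw [sum_cob _ _ rfl]

theorem rsz_mul {F : Type} [Group F] (N : F → ℕ) (L : ℕ → List F) (φ ψ : MulAut F) :
    rsz N (fun n => (L n).map ⇑(φ⁻¹)) ψ = rsz N L (φ * ψ) := by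
  simp only [rsz, List.map_map]
  rfl

/-- The translate of a vertex. -/
def actV {F : Type} [Group F] (φ : MulAut F) (v : Subgroup F × Set F) : Subgroup F × Set F :=
  (v.1.map φ.toMonoidHom, φ '' v.2)

theorem actV_mul {F : Type} [Group F] (φ ψ : MulAut F) (v : Subgroup F × Set F) :
    actV (φ * ψ) v = actV φ (actV ψ v) := by
  refine Prod.ext ?_ ?_
  · change Subgroup.map _ _ = Subgroup.map _ (Subgroup.map _ _)
    rw [Subgroup.map_map]
    rfl
  · change _ '' _ = _ '' (_ '' _)
    rw [Set.image_image]
    rfl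

theorem actV_one {F : Type} [Group F] (v : Subgroup F × Set F) : actV 1 v = v := by
  refine Prod.ext ?_ ?_
  · exact Subgroup.map_id _
  · exact Set.image_id _

theorem actV_inv {F : Type} [Group F] (φ : MulAut F) (v : Subgroup F × Set F) :
    actV φ⁻¹ (actV φ v) = v := by
  rw [← actV_mul, inv_mul_cancel, actV_one]

theorem actV_inv' {F : Type} [Group F] (φ : MulAut F) (v : Subgroup F × Set F) :
    actV φ (actV φ⁻¹ v) = v := by
  rw [← actV_mul, mul_inv_cancel, actV_one]

omit [DecidableEq ι] in
theorem actV_vtx (φ ψ : MulAut (FreeGroup ι)) (l : ι × Bool) :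
    actV φ (vtx ψ l) = vtx (φ * ψ) l := (actV_mul φ ψ (cof l.1, dbl l)).symm

/-- The exchange property for the roses of arbitrary automorphisms. -/
theorem exists_exchange [Fintype ι] (L : ℕ → List (FreeGroup ι)) (φ ψ : MulAut (FreeGroup ι))
    (h : rsz FreeGroup.norm L ψ < rsz FreeGroup.norm L φ) :
    ∃ i θ, rsz FreeGroup.norm L θ < rsz FreeGroup.norm L φ ∧
      (∀ j, j ≠ i → ∀ ε, vtx θ (j, ε) = vtx φ (j, ε)) ∧ ∀ ε l, vtx ψ l ≠ vtx φ (i, ε) := by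
  have key : ∀ θ, ∑ k, lsz (fun n => (L n).map ⇑(φ⁻¹)) (im θ (ball k)) =
      rsz FreeGroup.norm L (φ * θ) := fun θ => by rw [sum_lsz, rsz_mul]
  have h1 : ∑ k, lsz (fun n => (L n).map ⇑(φ⁻¹)) (ball k) = rsz FreeGroup.norm L φ := by
    rw [← mul_one φ, ← key, mul_one]
    rfl
  obtain ⟨i, θ, h2, h3, h4⟩ := (lsz_size fun n => (L n).map ⇑(φ⁻¹)).exists_exchange (φ⁻¹ * ψ)
    (by rwa [key, h1, mul_inv_cancel_left])
  rw [key, h1] at h2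
  refine ⟨i, φ * θ, h2, fun j hj ε => ?_, fun ε l he => h4 ε l ?_⟩
  · rw [← actV_vtx, h3 j hj, actV_vtx, mul_one]
  · rw [← actV_vtx, he, actV_vtx, inv_mul_cancel]

end

section
variable {ι : Type} [DecidableEq ι]

theorem lt_injective : Function.Injective (lt : ι × Bool → FreeGroup ι) := fun s t h => by
  have := fl_lt s
  rw [h, fl_lt] at this
  exact (Option.some.inj this).symm

/-- The automorphism permutes the letters. -/
def Signed (α : MulAut (FreeGroup ι)) (π : ι × Bool → ι × Bool) : Prop := ∀ t, α (lt t) = lt (π t)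

section
variable {α : MulAut (FreeGroup ι)} {π : ι × Bool → ι × Bool}

theorem Signed.opp (h : Signed α π) (t : ι × Bool) : π (opp t) = GrpCoh.opp (π t) :=
  lt_injective (by rw [← h, lt_opp, map_inv, h, lt_opp])

theorem Signed.injective (h : Signed α π) : Function.Injective π := fun s t hst =>
  lt_injective (α.injective (by rw [h, h, hst]))

omit [DecidableEq ι] in
theorem fst_eq_iff (s t : ι × Bool) : s.1 = t.1 ↔ s = t ∨ s = opp t := by
  obtain ⟨i, ε⟩ := s
  obtain ⟨j, δ⟩ := t
  cases ε <;> cases δ <;> simp [opp]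

theorem Signed.fst (h : Signed α π) (s t : ι × Bool) : (π s).1 = (π t).1 ↔ s.1 = t.1 := by
  rw [fst_eq_iff, fst_eq_iff, ← h.opp, h.injective.eq_iff, h.injective.eq_iff]

theorem Signed.inv [Finite ι] (h : Signed α π) :
    ∃ π', Signed α⁻¹ π' ∧ ∀ t, π' (π t) = t := by
  let π' := Equiv.ofBijective π (Finite.injective_iff_bijective.1 h.injective)
  have hπ : ∀ t, π'.symm (π t) = t := π'.symm_apply_apply
  refine ⟨π'.symm, fun t => ?_, hπ⟩
  obtain ⟨s, rfl⟩ := π'.surjective t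
  change α⁻¹ (lt (π s)) = lt (π'.symm (π s))
  rw [hπ, ← h, MulAut.inv_apply_self]

theorem Signed.cof (h : Signed α π) (l : ι × Bool) {x : FreeGroup ι} (hx : x ∈ GrpCoh.cof l.1) :
    α x ∈ GrpCoh.cof (π l).1 := by
  have : GrpCoh.cof l.1 ≤ (GrpCoh.cof (π l).1).comap α.toMonoidHom := by
    rw [GrpCoh.cof, Subgroup.closure_le]
    rintro _ ⟨j, hj, rfl⟩
    change α (lt (j, true)) ∈ GrpCoh.cof (π l).1
    have h1 : (π (j, true)).1 ≠ (π l).1 := fun h2 => hj ((h.fst _ _).1 h2)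
    rw [h]
    generalize π (j, true) = s at h1
    obtain ⟨i, ε⟩ := s
    cases ε
    · rw [lt_false]
      exact inv_mem (of_mem_cof h1)
    · exact of_mem_cof h1
  exact this hx

theorem Signed.dbl (h : Signed α π) (l : ι × Bool) {x : FreeGroup ι} (hx : x ∈ GrpCoh.dbl l) :
    α x ∈ GrpCoh.dbl (π l) := by
  obtain ⟨a, ha, b, hb, rfl⟩ := hx
  exact ⟨α a, h.cof l ha, α b, h.cof l hb, by rw [map_mul, map_mul, h]⟩

theorem Signed.vtx [Finite ι] (h : Signed α π) (φ : MulAut (FreeGroup ι)) (l : ι × Bool) :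
    vtx (φ * α) l = GrpCoh.vtx φ (π l) := by
  have key : GrpCoh.vtx α l = GrpCoh.vtx 1 (π l) := by
    obtain ⟨π', h', hπ⟩ := h.inv
    refine Prod.ext (le_antisymm ?_ ?_) (subset_antisymm ?_ ?_)
    · rintro _ ⟨x, hx, rfl⟩
      exact ⟨_, h.cof l hx, rfl⟩
    · rintro _ ⟨x, hx, rfl⟩
      have := h'.cof (π l) hx
      rw [hπ] at this
      exact ⟨_, this, MulAut.apply_inv_self _ α x⟩
    · rintro _ ⟨x, hx, rfl⟩
      exact ⟨_, h.dbl l hx, rfl⟩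
    · rintro _ ⟨x, hx, rfl⟩
      have := h'.dbl (π l) hx
      rw [hπ] at this
      exact ⟨_, this, MulAut.apply_inv_self _ α x⟩
  rw [← actV_vtx, key, actV_vtx, mul_one]

theorem Signed.nd (h : Signed α π) {w : List (ι × Bool)} (hw : Nd w) : Nd (w.map π) := by
  rw [Nd, List.map_map, List.nodup_iff_pairwise_ne, List.pairwise_map]
  rw [Nd, List.nodup_iff_pairwise_ne, List.pairwise_map] at hw
  exact hw.imp fun hst h' => hst ((h.fst _ _).1 h')

end

/-- An automorphism which preserves the word length permutes the letters. -/
theorem exists_signed {α : MulAut (FreeGroup ι)} (h : ∀ u, (α u).norm = u.norm) :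
    ∃ π, Signed α π := by
  have : ∀ t, ∃ s, α (lt t) = lt s := fun t => by
    have h1 : (α (lt t)).toWord.length = 1 := by
      have := h (lt t)
      rwa [FreeGroup.norm, FreeGroup.norm, toWord_lt] at this
    obtain ⟨s, hs⟩ := List.length_eq_one_iff.1 h1
    exact ⟨s, by rw [← FreeGroup.mk_toWord (x := α (lt t)), hs]; rfl⟩
  choose π hπ using this
  exact ⟨π, hπ⟩

theorem vtx_injective (φ : MulAut (FreeGroup ι)) : Function.Injective (vtx φ) := by
  intro s t h
  have h1 : vtx 1 s = vtx 1 t := by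
    rw [← inv_mul_cancel φ, ← actV_vtx, ← actV_vtx, h]
  have h2 : cof s.1 = cof t.1 := by
    have := congrArg Prod.fst h1
    rwa [vtx, vtx, show (1 : MulAut (FreeGroup ι)).toMonoidHom = MonoidHom.id _ from rfl,
      Subgroup.map_id, Subgroup.map_id] at this
  have h3 : dbl s = dbl t := by
    have := congrArg Prod.snd h1
    simpa only [vtx, MulAut.coe_one, Set.image_id] using this
  have h4 : s.1 = t.1 := by
    by_contra hne
    have := of_mem_cof hne
    rw [← h2] at this
    have := chi_cof this
    rw [chi_ball, if_pos rfl] at this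
    exact one_ne_zero this
  obtain ⟨i, ε⟩ := s
  obtain ⟨j, δ⟩ := t
  change i = j at h4
  subst h4
  have h5 : ∀ ε x, x ∈ dbl (i, ε) → chi (ball i) x = if ε then 1 else -1 := fun ε x hx => by
    obtain ⟨a, ha, b, hb, rfl⟩ := hx
    rw [chi_mul (ball_ai i), chi_mul (ball_ai i), chi_cof ha, chi_cof hb]
    cases ε
    · rw [lt_false, (ball_ai i).chi_inv, chi_ball]
      simp
    · rw [lt_true, chi_ball]
      simp
  have h6 := h5 ε _ (lt_mem_dbl _)
  have h7 := h5 δ (lt (i, ε)) (h3 ▸ lt_mem_dbl _)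
  rw [h6] at h7
  cases ε <;> cases δ <;> first | rfl | simp at h7

/-- The subgroup generated by a set of generators. -/
def gsub (S : Set ι) : Subgroup (FreeGroup ι) := Subgroup.closure (FreeGroup.of '' S)

open Classical in
/-- The retraction onto the subgroup generated by a set of generators. -/
def retr (S : Set ι) : FreeGroup ι →* FreeGroup ι :=
  FreeGroup.lift fun j => if j ∈ S then FreeGroup.of j else 1

omit [DecidableEq ι] in
theorem retr_of (S : Set ι) {j : ι} (h : j ∈ S) : retr S (FreeGroup.of j) = FreeGroup.of j := by
  simp [retr, h]

omit [DecidableEq ι] in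
theorem retr_of_not (S : Set ι) {j : ι} (h : j ∉ S) : retr S (FreeGroup.of j) = 1 := by
  simp [retr, h]

omit [DecidableEq ι] in
theorem retr_mem (S : Set ι) (x : FreeGroup ι) : retr S x ∈ gsub S := by
  induction x using FreeGroup.induction_on with
  | C1 => rw [map_one]; exact one_mem _
  | of i =>
    by_cases h : i ∈ S
    · rw [retr_of S h]
      exact Subgroup.subset_closure ⟨i, h, rfl⟩
    · rw [retr_of_not S h]
      exact one_mem _
  | inv_of i h => rw [map_inv]; exact inv_mem h
  | mul x y hx hy => rw [map_mul]; exact mul_mem hx hy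

omit [DecidableEq ι] in
theorem mem_gsub {S : Set ι} {x : FreeGroup ι} : x ∈ gsub S ↔ retr S x = x := by
  constructor
  · intro h
    have : gsub S ≤ (retr S).eqLocus (MonoidHom.id _) := by
      rw [gsub, Subgroup.closure_le]
      rintro _ ⟨j, hj, rfl⟩
      exact retr_of S hj
    exact this h
  · intro h
    rw [← h]
    exact retr_mem S x

omit [DecidableEq ι] in
theorem retr_retr (S T : Set ι) (x : FreeGroup ι) : retr S (retr T x) = retr (S ∩ T) x := by
  have : (retr S).comp (retr T) = retr (S ∩ T) := by
    ext j
    rw [MonoidHom.comp_apply]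
    by_cases hT : j ∈ T
    · rw [retr_of T hT]
      by_cases hS : j ∈ S
      · rw [retr_of S hS, retr_of (S ∩ T) ⟨hS, hT⟩]
      · rw [retr_of_not S hS, retr_of_not (S ∩ T) (fun h => hS h.1)]
    · rw [retr_of_not T hT, retr_of_not (S ∩ T) (fun h => hT h.2), map_one]
  rw [← this]
  rfl

omit [DecidableEq ι] in
theorem mem_gsub_inter {S T : Set ι} {x : FreeGroup ι} :
    x ∈ gsub (S ∩ T) ↔ x ∈ gsub S ∧ x ∈ gsub T := by
  constructor
  · intro h
    exact ⟨Subgroup.closure_mono (Set.image_mono Set.inter_subset_left) h,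
      Subgroup.closure_mono (Set.image_mono Set.inter_subset_right) h⟩
  · rintro ⟨h1, h2⟩
    rw [mem_gsub] at h1 h2 ⊢
    rw [← retr_retr, h2, h1]

omit [DecidableEq ι] in
theorem cof_eq (i : ι) : cof i = gsub {i}ᶜ := by
  rw [cof, gsub]
  congr 1
  ext x
  simp [Set.mem_image, eq_comm]

/-- The intersection of the subgroups of the vertices. -/
def core {F : Type} [Group F] (τ : List (Subgroup F × Set F)) : Subgroup F := ⨅ v ∈ τ, v.1

theorem mem_core {F : Type} [Group F] {τ : List (Subgroup F × Set F)} {x : F} :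
    x ∈ core τ ↔ ∀ v ∈ τ, x ∈ v.1 := by
  simp [core, Subgroup.mem_iInf]

theorem mem_core_act {F : Type} [Group F] {τ : List (Subgroup F × Set F)} {x : F} (φ : MulAut F) :
    x ∈ core (τ.map (actV φ)) ↔ φ⁻¹ x ∈ core τ := by
  rw [mem_core, mem_core, List.forall_mem_map]
  refine forall₂_congr fun v _ => ?_
  constructor
  · rintro ⟨y, hy, rfl⟩
    change φ⁻¹ (φ y) ∈ _
    rwa [MulAut.inv_apply_self]
  · intro h
    exact ⟨_, h, MulAut.apply_inv_self _ φ x⟩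

omit [DecidableEq ι] in
theorem mem_core_one {w : List (ι × Bool)} {x : FreeGroup ι} :
    x ∈ core (w.map (vtx 1)) ↔ x ∈ gsub {j | j ∉ w.map Prod.fst} := by
  rw [mem_core, List.forall_mem_map]
  have h1 : ∀ l, x ∈ (vtx 1 l).1 ↔ x ∈ gsub {l.1}ᶜ := fun l => by
    rw [vtx, show (1 : MulAut (FreeGroup ι)).toMonoidHom = MonoidHom.id _ from rfl,
      Subgroup.map_id, cof_eq]
  simp only [h1]
  induction w with
  | nil =>
    have : retr (Set.univ : Set ι) = MonoidHom.id _ := by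
      ext j
      exact retr_of _ (Set.mem_univ j)
    simp [mem_gsub, this]
  | cons l w ih =>
    have : {j | j ∉ (l :: w).map Prod.fst} = {l.1}ᶜ ∩ {j | j ∉ w.map Prod.fst} := by
      ext j
      simp only [List.map_cons, List.mem_cons, not_or, Set.mem_inter_iff, Set.mem_compl_iff,
        Set.mem_singleton_iff, Set.mem_ofPred_eq]
    rw [this, mem_gsub_inter, List.forall_mem_cons]
    exact and_congr Iff.rfl ih

omit [DecidableEq ι] in
theorem mem_core_vtx {φ : MulAut (FreeGroup ι)} {w : List (ι × Bool)} {x : FreeGroup ι} :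
    x ∈ core (w.map (vtx φ)) ↔ φ⁻¹ x ∈ gsub {j | j ∉ w.map Prod.fst} := by
  have : w.map (vtx φ) = (w.map (vtx 1)).map (actV φ) := by
    rw [List.map_map]
    refine List.map_congr_left fun l _ => ?_
    rw [Function.comp_apply, actV_vtx, mul_one]
  rw [this, mem_core_act, mem_core_one]

omit [DecidableEq ι] in
theorem core_vtx (φ : MulAut (FreeGroup ι)) (w : List (ι × Bool)) :
    core (w.map (vtx φ)) = wcore (fun i => φ (FreeGroup.of i)) w := by
  have : wcore (fun i => φ (FreeGroup.of i)) w =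
      (gsub {j | j ∉ w.map Prod.fst}).map φ.toMonoidHom := by
    rw [wcore, gsub, MonoidHom.map_closure, Set.image_image]
    rfl
  ext x
  rw [mem_core_vtx, this]
  constructor
  · intro h
    exact ⟨_, h, MulAut.apply_inv_self _ φ x⟩
  · rintro ⟨y, hy, rfl⟩
    change φ⁻¹ (φ y) ∈ _
    rwa [MulAut.inv_apply_self]

end

section
variable {ι : Type} [DecidableEq ι] [Fintype ι]

theorem countable_freeGroup : Countable (FreeGroup ι) :=
  (FreeGroup.toWord_injective (α := ι)).countable

theorem exists_enum : ∃ f : ℕ → FreeGroup ι, Function.Surjective f := by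
  have := countable_freeGroup (ι := ι)
  exact exists_surjective_nat _

/-- The generators, followed by an enumeration of all elements. -/
def words : ℕ → List (FreeGroup ι)
  | 0 => (Finset.univ : Finset ι).toList.map FreeGroup.of
  | n + 1 => [exists_enum.choose n]

/-- The size of the rose of an automorphism. -/
def val (φ : MulAut (FreeGroup ι)) : Lex (ℕ → ℕ) := rsz FreeGroup.norm words φ

theorem norm_of_val {φ ψ : MulAut (FreeGroup ι)} (h : val φ = val ψ) (u : FreeGroup ι) :
    (φ⁻¹ u).norm = (ψ⁻¹ u).norm := by
  obtain ⟨n, rfl⟩ := exists_enum.choose_spec u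
  have := congrFun (congrArg ofLex h) (n + 1)
  simpa [val, rsz, words] using this

/-- The simplices of the rose of an automorphism. -/
def IsSpx (φ : MulAut (FreeGroup ι)) (τ : List (Subgroup (FreeGroup ι) × Set (FreeGroup ι))) :
    Prop := ∃ w, Nd w ∧ τ = w.map (vtx φ)

theorem IsSpx.of_val {φ ψ : MulAut (FreeGroup ι)} (h : val φ = val ψ)
    {τ : List (Subgroup (FreeGroup ι) × Set (FreeGroup ι))} (hτ : IsSpx φ τ) : IsSpx ψ τ := by
  obtain ⟨w, hw, rfl⟩ := hτ
  obtain ⟨π, hπ⟩ := exists_signed (α := ψ⁻¹ * φ) fun u => by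
    rw [MulAut.mul_apply, ← norm_of_val h, MulAut.inv_apply_self]
  refine ⟨w.map π, hπ.nd hw, ?_⟩
  rw [List.map_map]
  refine List.map_congr_left fun l _ => ?_
  rw [Function.comp_apply, ← hπ.vtx, mul_inv_cancel_left]

variable (ι) in
/-- The possible sizes of roses. -/
abbrev Ros : Type := Set.range (val (ι := ι))

/-- An automorphism of the given size. -/
def rep (ν : Ros ι) : MulAut (FreeGroup ι) := ν.2.choose

theorem val_rep (ν : Ros ι) : val (rep ν) = ν.1 := ν.2.choose_spec

theorem finite_val_zero (m : ℕ) : {φ : MulAut (FreeGroup ι) | ofLex (val φ) 0 = m}.Finite := by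
  have h1 : {g : FreeGroup ι | g.norm ≤ m}.Finite :=
    Set.Finite.preimage (FreeGroup.toWord_injective (α := ι)).injOn
      (List.finite_length_le (ι × Bool) m)
  have h2 := Set.Finite.pi (ι := ι) (t := fun _ => {g : FreeGroup ι | g.norm ≤ m}) fun _ => h1
  refine Set.Finite.of_finite_image (f := fun φ i => φ⁻¹ (FreeGroup.of i)) (h2.subset ?_) ?_
  · rintro _ ⟨φ, hφ, rfl⟩ i -
    have hφ' : ((Finset.univ : Finset ι).toList.map fun i => (φ⁻¹ (FreeGroup.of i)).norm).sum = m := by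
      have : (((Finset.univ : Finset ι).toList.map FreeGroup.of).map
          fun w => (φ⁻¹ w).norm).sum = m := hφ
      rwa [List.map_map] at this
    change (φ⁻¹ (FreeGroup.of i)).norm ≤ m
    rw [← hφ']
    exact List.single_le_sum (fun _ _ => Nat.zero_le _) _
      (List.mem_map.2 ⟨i, Finset.mem_toList.2 (Finset.mem_univ i), rfl⟩)
  · intro φ _ ψ _ h
    have : (φ⁻¹).toMonoidHom = (ψ⁻¹).toMonoidHom := by
      ext i
      exact congrFun h i
    exact inv_injective (MulEquiv.toMonoidHom_injective this)

instance : WellFoundedLT (Ros ι) := ⟨WellFounded.wellFounded_iff_has_min.2 fun s hs => by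
  let f : Ros ι → ℕ := fun a => ofLex a.1 0
  obtain ⟨a₀, ha₀, hmin⟩ := WellFounded.has_min (InvImage.wf f (wellFounded_lt (α := ℕ))) s hs
  have hfin : {a ∈ s | f a = f a₀}.Finite := by
    refine Set.Finite.of_finite_image (f := Subtype.val)
      (((finite_val_zero (ι := ι) (f a₀)).image val).subset ?_) Subtype.val_injective.injOn
    rintro _ ⟨⟨_, φ, rfl⟩, ⟨-, h⟩, rfl⟩
    exact ⟨φ, h, rfl⟩
  obtain ⟨a, ha, hle⟩ := Set.exists_min_image _ id hfin ⟨a₀, ha₀, rfl⟩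
  refine ⟨a, ha.1, fun x hx hlt => ?_⟩
  have hxa : ¬ f x < f a₀ := hmin x hx
  have hlt' : x.1 < a.1 := hlt
  obtain ⟨i, hi, hi'⟩ := hlt'
  have haa : f a = f a₀ := ha.2
  rcases Nat.eq_zero_or_pos i with rfl | hpos
  · have : f x < f a := hi'
    omega
  · have : f x = f a := hi 0 hpos
    exact absurd hlt (not_lt.2 (hle x ⟨hx, this.trans haa⟩))⟩

/-- The vertices of the rose of given size. -/
def vtxs (ν : Ros ι) (l : ι × Bool) : Subgroup (FreeGroup ι) × Set (FreeGroup ι) := vtx (rep ν) l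

open Classical in
/-- The petals of a rose which can be exchanged for an earlier rose. -/
def petals (ν : Ros ι) : Finset ι := Finset.univ.filter fun i =>
  ∃ μ < ν, ∀ w, Nd w → i ∉ w.map Prod.fst → Val vtxs μ (w.map (vtxs ν))

theorem val_vtxs (φ : MulAut (FreeGroup ι))
    (τ : List (Subgroup (FreeGroup ι) × Set (FreeGroup ι))) :
    Val vtxs (⟨val φ, φ, rfl⟩ : Ros ι) τ ↔ IsSpx φ τ :=
  ⟨fun h => IsSpx.of_val (val_rep ⟨val φ, φ, rfl⟩) h,
    fun h => IsSpx.of_val (val_rep ⟨val φ, φ, rfl⟩).symm h⟩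

theorem exists_val {τ : List (Subgroup (FreeGroup ι) × Set (FreeGroup ι))} :
    (∃ ν, Val vtxs (ν : Ros ι) τ) ↔ ∃ φ, IsSpx φ τ :=
  ⟨fun ⟨ν, h⟩ => ⟨rep ν, h⟩, fun ⟨φ, h⟩ => ⟨_, (val_vtxs φ τ).2 h⟩⟩

theorem mem_petals {ν : Ros ι} {i : ι} : i ∈ petals ν ↔
    ∃ μ < ν, ∀ w, Nd w → i ∉ w.map Prod.fst → Val vtxs μ (w.map (vtxs ν)) := by
  classical
  simp [petals]

theorem roseSys : RoseSys (vtxs (ι := ι)) core (fun ν i => rep ν (FreeGroup.of i))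
    (fun ν i h => chi (ball i) ((rep ν)⁻¹ h)) petals where
  inj ν := vtx_injective (rep ν)
  core_eq ν w _ := core_vtx (rep ν) w
  e_mul ν i a b := by rw [map_mul, chi_mul (ball_ai i)]
  e_y ν i j := by rw [MulAut.inv_apply_self, chi_ball]; simp only [eq_comm]
  mem_R ν i hi := mem_petals.1 hi
  shell μ ν h := by
    have h' : val (rep μ) < val (rep ν) := by
      rw [val_rep, val_rep]
      exact h
    obtain ⟨i, θ, h1, h2, h3⟩ := exists_exchange words (rep ν) (rep μ) h'
    refine ⟨i, mem_petals.2 ⟨⟨val θ, θ, rfl⟩, ?_, fun w hw hi => ?_⟩,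
      fun w hw hi hv => ?_⟩
    · have : val θ < val (rep ν) := h1
      rw [val_rep] at this
      exact this
    · rw [val_vtxs]
      refine ⟨w, hw, List.map_congr_left fun l hl => ?_⟩
      refine (h2 l.1 (fun h => hi ?_) l.2).symm
      exact List.mem_map.2 ⟨l, hl, h⟩
    · obtain ⟨w', -, hw'⟩ := hv
      obtain ⟨⟨i', ε⟩, hl, rfl⟩ := List.mem_map.1 hi
      have : vtxs ν (i', ε) ∈ w.map (vtxs ν) := List.mem_map.2 ⟨_, hl, rfl⟩
      rw [hw'] at this
      obtain ⟨l', -, hl'⟩ := List.mem_map.1 this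
      exact h3 ε l' hl'

end

section
variable {ι : Type} {k : ℕ}

variable (ι) in
/-- The vertices of the complex. -/
abbrev Vx : Type := Subgroup (FreeGroup ι) × Set (FreeGroup ι)

/-- The ordered simplices of the complex. -/
def IsV (τ : List (Vx ι)) : Prop := ∃ φ, IsSpx φ τ

theorem IsV.sublist {τ τ' : List (Vx ι)} (h : IsV τ) (hs : τ'.Sublist τ) : IsV τ' := by
  obtain ⟨φ, hφ⟩ := h
  exact ⟨φ, Val.sublist (D := fun φ : MulAut (FreeGroup ι) => vtx φ) hφ hs⟩

theorem isV_act (φ : MulAut (FreeGroup ι)) {τ : List (Vx ι)} :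
    IsV (τ.map (actV φ)) ↔ IsV τ := by
  have key : ∀ (φ : MulAut (FreeGroup ι)) {τ : List (Vx ι)}, IsV τ → IsV (τ.map (actV φ)) := by
    rintro φ _ ⟨ψ, w, hw, rfl⟩
    refine ⟨φ * ψ, w, hw, ?_⟩
    rw [List.map_map]
    exact List.map_congr_left fun l _ => actV_vtx φ ψ l
  refine ⟨fun h => ?_, key φ⟩
  have := key φ⁻¹ h
  rw [List.map_map] at this
  have e : (actV φ⁻¹ : Vx ι → Vx ι) ∘ actV φ = id := by
    funext v
    exact actV_inv φ v
  rwa [e, List.map_id] at this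

theorem core_sublist {τ τ' : List (Vx ι)} (hs : τ'.Sublist τ) : core τ ≤ core τ' := fun _ hx =>
  mem_core.2 fun v hv => mem_core.1 hx v (hs.subset hv)

variable (ι k) in
/-- All functions of tuples of group elements and of ordered simplices. -/
abbrev Cch : Type := (Fin k → FreeGroup ι) → List (Vx ι) → ℤ

variable (ι k) in
/-- The action of automorphisms. -/
def cchRep : Representation ℤ (MulAut (FreeGroup ι)) (Cch ι k) :=
  mkRep (fun g =>
    { toFun := fun c h τ => c (fun l => g⁻¹ (h l)) (τ.map (actV g⁻¹))
      map_zero' := rfl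
      map_add' := fun _ _ => rfl })
    (fun c => by
      funext h τ
      have e : (actV 1 : Vx ι → Vx ι) = id := funext fun v => actV_one v
      change c (fun l => (1 : MulAut (FreeGroup ι))⁻¹ (h l))
        (τ.map (actV (1 : MulAut (FreeGroup ι))⁻¹)) = _
      rw [inv_one, e, List.map_id]
      rfl)
    (fun g g' c => by
      funext h τ
      change c (fun l => (g * g')⁻¹ (h l)) (τ.map (actV (g * g')⁻¹)) =
        c (fun l => g'⁻¹ (g⁻¹ (h l))) ((τ.map (actV g⁻¹)).map (actV g'⁻¹))
      rw [mul_inv_rev, List.map_map]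
      congr 1
      exact List.map_congr_left fun v _ => (actV_mul _ _ v))

theorem cchRep_apply (g : MulAut (FreeGroup ι)) (c : Cch ι k) (h : Fin k → FreeGroup ι)
    (τ : List (Vx ι)) :
    cchRep ι k g c h τ = c (fun l => g⁻¹ (h l)) (τ.map (actV g⁻¹)) := rfl

open Classical in
variable (ι k) in
/-- The differential. -/
def cchD : Cch ι k →+ Cch ι k where
  toFun c h τ := if IsV τ ∧ ∀ l, h l ∈ core τ then dl τ (c h) else 0
  map_zero' := by
    funext h τ
    simp only [Pi.zero_apply, ite_eq_right_iff]
    exact fun _ => dl_zero τ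
  map_add' c c' := by
    funext h τ
    simp only [Pi.add_apply]
    split_ifs
    · exact dl_add τ _ _
    · rfl

theorem cchD_pos {c : Cch ι k} {h : Fin k → FreeGroup ι} {τ : List (Vx ι)} (hτ : IsV τ)
    (hh : ∀ l, h l ∈ core τ) : cchD ι k c h τ = dl τ (c h) := if_pos ⟨hτ, hh⟩

theorem cchD_neg {c : Cch ι k} {h : Fin k → FreeGroup ι} {τ : List (Vx ι)}
    (hτ : ¬ (IsV τ ∧ ∀ l, h l ∈ core τ)) : cchD ι k c h τ = 0 := if_neg hτ

variable (ι k) in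
/-- The cochains of a given length. -/
def coch (ℓ : ℕ) : AddSubgroup (Cch ι k) where
  carrier := {c | (∀ h τ, c h τ ≠ 0 → IsV τ ∧ τ.length = ℓ ∧ ∀ l, h l ∈ core τ) ∧
    ∀ τ, IsV τ → AddOn (core τ) fun h => c h τ}
  zero_mem' := ⟨fun _ _ h => absurd rfl h, fun τ _ => AddOn.zero _ _⟩
  add_mem' := by
    rintro a b ⟨ha, ha'⟩ ⟨hb, hb'⟩
    refine ⟨fun h τ hn => ?_, fun τ hτ => ?_⟩
    · by_cases h0 : a h τ = 0
      · exact hb h τ fun h1 => hn (by rw [Pi.add_apply, Pi.add_apply, h0, h1, add_zero])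
      · exact ha h τ h0
    · have := (ha' τ hτ).sub ((hb' τ hτ).mul (-1))
      simpa using this
  neg_mem' := by
    rintro a ⟨ha, ha'⟩
    refine ⟨fun h τ hn => ha h τ fun h1 => hn (by rw [Pi.neg_apply, Pi.neg_apply, h1, neg_zero]),
      fun τ hτ => ?_⟩
    have := (ha' τ hτ).mul (-1)
    simpa using this

theorem dl_cchD {c : Cch ι k} {h : Fin k → FreeGroup ι} {τ : List (Vx ι)} (hτ : IsV τ)
    (hh : ∀ l, h l ∈ core τ) : dl τ (cchD ι k c h) = 0 := by
  rw [← dl_dl τ (c h)]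
  exact dl_congr fun τ' h' _ => cchD_pos (hτ.sublist h') fun l => core_sublist h' (hh l)

variable (ι k) in
theorem cch_cx : Cx (cchRep ι k) (coch ι k) (cchD ι k) where
  stable p g c hc := by
    refine ⟨fun h τ hn => ?_, fun τ hτ => ?_⟩
    · obtain ⟨h1, h2, h3⟩ := hc.1 _ _ hn
      refine ⟨(isV_act _).1 h1, by simpa using h2, fun l => ?_⟩
      have := (mem_core_act g⁻¹).1 (h3 l)
      rwa [inv_inv, MulAut.apply_inv_self] at this
    · have := hc.2 _ ((isV_act g⁻¹).2 hτ)
      intro h hh j a ha b hb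
      have hm : ∀ x ∈ core τ, g⁻¹ x ∈ core (τ.map (actV g⁻¹)) := fun x hx =>
        (mem_core_act g⁻¹).2 (by rwa [inv_inv, MulAut.apply_inv_self])
      have key := this (fun l => g⁻¹ (h l)) (fun l => hm _ (hh l)) j _ (hm a ha) _ (hm b hb)
      rw [← map_mul] at key
      simp only [cchRep_apply]
      have hu : ∀ x, (fun l => g⁻¹ (Function.update h j x l)) =
          Function.update (fun l => g⁻¹ (h l)) j (g⁻¹ x) := fun x => by
        funext l
        by_cases hl : l = j
        · subst hl; simp
        · simp [hl]
      rw [hu, hu, hu]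
      exact key
  equi g c := by
    funext h τ
    have hm : (∀ l, h l ∈ core τ) ↔ ∀ l, g⁻¹ (h l) ∈ core (τ.map (actV g⁻¹)) :=
      forall_congr' fun l => by rw [mem_core_act, inv_inv, MulAut.apply_inv_self]
    rw [cchRep_apply]
    by_cases H : IsV τ ∧ ∀ l, h l ∈ core τ
    · rw [cchD_pos H.1 H.2, cchD_pos ((isV_act _).2 H.1) (hm.1 H.2), dl_map]
      rfl
    · rw [cchD_neg H, cchD_neg fun H' => H ⟨(isV_act _).1 H'.1, hm.2 H'.2⟩]
  maps p c hc := by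
    refine ⟨fun h τ hn => ?_, fun τ hτ => ?_⟩
    · by_cases H : IsV τ ∧ ∀ l, h l ∈ core τ
      · refine ⟨H.1, ?_, H.2⟩
        rw [cchD_pos H.1 H.2] at hn
        by_contra hl
        refine hn (dl_eq_zero fun τ' _ h' => ?_)
        by_contra h0
        have := (hc.1 _ _ h0).2.1
        omega
      · exact absurd (cchD_neg H) hn
    · have key : AddOn (core τ) fun h => dl τ (c h) := AddOn.dl τ fun τ' h' =>
        (hc.2 τ' (hτ.sublist h')).mono (core_sublist h')
      intro h hh j a ha b hb
      have hu : ∀ x ∈ core τ, ∀ l, Function.update h j x l ∈ core τ := fun x hx l => by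
        by_cases hl : l = j
        · subst hl; simpa using hx
        · simpa [hl] using hh l
      simp only []
      rw [cchD_pos hτ (hu _ (mul_mem ha hb)), cchD_pos hτ (hu _ ha), cchD_pos hτ (hu _ hb)]
      exact key h hh j a ha b hb
  sq c := by
    funext h τ
    by_cases H : IsV τ ∧ ∀ l, h l ∈ core τ
    · rw [cchD_pos H.1 H.2, dl_cchD H.1 H.2]
      rfl
    · exact cchD_neg H

theorem isV_nil : IsV ([] : List (Vx ι)) := ⟨1, [], List.nodup_nil, rfl⟩

variable [DecidableEq ι] [Fintype ι]

theorem val_isV {ν : Ros ι} {τ : List (Vx ι)} (h : Val vtxs ν τ) : IsV τ := exists_val.1 ⟨ν, h⟩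

theorem cch_exact {j : ℕ} (hj : j + 1 + k < Fintype.card ι) (c : Cch ι k)
    (hc : c ∈ coch ι k (j + 1)) (hd : cchD ι k c = 0) : ∃ b ∈ coch ι k j, cchD ι k b = c := by
  classical
  have hco : IsCo (vtxs (ι := ι)) core (j + 1) c :=
    ⟨fun h τ hn => by
      obtain ⟨h1, h2⟩ := hc.1 h τ hn
      exact ⟨exists_val.2 h1, h2⟩, fun ν τ hν => hc.2 τ (val_isV hν)⟩
  obtain ⟨b, hb1, hb2, hb3⟩ := roseSys.exact c hj hco fun ν τ h hν hh => by
    rw [← cchD_pos (val_isV hν) hh, hd]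
    rfl
  refine ⟨fun h τ => if ∀ l, h l ∈ core τ then b h τ else 0, ⟨fun h τ hn => ?_, fun τ hτ => ?_⟩, ?_⟩
  · by_cases H : ∀ l, h l ∈ core τ
    · have hn : b h τ ≠ 0 := fun h0 => hn ((if_pos H).trans h0)
      obtain ⟨h1, h2⟩ := hb1 h τ hn
      exact ⟨exists_val.1 h1, by omega, H⟩
    · exact absurd (if_neg H) hn
  · obtain ⟨ν, hν⟩ := exists_val.2 hτ
    intro h hh j a ha b hb
    have hu : ∀ x ∈ core τ, ∀ l, Function.update h j x l ∈ core τ := fun x hx l => by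
      by_cases hl : l = j
      · subst hl; simpa using hx
      · simpa [hl] using hh l
    simp only []
    rw [if_pos (hu _ (mul_mem ha hb)), if_pos (hu _ ha), if_pos (hu _ hb)]
    exact hb2 ν τ hν h hh j a ha b hb
  · funext h τ
    by_cases H : IsV τ ∧ ∀ l, h l ∈ core τ
    · obtain ⟨ν, hν⟩ := exists_val.2 H.1
      rw [cchD_pos H.1 H.2, ← hb3 ν τ h hν H.2]
      exact dl_congr fun τ' h' _ => if_pos fun l => core_sublist h' (H.2 l)
    · rw [cchD_neg H]
      by_contra h0
      have := hc.1 h τ (Ne.symm h0)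
      exact H ⟨this.1, this.2.2⟩

/-- Injectivity of the augmentation. -/
theorem cch_zero (hk : k < Fintype.card ι) (c : Cch ι k) (hc : c ∈ coch ι k 0)
    (hd : cchD ι k c = 0) : c = 0 := by
  have hco : IsCo (vtxs (ι := ι)) core 0 c :=
    ⟨fun h τ hn => by
      obtain ⟨h1, h2⟩ := hc.1 h τ hn
      exact ⟨exists_val.2 h1, h2⟩, fun ν τ hν => hc.2 τ (val_isV hν)⟩
  obtain ⟨b, hb1, hb2, hb3⟩ := roseSys.exact c (by omega) hco fun ν τ h hν hh => by
    rw [← cchD_pos (val_isV hν) hh, hd]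
    rfl
  funext h τ
  by_contra h0
  obtain ⟨h1, h2, h3⟩ := hc.1 h τ h0
  obtain ⟨ν, hν⟩ := exists_val.2 h1
  apply h0
  rw [← hb3 ν τ h hν h3, List.length_eq_zero_iff.1 h2]
  rfl

end

section
variable {ι : Type}

/-- The automorphism inverting some of the generators. -/
def flipHom (ε : ι → Bool) : FreeGroup ι →* FreeGroup ι := FreeGroup.lift fun i => lt (i, ε i)

theorem lt_not (i : ι) (b : Bool) : lt (i, !b) = (lt (i, b))⁻¹ := lt_opp (i, b)

theorem flipHom_lt (ε : ι → Bool) (i : ι) (b : Bool) :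
    flipHom ε (lt (i, b)) = lt (i, if b then ε i else !ε i) := by
  have h : flipHom ε (lt (i, true)) = lt (i, ε i) := FreeGroup.lift_apply_of
  cases b
  · rw [show false = !true from rfl, lt_not, map_inv, h, ← lt_not]
    rfl
  · exact h

theorem flipHom_comp (ε : ι → Bool) : (flipHom ε).comp (flipHom ε) = MonoidHom.id _ := by
  ext i
  change flipHom ε (flipHom ε (lt (i, true))) = lt (i, true)
  rw [flipHom_lt, flipHom_lt]
  cases ε i <;> simp

/-- The automorphism permuting the letters. -/
def letterAut (s : Equiv.Perm ι) (ε : ι → Bool) : MulAut (FreeGroup ι) :=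
  ((flipHom ε).toMulEquiv (flipHom ε) (flipHom_comp ε) (flipHom_comp ε)).trans
    (FreeGroup.freeGroupCongr s)

theorem letterAut_signed (s : Equiv.Perm ι) (ε : ι → Bool) :
    Signed (letterAut s ε) fun t => (s t.1, if t.2 then ε t.1 else !ε t.1) := by
  rintro ⟨i, b⟩
  change FreeGroup.map s (flipHom ε (lt (i, b))) = _
  rw [flipHom_lt, lt, FreeGroup.map.mk]
  rfl

variable {κ : Type} {m : ℕ} (e : Fin m ⊕ κ ≃ ι)

/-- The standard simplex. -/
def stw : List (ι × Bool) := (List.finRange m).map fun p => (e (Sum.inl p), true)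

@[simp] theorem length_stw : (stw e).length = m := by simp [stw]

theorem fst_stw : (stw e).map Prod.fst = (List.finRange m).map fun p => e (Sum.inl p) := by
  rw [stw, List.map_map]
  rfl

theorem nd_stw : Nd (stw e) := by
  rw [Nd, fst_stw]
  exact (List.nodup_finRange m).map fun p q h => Sum.inl_injective (e.injective h)

theorem exists_letterAut {w : List (ι × Bool)} (hw : Nd w) (hm : w.length = m) :
    ∃ (α : MulAut (FreeGroup ι)) (π : ι × Bool → ι × Bool), Signed α π ∧ w = (stw e).map π := by
  subst hm
  let x : Fin w.length ↪ ι := ⟨fun p => e (Sum.inl p), fun p q h => Sum.inl_injective (e.injective h)⟩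
  have hinj : Function.Injective fun p : Fin w.length => (w.get p).1 := fun p q h => by
    have := List.nodup_iff_injective_get.1 hw
    have h2 := @this ⟨p, by simp⟩ ⟨q, by simp⟩ (by simpa using h)
    exact Fin.ext (Fin.mk.inj_iff.1 h2)
  let y : Fin w.length ↪ ι := ⟨_, hinj⟩
  obtain ⟨s, hs⟩ := (Equiv.Perm.isMultiplyPretransitive ι w.length).exists_smul_eq x y
  have hs' : ∀ p, s (e (Sum.inl p)) = (w.get p).1 := fun p => congrArg (fun f => f p) hs
  refine ⟨_, _, letterAut_signed s fun i => Sum.elim (fun p => (w.get p).2) (fun _ => true)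
    (e.symm i), ?_⟩
  rw [stw, List.map_map]
  refine (List.map_get_finRange w).symm.trans (List.map_congr_left fun p _ => ?_)
  simp [hs']

/-- The inclusion of the free factor. -/
def incl : FreeGroup κ →* FreeGroup ι := FreeGroup.map fun j => e (Sum.inr j)

theorem incl_of (j : κ) : incl e (FreeGroup.of j) = FreeGroup.of (e (Sum.inr j)) :=
  FreeGroup.map.of

/-- The retraction onto the free factor. -/
def ret : FreeGroup ι →* FreeGroup κ :=
  FreeGroup.lift fun i => Sum.elim (fun _ => 1) FreeGroup.of (e.symm i)

@[simp] theorem ret_incl (x : FreeGroup κ) : ret e (incl e x) = x := by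
  have : (ret e).comp (incl e) = MonoidHom.id _ := by
    ext j
    simp [incl, ret]
  exact DFunLike.congr_fun this x

theorem incl_injective : Function.Injective (incl e) := Function.LeftInverse.injective (ret_incl e)

theorem incl_ret (x : FreeGroup ι) :
    incl e (ret e x) = retr (Set.range fun j => e (Sum.inr j)) x := by
  have : (incl e).comp (ret e) = retr (Set.range fun j => e (Sum.inr j)) := by
    ext i
    obtain ⟨p | j, rfl⟩ := e.surjective i
    · rw [retr_of_not]
      · simp [ret]
      · rintro ⟨j, hj⟩
        simpa using e.injective hj
    · rw [retr_of _ (Set.mem_range_self j)]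
      simp [ret, incl]
  exact DFunLike.congr_fun this x

theorem mem_gsub_incl {x : FreeGroup ι} :
    x ∈ gsub (Set.range fun j => e (Sum.inr j)) ↔ incl e (ret e x) = x := by
  rw [mem_gsub, incl_ret]

theorem compl_stw : {j | j ∉ (stw e).map Prod.fst} = Set.range fun j => e (Sum.inr j) := by
  rw [fst_stw]
  ext i
  obtain ⟨p | j, rfl⟩ := e.surjective i <;> simp

/-- The vertices of the standard simplex. -/
def stx : List (Vx ι) := (stw e).map (vtx 1)

theorem isV_stx : IsV (stx e) := ⟨1, stw e, nd_stw e, rfl⟩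

theorem mem_core_stx {x : FreeGroup ι} : x ∈ core (stx e) ↔ incl e (ret e x) = x := by
  rw [stx, mem_core_one, compl_stw, mem_gsub_incl]

theorem exists_stx [Finite ι] {τ : List (Vx ι)} (hτ : IsV τ) (hm : τ.length = m) :
    ∃ g : MulAut (FreeGroup ι), τ = (stx e).map (actV g) := by
  classical
  obtain ⟨φ, w, hw, rfl⟩ := hτ
  obtain ⟨α, π, h, rfl⟩ := exists_letterAut e hw (by simpa using hm)
  refine ⟨φ * α, ?_⟩
  rw [stx, List.map_map, List.map_map]
  refine List.map_congr_left fun l _ => ?_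
  rw [Function.comp_apply, Function.comp_apply, actV_vtx, mul_one, h.vtx]

/-- The endomorphism of an element of the stabilizer. -/
def stHom (x : Ext (Fin m × Bool) (FreeGroup κ)) : FreeGroup ι →* FreeGroup ι :=
  FreeGroup.lift fun i => Sum.elim
    (fun p => (incl e (x.left (p, true)))⁻¹ * FreeGroup.of i * incl e (x.left (p, false)))
    (fun j => incl e (x.right (FreeGroup.of j))) (e.symm i)

theorem stHom_inl (x : Ext (Fin m × Bool) (FreeGroup κ)) (p : Fin m) :
    stHom e x (FreeGroup.of (e (Sum.inl p))) = (incl e (x.left (p, true)))⁻¹ *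
      FreeGroup.of (e (Sum.inl p)) * incl e (x.left (p, false)) := by
  simp [stHom]

theorem stHom_incl (x : Ext (Fin m × Bool) (FreeGroup κ)) (y : FreeGroup κ) :
    stHom e x (incl e y) = incl e (x.right y) := by
  have : (stHom e x).comp (incl e) = (incl e).comp x.right.toMonoidHom := by
    ext j
    simp [stHom, incl]
  exact DFunLike.congr_fun this y

theorem stHom_mul (x y : Ext (Fin m × Bool) (FreeGroup κ)) :
    stHom e (x * y) = (stHom e x).comp (stHom e y) := by
  ext i
  obtain ⟨p | j, rfl⟩ := e.surjective i
  · rw [stHom_inl, MonoidHom.comp_apply, stHom_inl, map_mul, map_mul, map_inv, stHom_inl,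
      stHom_incl, stHom_incl]
    simp [mul_assoc]
  · rw [← incl_of, stHom_incl, MonoidHom.comp_apply, stHom_incl, stHom_incl]
    rfl

theorem stHom_one : stHom e 1 = MonoidHom.id _ := by
  ext i
  obtain ⟨p | j, rfl⟩ := e.surjective i
  · rw [stHom_inl]
    simp
  · rw [← incl_of, stHom_incl]
    rfl

/-- The map from the stabilizer to the automorphism group. -/
def stab : Ext (Fin m × Bool) (FreeGroup κ) →* MulAut (FreeGroup ι) where
  toFun x := (stHom e x).toMulEquiv (stHom e x⁻¹)
    (by rw [← stHom_mul, inv_mul_cancel, stHom_one])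
    (by rw [← stHom_mul, mul_inv_cancel, stHom_one])
  map_one' := MulEquiv.ext fun y => DFunLike.congr_fun (stHom_one e) y
  map_mul' x x' := MulEquiv.ext fun y => DFunLike.congr_fun (stHom_mul e x x') y

theorem stab_incl (x : Ext (Fin m × Bool) (FreeGroup κ)) (y : FreeGroup κ) :
    stab e x (incl e y) = incl e (x.right y) := stHom_incl e x y

theorem incl_mem_cof (p : Fin m) (y : FreeGroup κ) : incl e y ∈ cof (e (Sum.inl p)) := by
  rw [cof_eq]
  have h : incl e y ∈ gsub (Set.range fun j => e (Sum.inr j)) := by rw [mem_gsub_incl, ret_incl]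
  refine Subgroup.closure_mono (Set.image_mono ?_) h
  rintro _ ⟨j, rfl⟩ h
  simpa using e.injective h

theorem stab_stx (x : Ext (Fin m × Bool) (FreeGroup κ)) : (stx e).map (actV (stab e x)) = stx e := by
  have h1 : ∀ (x : Ext (Fin m × Bool) (FreeGroup κ)) (p : Fin m), ∀ y ∈ cof (e (Sum.inl p)),
      stab e x y ∈ cof (e (Sum.inl p)) := by
    intro x p
    change cof (e (Sum.inl p)) ≤ (cof (e (Sum.inl p))).comap (stHom e x)
    conv_lhs => rw [cof]
    rw [Subgroup.closure_le]
    rintro _ ⟨i, hi, rfl⟩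
    obtain ⟨q | j, rfl⟩ := e.surjective i
    · rw [SetLike.mem_coe, Subgroup.mem_comap, stHom_inl]
      exact mul_mem (mul_mem (inv_mem (incl_mem_cof e p _)) (of_mem_cof hi)) (incl_mem_cof e p _)
    · rw [SetLike.mem_coe, Subgroup.mem_comap, ← incl_of, stHom_incl]
      exact incl_mem_cof e p _
  have h2 : ∀ (x : Ext (Fin m × Bool) (FreeGroup κ)) (p : Fin m), ∀ y ∈ dbl (e (Sum.inl p), true),
      stab e x y ∈ dbl (e (Sum.inl p), true) := by
    rintro x p _ ⟨a, ha, b, hb, rfl⟩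
    refine ⟨stab e x a * (incl e (x.left (p, true)))⁻¹,
      mul_mem (h1 x p a ha) (inv_mem (incl_mem_cof e p _)),
      incl e (x.left (p, false)) * stab e x b,
      mul_mem (incl_mem_cof e p _) (h1 x p b hb), ?_⟩
    have h3 : stab e x (lt (e (Sum.inl p), true)) = (incl e (x.left (p, true)))⁻¹ *
      lt (e (Sum.inl p), true) * incl e (x.left (p, false)) := stHom_inl e x p
    rw [map_mul, map_mul, h3]
    simp only [mul_assoc]
  rw [stx, List.map_map]
  refine List.map_congr_left fun l hl => ?_
  obtain ⟨p, -, rfl⟩ := List.mem_map.1 hl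
  rw [Function.comp_apply]
  have e1 : vtx 1 (e (Sum.inl p), true) = (cof (e (Sum.inl p)), dbl (e (Sum.inl p), true)) := by
    refine Prod.ext (Subgroup.map_id _) (Set.image_id _)
  have h3 : ∀ y, stab e x (stab e x⁻¹ y) = y := fun y => by
    rw [map_inv]
    exact MulAut.apply_inv_self _ _ y
  rw [e1]
  refine Prod.ext (le_antisymm ?_ ?_) (subset_antisymm ?_ ?_)
  · rintro _ ⟨y, hy, rfl⟩
    exact h1 x p y hy
  · intro y hy
    exact ⟨_, h1 x⁻¹ p y hy, h3 y⟩
  · rintro _ ⟨y, hy, rfl⟩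
    exact h2 x p y hy
  · intro y hy
    exact ⟨_, h2 x⁻¹ p y hy, h3 y⟩

end

section
variable {ι κ : Type} {m : ℕ} (e : Fin m ⊕ κ ≃ ι)

/-- Left translation on one of two copies of a group. -/
def onePerm (F : Type) [Group F] : F →* Equiv.Perm (F × Bool) where
  toFun u :=
    { toFun := fun z => (if z.2 then u * z.1 else z.1, z.2)
      invFun := fun z => (if z.2 then u⁻¹ * z.1 else z.1, z.2)
      left_inv := by rintro ⟨z, _ | _⟩ <;> simp
      right_inv := by rintro ⟨z, _ | _⟩ <;> simp }
  map_one' := by ext ⟨z, _ | _⟩ <;> simp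
  map_mul' u v := by ext ⟨z, _ | _⟩ <;> simp [mul_assoc]

/-- The exchange of the two copies. -/
def swapPerm (F : Type) : Equiv.Perm (F × Bool) where
  toFun z := (z.1, !z.2)
  invFun z := (z.1, !z.2)
  left_inv z := by simp
  right_inv z := by simp

theorem eq_one_of_conj (p : Fin m) {u v : FreeGroup κ}
    (h : FreeGroup.of (e (Sum.inl p)) * incl e v = incl e u * FreeGroup.of (e (Sum.inl p))) :
    u = 1 ∧ v = 1 := by
  let R : FreeGroup ι →* Equiv.Perm (FreeGroup κ × Bool) := FreeGroup.lift fun i =>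
    Sum.elim (fun _ => swapPerm _) (fun j => onePerm _ (FreeGroup.of j)) (e.symm i)
  have h1 : R (FreeGroup.of (e (Sum.inl p))) = swapPerm _ := by simp [R]
  have h2 : ∀ x, R (incl e x) = onePerm _ x := by
    intro x
    have : R.comp (incl e) = onePerm _ := by
      ext1 j
      simp [R, incl]
    exact DFunLike.congr_fun this x
  have h3 := congrArg R h
  rw [map_mul, map_mul, h1, h2, h2] at h3
  have h4 := DFunLike.congr_fun h3 (1, false)
  have h5 := DFunLike.congr_fun h3 (1, true)
  simp [swapPerm, onePerm] at h4 h5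
  exact ⟨h4.symm, h5⟩

theorem stab_injective : Function.Injective (stab e) := by
  refine (injective_iff_map_eq_one _).2 fun x hx => ?_
  have hx' : ∀ y, stHom e x y = y := fun y => DFunLike.congr_fun hx y
  have h1 : ∀ p, x.left (p, true) = 1 ∧ x.left (p, false) = 1 := fun p => by
    have := hx' (FreeGroup.of (e (Sum.inl p)))
    rw [stHom_inl, mul_assoc, inv_mul_eq_iff_eq_mul] at this
    exact eq_one_of_conj e p this
  refine ext_ext (fun ⟨p, b⟩ => ?_) (MulEquiv.ext fun y => incl_injective e ?_)
  · cases b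
    · exact (h1 p).2
    · exact (h1 p).1
  · rw [← stHom_incl]
    exact hx' _

theorem exists_stab {θ : MulAut (FreeGroup ι)} (hθ : (stx e).map (actV θ) = stx e) :
    ∃ x, stab e x = θ := by
  have e1 : ∀ p, vtx 1 (e (Sum.inl p), true) = (cof (e (Sum.inl p)), dbl (e (Sum.inl p), true)) :=
    fun p => Prod.ext (Subgroup.map_id _) (Set.image_id _)
  have hθ' : (stx e).map (actV θ⁻¹) = stx e := by
    conv_lhs => rw [← hθ]
    rw [List.map_map]
    conv_rhs => rw [← List.map_id (stx e)]
    exact List.map_congr_left fun v _ => actV_inv θ v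
  have key : ∀ θ : MulAut (FreeGroup ι), (stx e).map (actV θ) = stx e → ∀ p,
      actV θ (cof (e (Sum.inl p)), dbl (e (Sum.inl p), true)) =
        (cof (e (Sum.inl p)), dbl (e (Sum.inl p), true)) := by
    intro θ h p
    have h1 : ∀ v ∈ stx e, actV θ v = v := by
      have : (stx e).map (actV θ) = (stx e).map id := h.trans (List.map_id _).symm
      exact List.map_inj_left.1 this
    have h2 := h1 (vtx 1 (e (Sum.inl p), true))
      (List.mem_map.2 ⟨_, List.mem_map.2 ⟨p, List.mem_finRange p, rfl⟩, rfl⟩)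
    rwa [e1] at h2
  have hcof : ∀ (p : Fin m) (y : FreeGroup ι), y ∈ cof (e (Sum.inl p)) → θ y ∈ cof (e (Sum.inl p)) :=
    fun p y hy => by
      have := congrArg Prod.fst (key θ hθ p)
      rw [← show _ = cof (e (Sum.inl p)) from this]
      exact ⟨y, hy, rfl⟩
  have hincl : ∀ θ : MulAut (FreeGroup ι), (stx e).map (actV θ) = stx e → ∀ y,
      incl e (ret e (θ (incl e y))) = θ (incl e y) := by
    intro θ h y
    rw [← mem_core_stx, ← h, mem_core_act, MulAut.inv_apply_self, mem_core_stx, ret_incl]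
  let ψ : MulAut (FreeGroup κ) := ((ret e).comp (θ.toMonoidHom.comp (incl e))).toMulEquiv
    ((ret e).comp ((θ⁻¹).toMonoidHom.comp (incl e)))
    (MonoidHom.ext fun y => by
      change ret e (θ⁻¹ (incl e (ret e (θ (incl e y))))) = y
      rw [hincl θ hθ, MulAut.inv_apply_self, ret_incl])
    (MonoidHom.ext fun y => by
      change ret e (θ (incl e (ret e (θ⁻¹ (incl e y))))) = y
      rw [hincl _ hθ', MulAut.apply_inv_self, ret_incl])
  have hψ : ∀ y, incl e (ψ y) = θ (incl e y) := fun y => hincl θ hθ y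
  have hp : ∀ p, ∃ a b : FreeGroup κ, θ (FreeGroup.of (e (Sum.inl p))) =
      incl e a * FreeGroup.of (e (Sum.inl p)) * incl e b := by
    intro p
    have h1 : θ (lt (e (Sum.inl p), true)) ∈ dbl (e (Sum.inl p), true) := by
      have := congrArg Prod.snd (key θ hθ p)
      rw [← show _ = dbl (e (Sum.inl p), true) from this]
      exact ⟨_, lt_mem_dbl _, rfl⟩
    obtain ⟨a, ha, b, hb, hab⟩ := h1
    let T : Set ι := {i | ∀ q, i = e (Sum.inl q) → q = p}
    have hT : ∀ s : List (Fin m), p ∉ s → θ (FreeGroup.of (e (Sum.inl p))) ∈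
        gsub {i | ∀ q ∈ s, i ≠ e (Sum.inl q)} := by
      intro s
      induction s with
      | nil =>
        intro _
        have : {i | ∀ q ∈ ([] : List (Fin m)), i ≠ e (Sum.inl q)} = Set.univ := by
          ext i
          simp
        rw [this, gsub, Set.image_univ, FreeGroup.closure_range_of]
        trivial
      | cons q s ih =>
        intro hs
        rw [List.mem_cons, not_or] at hs
        have : {i | ∀ r ∈ q :: s, i ≠ e (Sum.inl r)} =
            {e (Sum.inl q)}ᶜ ∩ {i | ∀ r ∈ s, i ≠ e (Sum.inl r)} := by
          ext i
          simp
        rw [this, mem_gsub_inter]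
        refine ⟨?_, ih hs.2⟩
        rw [← cof_eq]
        refine hcof q _ (of_mem_cof fun h => hs.1 ?_)
        exact Sum.inl_injective (e.injective h)
    have h2 := hT ((List.finRange m).filter (· ≠ p)) (by simp)
    have h3 : {i | ∀ q ∈ (List.finRange m).filter (· ≠ p), i ≠ e (Sum.inl q)} = T := by
      ext i
      simp only [List.mem_filter, List.mem_finRange, true_and, decide_eq_true_eq, T,
        Set.mem_ofPred_eq]
      exact forall_congr' fun q => ⟨fun h h' => by_contra fun hq => h hq h', fun h hq h' => hq (h h')⟩
    rw [h3] at h2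
    have h4 : T ∩ {e (Sum.inl p)}ᶜ = Set.range fun j => e (Sum.inr j) := by
      ext i
      obtain ⟨q | j, rfl⟩ := e.surjective i <;> simp [T]
    have h5 : ∀ c ∈ cof (e (Sum.inl p)), incl e (ret e c) = retr T c := fun c hc => by
      rw [cof_eq, mem_gsub] at hc
      rw [incl_ret, ← h4, ← retr_retr, hc]
    refine ⟨ret e a, ret e b, ?_⟩
    rw [h5 a ha, h5 b hb, ← mem_gsub.1 h2]
    change retr T (θ (lt (e (Sum.inl p), true))) = _
    rw [hab, map_mul, map_mul]
    change _ * retr T (FreeGroup.of _) * _ = _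
    rw [retr_of T]
    exact fun q hq => (Sum.inl_injective (e.injective hq)).symm
  choose a b hab using hp
  refine ⟨⟨fun z => if z.2 then (a z.1)⁻¹ else b z.1, ψ⟩, MulEquiv.toMonoidHom_injective ?_⟩
  ext i
  obtain ⟨p | j, rfl⟩ := e.surjective i
  · change stHom e _ _ = θ _
    rw [stHom_inl, hab]
    simp
  · change stHom e _ _ = θ _
    rw [← incl_of, stHom_incl, ← hψ]

variable {k : ℕ}

/-- Evaluation at the standard simplex. -/
def stEv : coch ι k m →+ multi (FreeGroup κ) k where
  toFun c := ⟨fun h => c.1 (fun l => incl e (h l)) (stx e), fun h j a b => by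
    have := c.2.2 (stx e) (isV_stx e)
    have key := this (fun l => incl e (h l)) (fun l => by rw [mem_core_stx, ret_incl]) j
      (incl e a) (by rw [mem_core_stx, ret_incl]) (incl e b) (by rw [mem_core_stx, ret_incl])
    rw [← map_mul] at key
    simp only [comp_update_aut (incl e)]
    exact key⟩
  map_zero' := rfl
  map_add' _ _ := rfl

theorem stEv_apply (c : coch ι k m) (h : Fin k → FreeGroup κ) :
    (stEv e c).1 h = c.1 (fun l => incl e (h l)) (stx e) := rfl

theorem stEv_isCoind [Finite ι] : IsCoind (subRep (cchRep ι k) _ ((cch_cx ι k).stable m))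
    ((formRep k).comp (SemidirectProduct.rightHom : Ext (Fin m × Bool) (FreeGroup κ) →* _))
    (stab e) (stEv e) where
  compat x c := Subtype.ext <| funext fun h => by
    change c.1 (fun l => (stab e x)⁻¹ (incl e (h l))) ((stx e).map (actV (stab e x)⁻¹)) =
      c.1 (fun l => incl e ((x.right)⁻¹ (h l))) (stx e)
    rw [← map_inv, stab_stx]
    refine congrArg (fun f => c.1 f _) (funext fun l => ?_)
    rw [stab_incl]
    rfl
  inj := stab_injective e
  zero c hc := by
    refine Subtype.ext (funext fun h => funext fun τ => ?_)
    by_contra h0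
    obtain ⟨h1, h2, h3⟩ := c.2.1 h τ h0
    obtain ⟨g, rfl⟩ := exists_stx e h1 h2
    have := congrFun (congrArg Subtype.val (hc g⁻¹)) fun l => ret e (g⁻¹ (h l))
    refine h0 (Eq.trans ?_ this)
    rw [stEv_apply, subRep_val, cchRep_apply, inv_inv]
    refine congrArg (fun f => c.1 f _) (funext fun l => ?_)
    have := h3 l
    rw [mem_core_act, mem_core_stx] at this
    rw [this, MulAut.apply_inv_self]
  ex u hu := by
    classical
    let P : List (Vx ι) → Prop := fun τ => ∃ g : MulAut (FreeGroup ι), τ = (stx e).map (actV g⁻¹)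
    let c : Cch ι k := fun h τ => if H : P τ ∧ ∀ l, h l ∈ core τ then
      (u H.1.choose).1 fun l => ret e (H.1.choose (h l)) else 0
    have hval : ∀ (g : MulAut (FreeGroup ι)) h, (∀ l, h l ∈ core ((stx e).map (actV g⁻¹))) →
        c h ((stx e).map (actV g⁻¹)) = (u g).1 fun l => ret e (g (h l)) := by
      intro g h hh
      have H : P ((stx e).map (actV g⁻¹)) ∧ ∀ l, h l ∈ core ((stx e).map (actV g⁻¹)) :=
        ⟨⟨g, rfl⟩, hh⟩
      refine (dif_pos H).trans ?_
      generalize_proofs hP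
      have hs := hP.choose_spec
      generalize hP.choose = g' at hs
      obtain ⟨x, hx⟩ : ∃ x, stab e x = g' * g⁻¹ := by
        refine exists_stab e ?_
        have e2 : (actV (g' * g⁻¹) : Vx ι → Vx ι) = actV g' ∘ actV g⁻¹ :=
          funext fun v => actV_mul _ _ v
        rw [e2, ← List.map_map, hs, List.map_map]
        conv_rhs => rw [← List.map_id (stx e)]
        exact List.map_congr_left fun v _ => actV_inv' g' v
      have hx' : g' = stab e x * g := by rw [hx, inv_mul_cancel_right]
      rw [hx', hu]
      change (u g).1 _ = _
      refine congrArg (u g).1 (funext fun l => ?_)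
      have h3 := hh l
      rw [mem_core_act, inv_inv, mem_core_stx] at h3
      change (x.right)⁻¹ (ret e (stab e x (g (h l)))) = _
      rw [← h3, stab_incl, ret_incl, ret_incl]
      exact MulAut.inv_apply_self _ x.right _
    have hsupp : ∀ h τ, ¬ (P τ ∧ ∀ l, h l ∈ core τ) → c h τ = 0 := fun h τ H => dif_neg H
    have hc : c ∈ coch ι k m := by
      refine ⟨fun h τ hn => ?_, fun τ hτ => ?_⟩
      · have H : P τ ∧ ∀ l, h l ∈ core τ := by_contra fun H => hn (hsupp h τ H)
        obtain ⟨⟨g, rfl⟩, H2⟩ := H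
        exact ⟨(isV_act _).2 (isV_stx e), by simp [stx], H2⟩
      · by_cases hP : P τ
        · obtain ⟨g, rfl⟩ := hP
          intro h hh j a ha b hb
          have hu' : ∀ x ∈ core ((stx e).map (actV g⁻¹)), ∀ l,
              Function.update h j x l ∈ core ((stx e).map (actV g⁻¹)) := fun x hx l => by
            by_cases hl : l = j
            · subst hl; simpa using hx
            · simpa [hl] using hh l
          simp only []
          rw [hval g _ (hu' _ (mul_mem ha hb)), hval g _ (hu' _ ha), hval g _ (hu' _ hb)]
          simp only [comp_update_aut fun y => ret e (g y), map_mul]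
          exact (u g).2 _ _ _ _
        · intro h _ j a _ b _
          simp only [hsupp _ _ fun H => hP H.1, add_zero]
    refine ⟨⟨c, hc⟩, fun g => Subtype.ext <| funext fun h => ?_⟩
    rw [stEv_apply, subRep_val, cchRep_apply]
    change c _ _ = _
    rw [hval]
    · refine congrArg (u g).1 (funext fun l => ?_)
      rw [MulAut.apply_inv_self, ret_incl]
    · intro l
      rw [mem_core_act, inv_inv, MulAut.apply_inv_self, mem_core_stx, ret_incl]

end

section
variable {ι κ : Type} {k : ℕ}

open Classical in
/-- Multiadditive functions are the cochains of length zero. -/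
def zeroIn : multi (FreeGroup ι) k →+ coch ι k 0 where
  toFun c := ⟨fun h τ => if τ = [] then c.1 h else 0, fun h τ hn => by
      have hτ : τ = [] := by_contra fun H => hn (if_neg H)
      subst hτ
      exact ⟨isV_nil, rfl, fun l => mem_core.2 fun v hv => absurd hv List.not_mem_nil⟩,
    fun τ _ h _ j a _ b _ => by
      beta_reduce
      split_ifs
      · exact c.2 h j a b
      · rfl⟩
  map_zero' := Subtype.ext <| funext fun h => funext fun τ => ite_self _
  map_add' c c' := Subtype.ext <| funext fun h => funext fun τ => by
    change (if τ = [] then c.1 h + c'.1 h else 0) =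
      (if τ = [] then c.1 h else 0) + (if τ = [] then c'.1 h else 0)
    split_ifs <;> simp

theorem zeroIn_apply (c : multi (FreeGroup ι) k) (h : Fin k → FreeGroup ι) :
    (zeroIn c).1 h [] = c.1 h := by
  simp [zeroIn]

theorem zeroIn_compat : Compat (formRep k) (subRep (cchRep ι k) _ ((cch_cx ι k).stable 0))
    (MonoidHom.id _) zeroIn := fun g c => Subtype.ext <| funext fun h => funext fun τ => by
  change (if τ = [] then c.1 (fun l => g⁻¹ (h l)) else 0) =
    if τ.map (actV g⁻¹) = [] then c.1 (fun l => g⁻¹ (h l)) else 0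
  simp only [List.map_eq_nil_iff]

/-- Evaluation at the empty simplex. -/
def zeroOut : coch ι k 0 →+ multi (FreeGroup ι) k where
  toFun c := ⟨fun h => c.1 h [], fun h j a b => by
    have hm : ∀ x : FreeGroup ι, x ∈ core ([] : List (Vx ι)) := fun x =>
      mem_core.2 fun v hv => absurd hv List.not_mem_nil
    exact c.2.2 [] isV_nil h (fun l => hm _) j a (hm a) b (hm b)⟩
  map_zero' := rfl
  map_add' _ _ := rfl

theorem zeroOut_compat : Compat (subRep (cchRep ι k) _ ((cch_cx ι k).stable 0)) (formRep k)
    (MonoidHom.id _) zeroOut := fun _ _ => rfl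

variable (e : Fin 1 ⊕ κ ≃ ι)

/-- The two copies of the group acting on a stable letter. -/
def boolEquiv : Option Unit ≃ Fin 1 × Bool where
  toFun o := (0, o.isNone)
  invFun x := if x.2 then none else some ()
  left_inv o := by cases o <;> rfl
  right_inv := by rintro ⟨p, _ | _⟩ <;> simp [Subsingleton.elim p 0]

/-- The action of one copy of the group by right translation of a stable letter. -/
def rightStab : Ext Unit (FreeGroup κ) →* MulAut (FreeGroup ι) :=
  (stab e).comp ((extCongr (FreeGroup κ) boolEquiv).symm.toMonoidHom.comp (optS Unit (FreeGroup κ)))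

theorem rightStab_incl (x : Ext Unit (FreeGroup κ)) (y : FreeGroup κ) :
    rightStab e x (incl e y) = incl e (x.right y) := stab_incl e _ y

theorem rightStab_inl (x : Ext Unit (FreeGroup κ)) :
    rightStab e x (FreeGroup.of (e (Sum.inl 0))) =
      FreeGroup.of (e (Sum.inl 0)) * incl e (x.left ()) := by
  refine (stHom_inl e _ 0).trans ?_
  simp [extCongr, optS, boolEquiv]

/-- Restriction to the free factor. -/
def restr : multi (FreeGroup ι) k →+ multi (FreeGroup κ) k where
  toFun c := ⟨fun h => c.1 fun l => incl e (h l), fun h j a b => by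
    beta_reduce
    simp only [comp_update_aut (incl e), map_mul]
    exact c.2 _ _ _ _⟩
  map_zero' := rfl
  map_add' _ _ := rfl

theorem restr_compat : Compat ((formRep k).comp (rightStab e))
    ((formRep k).comp SemidirectProduct.rightHom) (MonoidHom.id _) (restr e) := fun x c =>
  Subtype.ext <| funext fun h => by
    refine congrArg c.1 (funext fun l => ?_)
    rw [← map_inv, rightStab_incl]
    rfl

/-- Minus the evaluation of the first variable at a stable letter. -/
def evStable : multi (FreeGroup ι) (k + 1) →+ multi (FreeGroup κ) k :=
  -((restr e).comp (AddMonoidHom.mk' (fun c => formEv c (FreeGroup.of (e (Sum.inl 0))))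
    fun _ _ => rfl))

theorem cons_map {A B : Type} (f : A → B) (a : A) (h : Fin k → A) :
    (fun l => f ((Fin.cons a h : Fin (k + 1) → A) l)) = Fin.cons (f a) fun l => f (h l) :=
  funext fun l => Fin.cases rfl (fun _ => rfl) l

theorem evStable_compat : Compat ((formRep (k + 1)).comp (rightStab e)) (formRep k)
    (SemidirectProduct.inr (φ := piAct Unit (FreeGroup κ))) (evStable e) := fun φ c =>
  Subtype.ext <| funext fun h => by
    change -c.1 _ = -c.1 _
    rw [cons_map, ← map_inv, ← map_inv, rightStab_inl]
    refine congrArg (fun f => -c.1 f) ?_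
    have h1 : (SemidirectProduct.inr φ⁻¹ : Ext Unit (FreeGroup κ)).left () = 1 := rfl
    rw [h1, map_one, mul_one]
    exact congrArg (fun f => (Fin.cons _ f : Fin (k + 1) → FreeGroup ι)) (funext fun l => rightStab_incl e _ _)

theorem evStable_unit (w : FreeGroup κ) (c : multi (FreeGroup ι) (k + 1)) :
    evStable e (((formRep (k + 1)).comp (rightStab e)) (unitI (FreeGroup κ) w) c) =
      formEv (restr e c) w + evStable e c := Subtype.ext <| funext fun h => by
  change -c.1 _ = c.1 (fun l => incl e ((Fin.cons w h : Fin (k + 1) → FreeGroup κ) l)) + -c.1 _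
  rw [cons_map, cons_map, ← map_inv, ← map_inv, rightStab_inl]
  have hi : (fun l => rightStab e (unitI (FreeGroup κ) w⁻¹) (incl e (h l))) =
      fun l => incl e (h l) := funext fun l => rightStab_incl e _ _
  rw [hi, show (unitI (FreeGroup κ) w⁻¹).left () = w⁻¹ from rfl, map_inv]
  have key := fun a b => c.2 (Fin.cons 1 fun l => incl e (h l)) 0 a b
  simp only [Fin.update_cons_zero] at key
  have h1 := key (FreeGroup.of (e (Sum.inl 0)) * (incl e w)⁻¹) (incl e w)
  rw [inv_mul_cancel_right] at h1
  rw [h1]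
  ring

theorem stEv_zeroIn (c : multi (FreeGroup ι) k) :
    stEv e ((cch_cx ι k).map 0 (zeroIn c)) = restr e c := Subtype.ext <| funext fun h => by
  refine (cchD_pos (isV_stx e) fun l => ?_).trans ?_
  · rw [mem_core_stx, ret_incl]
  · rw [show stx e = [vtx 1 (e (Sum.inl 0), true)] from rfl, dl, dl, sub_zero, zeroIn_apply]
    rfl

end

theorem van_formRep (i : ℕ) : ∀ (k : ℕ), 1 ≤ k → ∀ (ι : Type) [Finite ι],
    2 * i + k + 3 ≤ Nat.card ι → Van (formRep (F := FreeGroup ι) k) i := by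
  induction i using Nat.strong_induction_on with
  | _ i ih =>
  rintro k hk ι _ hn c hc
  classical
  have := Fintype.ofFinite ι
  have hdec : ∀ j, j ≤ Nat.card ι → Nonempty (Fin j ⊕ Fin (Nat.card ι - j) ≃ ι) := fun j hj =>
    ⟨(finSumFinEquiv.trans (finCongr (by omega))).trans (Finite.equivFin ι).symm⟩
  have hext : ∀ (I : Type) [Finite I] (j k' r : ℕ), k ≤ k' → r < i →
      2 * r + k' + 3 + j ≤ Nat.card ι →
      Van ((formRep k').comp (SemidirectProduct.rightHom :
        Ext I (FreeGroup (Fin (Nat.card ι - j))) →* _)) r := fun I _ j k' r h1 h2 h3 =>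
    van_ext I k' r fun j' r' h4 h5 => ih r' (by omega) j' (by omega) _ (by
      rw [Nat.card_fin]; omega)
  obtain ⟨e⟩ := hdec 1 (by omega)
  have hcard : Fintype.card ι = Nat.card ι := Nat.card_eq_fintype_card.symm
  have h01 := (cch_cx ι k).inj_zero_one i (cch_zero (by omega))
    (fun j hj => cch_exact (by omega)) fun j r hj hr => by
      obtain ⟨e⟩ := hdec j (by omega)
      have hI := stEv_isCoind (k := k) e
      exact Van.of_inj hI.compat (hI.van_inj r)
        (hext _ j k r le_rfl (by omega) (by omega))
  have hmap : Compat (subRep (cchRep ι k) _ ((cch_cx ι k).stable 0))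
      (subRep (cchRep ι k) _ ((cch_cx ι k).stable 1)) (MonoidHom.id _) ((cch_cx ι k).map 0) :=
    fun g c => Subtype.ext ((cch_cx ι k).equi g c.1)
  have hI := stEv_isCoind (k := k) e
  let F := FreeGroup (Fin (Nat.card ι - 1))
  have hb : Compat ((formRep k).comp (SemidirectProduct.rightHom : Ext (Fin 1 × Bool) F →* _))
      ((formRep k).comp SemidirectProduct.rightHom) (extCongr F boolEquiv).symm.toMonoidHom
      (AddMonoidHom.id _) := fun _ _ => rfl
  have hb' : Compat ((formRep k).comp (SemidirectProduct.rightHom : Ext (Option Unit) F →* _))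
      ((formRep k).comp SemidirectProduct.rightHom) (extCongr F boolEquiv).toMonoidHom
      (AddMonoidHom.id _) := fun _ _ => rfl
  have c1 : dC (subRep (cchRep ι k) _ ((cch_cx ι k).stable 0)) i (pull (MonoidHom.id _) zeroIn c) = 0 := by
    rw [dC_pull zeroIn_compat, hc, pull_zero]
  have c2 : dC (subRep (cchRep ι k) _ ((cch_cx ι k).stable 1)) i
      (pull (MonoidHom.id _) ((cch_cx ι k).map 0) (pull (MonoidHom.id _) zeroIn c)) = 0 := by
    rw [dC_pull hmap, c1, pull_zero]
  set c3 := pull (stab e) (stEv e) (pull (MonoidHom.id _) ((cch_cx ι k).map 0)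
    (pull (MonoidHom.id _) zeroIn c)) with hc3
  have hd3 : dC ((formRep k).comp (SemidirectProduct.rightHom : Ext (Fin 1 × Bool) F →* _)) i c3 = 0 := by
    rw [hc3, dC_pull hI.compat, c2, pull_zero]
  have hopt : Inj ((formRep k).comp (SemidirectProduct.rightHom : Ext (Option Unit) F →* _))
      ((formRep k).comp (SemidirectProduct.rightHom : Ext Unit F →* _)) (optS Unit F)
      (AddMonoidHom.id _) i := by
    cases i with
    | zero => exact Split.inj_res_zero (π := optP Unit F) (σ := (formRep k).comp SemidirectProduct.rightHom)
    | succ i =>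
      exact (opt_split Unit F).inj_res_succ (opt_isHom Unit F k)
        (hext Unit 1 (k + 1) i (by omega) (by omega) (by omega))
  suffices H : IsB ((formRep k).comp (SemidirectProduct.rightHom : Ext Unit F →* _)) i
      (pull (optS Unit F) (AddMonoidHom.id _) 
        (pull (extCongr F boolEquiv).symm.toMonoidHom (AddMonoidHom.id _) c3)) by
    have h3 := (hopt _ (by rw [dC_pull hb, hd3, pull_zero]) H).pull hb'
    have h4 : pull (extCongr F boolEquiv).toMonoidHom (AddMonoidHom.id _)
      (pull (extCongr F boolEquiv).symm.toMonoidHom (AddMonoidHom.id _) c3) = c3 :=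
      funext fun a => congrArg c3 (funext fun j => MulEquiv.symm_apply_apply _ _)
    rw [h4] at h3
    exact (h01 _ c1 (hI.van_inj i _ c2 h3)).pull zeroOut_compat
  obtain ⟨k, rfl⟩ : ∃ k', k = k' + 1 := ⟨k - 1, by omega⟩
  have hr : Compat (formRep (k + 1)) ((formRep (k + 1)).comp (rightStab e)) (rightStab e)
    (AddMonoidHom.id _) := fun _ _ => rfl
  have h5 := (unit_split F).isB_of_ev (unit_isHom F k) (unit_isHom F (k + 1)) (restr_compat e)
    (evStable_compat e) (fun w c => evStable_unit e w c) i
    (fun q' hq => ih q' (by omega) _ (by omega) _ (by rw [Nat.card_fin]; omega))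
    (pull (rightStab e) (AddMonoidHom.id _) c) (by rw [dC_pull hr, hc, pull_zero])
  convert h5 using 1
  funext a
  exact stEv_zeroIn e _

section
variable {ι : Type} {k : ℕ}

theorem multi_eq_zero (c : multi (FreeGroup ι) k)
    (hc : ∀ p : Fin k → ι, c.1 (fun l => FreeGroup.of (p l)) = 0) : c = 0 := by
  have key : ∀ (s : Finset (Fin k)) (h : Fin k → FreeGroup ι),
      (∀ l ∉ s, ∃ i, h l = FreeGroup.of i) → c.1 h = 0 := by
    intro s
    induction s using Finset.induction_on with
    | empty =>
      intro h hh
      choose p hp using fun l => hh l (Finset.notMem_empty l)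
      rw [funext hp, hc]
    | insert j s hj ih =>
      intro h hh
      let f : FreeGroup ι →* Multiplicative ℤ :=
        MonoidHom.mk' (fun x => Multiplicative.ofAdd (c.1 (Function.update h j x)))
          fun a b => congrArg Multiplicative.ofAdd (c.2 h j a b)
      have hf : f = 1 := FreeGroup.ext_hom _ _ fun i => by
        refine congrArg Multiplicative.ofAdd (ih _ fun l hl => ?_)
        by_cases hlj : l = j
        · subst hlj
          exact ⟨i, Function.update_self ..⟩
        · rw [Function.update_of_ne hlj]
          exact hh l fun h => (Finset.mem_insert.1 h).elim hlj hl
      have := congrArg Multiplicative.toAdd (DFunLike.congr_fun hf (h j))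
      rwa [show f (h j) = Multiplicative.ofAdd (c.1 (Function.update h j (h j))) from rfl,
        Function.update_eq_self] at this
  exact Subtype.ext (funext fun h => key Finset.univ h fun l hl => absurd (Finset.mem_univ l) hl)

end

section
variable (n k : ℕ)

/-- The class of an element in the abelianization. -/
def toAb (x : FreeGrp n) : AbH n := Additive.ofMul (Abelianization.of x)

theorem toAb_mul (x y : FreeGrp n) : toAb n (x * y) = toAb n x + toAb n y := rfl

/-- The basis of the abelianization. -/
def abBasis : Module.Basis (Fin n) ℤ (AbH n) := FreeAbelianGroup.basis (Fin n)

theorem abBasis_apply (i : Fin n) : abBasis n i = toAb n (FreeGroup.of i) :=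
  Finsupp.toFreeAbelianGroup_single i 1 |>.trans (one_zsmul _)

variable {n k}

/-- The value of a tensor of linear forms. -/
def tensorVal (x : Fin k → AbH n) : (⨂[ℤ]^k (Module.Dual ℤ (AbH n))) →ₗ[ℤ] ℤ :=
  PiTensorProduct.lift ((MultilinearMap.mkPiAlgebra ℤ (Fin k) ℤ).compLinearMap
    fun l => LinearMap.applyₗ (x l))

theorem tensorVal_tprod (x : Fin k → AbH n) (f : Fin k → Module.Dual ℤ (AbH n)) :
    tensorVal x (PiTensorProduct.tprod ℤ f) = ∏ l, f l (x l) := by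
  simp [tensorVal]

theorem tensorVal_update (x : Fin k → AbH n) (j : Fin k) (a b : AbH n) :
    tensorVal (Function.update x j (a + b)) =
      tensorVal (Function.update x j a) + tensorVal (Function.update x j b) := by
  refine PiTensorProduct.ext (MultilinearMap.ext fun f => ?_)
  simp only [LinearMap.compMultilinearMap_apply, LinearMap.add_apply, tensorVal_tprod]
  exact ((MultilinearMap.mkPiAlgebra ℤ (Fin k) ℤ).compLinearMap f).map_update_add x j a b

variable (n k) in
/-- The form associated with a tensor of linear forms. -/
def toMulti : (⨂[ℤ]^k (Module.Dual ℤ (AbH n))) →+ multi (FreeGrp n) k where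
  toFun t := ⟨fun h => tensorVal (fun l => toAb n (h l)) t, fun h j a b => by
    beta_reduce
    simp only [comp_update_aut (toAb n), toAb_mul, tensorVal_update, LinearMap.add_apply]⟩
  map_zero' := Subtype.ext <| funext fun h => map_zero _
  map_add' _ _ := Subtype.ext <| funext fun h => map_add _ _ _

theorem toMulti_of (t : ⨂[ℤ]^k (Module.Dual ℤ (AbH n))) (p : Fin k → Fin n) :
    (toMulti n k t).1 (fun l => FreeGroup.of (p l)) =
      (Basis.piTensorProduct fun _ : Fin k => (abBasis n).dualBasis).repr t p := by
  have : tensorVal (fun l => toAb n (FreeGroup.of (p l))) =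
      (Basis.piTensorProduct fun _ : Fin k => (abBasis n).dualBasis).coord p := by
    refine PiTensorProduct.ext (MultilinearMap.ext fun f => ?_)
    rw [LinearMap.compMultilinearMap_apply, LinearMap.compMultilinearMap_apply, tensorVal_tprod,
      Module.Basis.coord_apply, Basis.piTensorProduct_repr_tprod_apply]
    refine Finset.prod_congr rfl fun l _ => ?_
    rw [← abBasis_apply, Module.Basis.dualBasis_repr]
  exact DFunLike.congr_fun this t

theorem toMulti_bijective : Function.Bijective (toMulti n k) := by
  constructor
  · refine (injective_iff_map_eq_zero _).2 fun t ht => ?_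
    refine (Basis.piTensorProduct fun _ : Fin k => (abBasis n).dualBasis).ext_elem fun p => ?_
    rw [← toMulti_of, ht]
    simp
  · intro c
    let b := Basis.piTensorProduct fun _ : Fin k => (abBasis n).dualBasis
    refine ⟨b.equivFun.symm fun p => c.1 fun l => FreeGroup.of (p l), ?_⟩
    rw [← sub_eq_zero]
    refine multi_eq_zero _ fun p => sub_eq_zero.2 ((toMulti_of _ p).trans ?_)
    exact congrFun (b.equivFun.apply_symm_apply _) p

theorem toMulti_compat : Compat (tensorPowerRep (abRep n).dual k) (formRep k) (MonoidHom.id _)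
    (toMulti n k) := fun φ t => Subtype.ext <| funext fun h => by
  have : (tensorVal fun l => toAb n (h l)) ∘ₗ tensorPowerRep (abRep n).dual k φ =
      tensorVal fun l => toAb n (φ⁻¹ (h l)) := by
    refine PiTensorProduct.ext (MultilinearMap.ext fun f => ?_)
    rw [LinearMap.compMultilinearMap_apply, LinearMap.compMultilinearMap_apply,
      LinearMap.comp_apply, show tensorPowerRep (abRep n).dual k φ =
        PiTensorProduct.map fun _ => (abRep n).dual φ from rfl,
      PiTensorProduct.map_tprod, tensorVal_tprod, tensorVal_tprod]
    rfl
  exact DFunLike.congr_fun this t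

end

end GrpCoh

/-- For every `k ≥ 1`, every `n`, and every degree `i ≥ 0` with
`2i ≤ n - 4k`, the group cohomology `H^i(Aut(F_n); (H^*)^{⊗k})` vanishes. -/
theorem stmt2 (k : ℕ) (hk : 1 ≤ k) (n : ℕ) (i : ℕ) (h : 2 * i + 4 * k ≤ n) :
    Limits.IsZero (groupCohomology (dualTensorPowerRep n k) i) := by
  refine GrpCoh.Van.isZero (GrpCoh.Van.of_equiv (MulEquiv.refl _)
    (AddEquiv.ofBijective _ GrpCoh.toMulti_bijective) GrpCoh.toMulti_compat
    (GrpCoh.van_formRep i k hk (Fin n) ?_))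
  rw [Nat.card_fin]
  omega
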